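/- Let P1 and P2 be m×n matrix pencils. Then orbᵉ(P1) covers orbᵉ(P2) if and only if the partitions R, L, and J_μ of P2 are obtained from those of P1 by applying exactly one of the following four rules: C1: a minimum rightward coin move in R (or in L) starting from a column j ≥ 1; C2: if the rightmost column of R (or of L) consists of a single coin, remove that coin and append it as a new rightmost column of some J_μ; C3: a minimum leftward coin move in some J_μ; C4: letting k be the total number of coins in all of the longest (lowest) rows of all the J_μ, remove these k coins, add one more coin, and distribute the resulting k+1 coins to the columns r_0,…,r_t of R and l_0,…,l_{k−t−1} of L (for some t) in such a way that every previously nonzero column of R and of L receives a coin (this rule applies only when k+1 is at least the total number of nonzero columns of R and L). -/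

import Mathlib

/-!
Basic framework: a complex `m × n` matrix pencil `A - λ B` is formalized as the
pair `(A, B)` of matrices.  We define strict equivalence, congruence,
skew-symmetry, orbits, direct sums, and the cover relations for the orbit
closure hierarchies (in the Euclidean topology).
-/

open Matrix

noncomputable section

/-- An `m × n` complex matrix pencil `A - λ B`, formalized as the pair `(A, B)`. -/
abbrev Pencil (m n : ℕ) : Type :=
  Matrix (Fin m) (Fin n) ℂ × Matrix (Fin m) (Fin n) ℂ

namespace Pencil

/-- Strict equivalence of matrix pencils: `Q⁻¹ * A * R = C` and `Q⁻¹ * B * R = D`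
for some invertible `Q`, `R`. -/
def StrictEquiv {m n : ℕ} (P Q : Pencil m n) : Prop :=
  ∃ (S : Matrix (Fin m) (Fin m) ℂ) (R : Matrix (Fin n) (Fin n) ℂ),
    IsUnit S ∧ IsUnit R ∧ S⁻¹ * P.1 * R = Q.1 ∧ S⁻¹ * P.2 * R = Q.2

/-- The strict-equivalence orbit of a pencil. -/
def orbE {m n : ℕ} (P : Pencil m n) : Set (Pencil m n) :=
  {Q | StrictEquiv P Q}

/-- A pencil `A - λ B` is skew-symmetric if `Aᵀ = -A` and `Bᵀ = -B`. -/
def IsSkew {n : ℕ} (P : Pencil n n) : Prop :=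
  P.1ᵀ = -P.1 ∧ P.2ᵀ = -P.2

/-- Congruence of (square) matrix pencils: `Sᵀ * A * S = C` and `Sᵀ * B * S = D`
for some invertible `S`. -/
def Congruent {n : ℕ} (P Q : Pencil n n) : Prop :=
  ∃ S : Matrix (Fin n) (Fin n) ℂ,
    IsUnit S ∧ Sᵀ * P.1 * S = Q.1 ∧ Sᵀ * P.2 * S = Q.2

/-- The congruence orbit of a pencil. -/
def orbC {n : ℕ} (P : Pencil n n) : Set (Pencil n n) :=
  {Q | Congruent P Q}

/-- Direct (block-diagonal) sum of two pencils. -/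
def dsum {m n p q : ℕ} (P : Pencil m n) (Q : Pencil p q) : Pencil (m + p) (n + q) :=
  ((fromBlocks P.1 0 0 Q.1).submatrix finSumFinEquiv.symm finSumFinEquiv.symm,
   (fromBlocks P.2 0 0 Q.2).submatrix finSumFinEquiv.symm finSumFinEquiv.symm)

/-- Transport a pencil along equalities of its dimensions. -/
def cast {m n m' n' : ℕ} (hm : m = m') (hn : n = n') (P : Pencil m n) : Pencil m' n' :=
  (P.1.submatrix (finCongr hm.symm) (finCongr hn.symm),
   P.2.submatrix (finCongr hm.symm) (finCongr hn.symm))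

/-- `orbE P1` covers `orbE P2` in the closure hierarchy of strict-equivalence
orbits: `P1` is not strictly equivalent to `P2`, `orbE P2 ⊆ closure (orbE P1)`,
and there is no intermediate orbit strictly between them. -/
def CoversE {m n : ℕ} (P1 P2 : Pencil m n) : Prop :=
  ¬ StrictEquiv P1 P2 ∧ orbE P2 ⊆ closure (orbE P1) ∧
    ¬ ∃ P : Pencil m n, ¬ StrictEquiv P P1 ∧ ¬ StrictEquiv P P2 ∧
        orbE P ⊆ closure (orbE P1) ∧ orbE P2 ⊆ closure (orbE P)

/-- `orbC P1` covers `orbC P2` in the closure hierarchy of congruence orbits of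
skew-symmetric pencils: `P1` is not congruent to `P2`,
`orbC P2 ⊆ closure (orbC P1)`, and there is no congruence orbit of a
skew-symmetric pencil strictly between them. -/
def CoversC {n : ℕ} (P1 P2 : Pencil n n) : Prop :=
  ¬ Congruent P1 P2 ∧ orbC P2 ⊆ closure (orbC P1) ∧
    ¬ ∃ P : Pencil n n, IsSkew P ∧ ¬ Congruent P P1 ∧ ¬ Congruent P P2 ∧
        orbC P ⊆ closure (orbC P1) ∧ orbC P2 ⊆ closure (orbC P)

end Pencil

/-! Canonical building blocks. -/

/-- The `k × k` Jordan block `J_k(μ)`. -/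
def Jmat (k : ℕ) (μ : ℂ) : Matrix (Fin k) (Fin k) ℂ :=
  Matrix.of fun i j => if (j : ℕ) = (i : ℕ) then μ else if (j : ℕ) = (i : ℕ) + 1 then 1 else 0

/-- The `k × (k+1)` matrix `F_k` with ones on the superdiagonal. -/
def Fmat (k : ℕ) : Matrix (Fin k) (Fin (k + 1)) ℂ :=
  Matrix.of fun i j => if (j : ℕ) = (i : ℕ) + 1 then 1 else 0

/-- The `k × (k+1)` matrix `G_k` with ones on the diagonal. -/
def Gmat (k : ℕ) : Matrix (Fin k) (Fin (k + 1)) ℂ :=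
  Matrix.of fun i j => if (j : ℕ) = (i : ℕ) then 1 else 0

/-- The Kronecker block `E_k(μ) = J_k(μ) - λ I_k`. -/
def Eblk (k : ℕ) (μ : ℂ) : Pencil k k := (Jmat k μ, 1)

/-- The Kronecker block `E_k(∞) = I_k - λ J_k(0)`. -/
def EInfblk (k : ℕ) : Pencil k k := (1, Jmat k 0)

/-- The Kronecker block `L_k = F_k - λ G_k`. -/
def Lblk (k : ℕ) : Pencil k (k + 1) := (Fmat k, Gmat k)

/-- The Kronecker block `L_kᵀ = F_kᵀ - λ G_kᵀ`. -/
def LTblk (k : ℕ) : Pencil (k + 1) k := ((Fmat k)ᵀ, (Gmat k)ᵀ)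

/-- The skew-symmetric matrix `[[0, X], [-Xᵀ, 0]]`. -/
def skewPair {p q : ℕ} (X : Matrix (Fin p) (Fin q) ℂ) :
    Matrix (Fin (p + q)) (Fin (p + q)) ℂ :=
  (fromBlocks 0 X (-Xᵀ) 0).submatrix finSumFinEquiv.symm finSumFinEquiv.symm

/-- The skew-symmetric canonical block `H_h(μ)` (size `2h × 2h`). -/
def Hblk (h : ℕ) (μ : ℂ) : Pencil (h + h) (h + h) :=
  (skewPair (Jmat h μ), skewPair (1 : Matrix (Fin h) (Fin h) ℂ))

/-- The skew-symmetric canonical block `K_k = H_k(∞)` (size `2k × 2k`). -/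
def Kblk (k : ℕ) : Pencil (k + k) (k + k) :=
  (skewPair (1 : Matrix (Fin k) (Fin k) ℂ), skewPair (Jmat k 0))

/-- The skew-symmetric canonical block `M_m` (size `(2m+1) × (2m+1)`). -/
def Mblk (m : ℕ) : Pencil (m + (m + 1)) (m + (m + 1)) :=
  (skewPair (Fmat m), skewPair (Gmat m))

/-! Kronecker canonical forms as multisets of block descriptors. -/

/-- Descriptor of a Kronecker canonical block. -/
inductive KBlock : Type
  | E : ℕ → ℂ → KBlock        -- `E_k(μ)`, `μ ∈ ℂ`
  | Einf : ℕ → KBlock          -- `E_k(∞)`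
  | L : ℕ → KBlock             -- `L_k`
  | LT : ℕ → KBlock            -- `L_kᵀ`

namespace KBlock

/-- Number of rows of a block. -/
def rows : KBlock → ℕ
  | E k _ => k
  | Einf k => k
  | L k => k
  | LT k => k + 1

/-- Number of columns of a block. -/
def cols : KBlock → ℕ
  | E k _ => k
  | Einf k => k
  | L k => k + 1
  | LT k => k

/-- The index of a block. -/
def idx : KBlock → ℕ
  | E k _ => k
  | Einf k => k
  | L k => k
  | LT k => k

/-- A block is valid (may occur in a Kronecker canonical form) if Jordan blocks
have size at least one. -/
def valid : KBlock → Prop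
  | E k _ => 1 ≤ k
  | Einf k => 1 ≤ k
  | L _ => True
  | LT _ => True

/-- The pencil corresponding to a block descriptor. -/
def toPencil : (b : KBlock) → Pencil b.rows b.cols
  | E k μ => Eblk k μ
  | Einf k => EInfblk k
  | L k => Lblk k
  | LT k => LTblk k

end KBlock

/-- The block `E_k(μ)` for an eigenvalue `μ ∈ ℂ ∪ {∞}`; `none` encodes `∞`. -/
def Eb : Option ℂ → ℕ → KBlock
  | some μ, k => KBlock.E k μ
  | none, k => KBlock.Einf k

/-- Total number of rows of a list of blocks. -/
def rowsSum : List KBlock → ℕ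
  | [] => 0
  | b :: t => b.rows + rowsSum t

/-- Total number of columns of a list of blocks. -/
def colsSum : List KBlock → ℕ
  | [] => 0
  | b :: t => b.cols + colsSum t

/-- The direct sum of the blocks in a list. -/
def pencilOfList : (l : List KBlock) → Pencil (rowsSum l) (colsSum l)
  | [] => (0, 0)
  | b :: t => Pencil.dsum b.toPencil (pencilOfList t)

/-- `s` is the multiset of blocks of a Kronecker canonical form of `P`, i.e. `P`
is strictly equivalent to the direct sum of the blocks of `s`. -/
def RepresentsE {m n : ℕ} (P : Pencil m n) (s : Multiset KBlock) : Prop :=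
  (∀ b ∈ s, b.valid) ∧
  ∃ (l : List KBlock) (hm : rowsSum l = m) (hn : colsSum l = n),
    (l : Multiset KBlock) = s ∧
    Pencil.StrictEquiv (Pencil.cast hm hn (pencilOfList l)) P

/-- Like `RepresentsE`, but also allowing degenerate (empty) blocks such as
`E_0(μ)` among the summands. -/
def WeakRepresentsE {m n : ℕ} (P : Pencil m n) (s : Multiset KBlock) : Prop :=
  ∃ (l : List KBlock) (hm : rowsSum l = m) (hn : colsSum l = n),
    (l : Multiset KBlock) = s ∧
    Pencil.StrictEquiv (Pencil.cast hm hn (pencilOfList l)) P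

/-! Weyr characteristics of a Kronecker canonical form. -/

open scoped Classical

/-- `r_i`: the number of `L`-blocks with index `≥ i`. -/
def rW (s : Multiset KBlock) (i : ℕ) : ℕ :=
  Multiset.card (s.filter fun b => ∃ a, b = KBlock.L a ∧ i ≤ a)

/-- `l_i`: the number of `Lᵀ`-blocks with index `≥ i`. -/
def lW (s : Multiset KBlock) (i : ℕ) : ℕ :=
  Multiset.card (s.filter fun b => ∃ a, b = KBlock.LT a ∧ i ≤ a)

/-- `j_i^μ`: the number of `E`-blocks with eigenvalue `μ ∈ ℂ ∪ {∞}` and index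
`≥ i`. -/
def jW (s : Multiset KBlock) (μ : Option ℂ) (i : ℕ) : ℕ :=
  Multiset.card (s.filter fun b => ∃ a, b = Eb μ a ∧ i ≤ a)

/-! Integer partitions (as finitely supported non-increasing sequences of
column heights of coin diagrams) and coin moves. -/

/-- An integer partition, presented by the sequence of its parts (equivalently,
of the column heights of its coin diagram), indexed from `0`. -/
def IsPartitionFun (p : ℕ → ℕ) : Prop :=
  (∀ i, p (i + 1) ≤ p i) ∧ ∃ N, ∀ i, N ≤ i → p i = 0

/-- Partial sum of the first `m` parts. -/
def psum (p : ℕ → ℕ) (m : ℕ) : ℕ := ∑ i ∈ Finset.range m, p i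

/-- Dominance order on partitions (of the same number). -/
def Dominates (p q : ℕ → ℕ) : Prop :=
  (∀ m, psum q m ≤ psum p m) ∧ ∃ N, ∀ m, N ≤ m → psum p m = psum q m

/-- `p` covers `q` in the dominance order on partitions. -/
def DomCovers (p q : ℕ → ℕ) : Prop :=
  Dominates p q ∧ p ≠ q ∧
    ∀ r, IsPartitionFun r → Dominates p r → Dominates r q → r = p ∨ r = q

/-- `q` is obtained from `p` by moving one coin from column `j` rightward
(one column rightward or one row downward, i.e. to a later column). -/
def CoinMoveRight (p q : ℕ → ℕ) (j : ℕ) : Prop :=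
  ∃ k, j < k ∧ q j + 1 = p j ∧ q k = p k + 1 ∧ ∀ i, i ≠ j → i ≠ k → q i = p i

/-- Minimum rightward coin move from column `j`: the result is again a
partition and is covered by the original one in the dominance order. -/
def MinRightCoinMove (p q : ℕ → ℕ) (j : ℕ) : Prop :=
  CoinMoveRight p q j ∧ IsPartitionFun q ∧ DomCovers p q

/-- Minimum leftward coin move: the inverse of a minimum rightward coin move. -/
def MinLeftCoinMove (p q : ℕ → ℕ) : Prop :=
  ∃ j, MinRightCoinMove q p j

/-- `q` is obtained from `p` by moving a vertical pair of coins (a pair of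
coins of the same column lying in rows `2t+1`, `2t+2`) from column `k` to an
earlier column `j`. -/
def VPairMoveLeft (p q : ℕ → ℕ) : Prop :=
  ∃ j k, j < k ∧ Even (p k) ∧ Even (p j) ∧
    q j = p j + 2 ∧ q k + 2 = p k ∧ ∀ i, i ≠ j → i ≠ k → q i = p i

/-- Minimum leftward coin move of a vertical pair of coins: the result is again
a partition and no partition with even parts lies strictly between the two in
the dominance order. -/
def MinLeftVPairMove (p q : ℕ → ℕ) : Prop :=
  VPairMoveLeft p q ∧ IsPartitionFun q ∧ Dominates q p ∧ q ≠ p ∧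
    ∀ r, IsPartitionFun r → (∀ i, Even (r i)) → Dominates q r → Dominates r p →
      r = q ∨ r = p

/-- The partition `R = (r_0, r_1, …)` of a Kronecker canonical form. -/
def rPart (s : Multiset KBlock) : ℕ → ℕ := fun i => rW s i

/-- The partition `L = (l_0, l_1, …)` of a Kronecker canonical form. -/
def lPart (s : Multiset KBlock) : ℕ → ℕ := fun i => lW s i

/-- The partition `J_μ = (j_1^μ, j_2^μ, …)` of a Kronecker canonical form
(re-indexed from `0`). -/
def jPart (s : Multiset KBlock) (μ : Option ℂ) : ℕ → ℕ := fun i => jW s μ (i + 1)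

/-- Rule C1: a minimum rightward coin move in `R` (or in `L`) from a column
`j ≥ 1`; all other partitions are unchanged. -/
def RuleC1 (s1 s2 : Multiset KBlock) : Prop :=
  (∃ j, 1 ≤ j ∧ MinRightCoinMove (rPart s1) (rPart s2) j ∧
      lPart s2 = lPart s1 ∧ ∀ μ, jPart s2 μ = jPart s1 μ) ∨
  (∃ j, 1 ≤ j ∧ MinRightCoinMove (lPart s1) (lPart s2) j ∧
      rPart s2 = rPart s1 ∧ ∀ μ, jPart s2 μ = jPart s1 μ)

/-- Rule C2: if the rightmost column of `R` (or of `L`) is a single coin,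
remove that coin and append it as a new rightmost column of some `J_μ`. -/
def RuleC2 (s1 s2 : Multiset KBlock) : Prop :=
  (∃ (c : ℕ) (μ : Option ℂ) (d : ℕ),
      rPart s1 c = 1 ∧ (∀ i, c < i → rPart s1 i = 0) ∧
      rPart s2 = Function.update (rPart s1) c 0 ∧
      jPart s1 μ d = 0 ∧ (∀ i, i < d → 1 ≤ jPart s1 μ i) ∧
      jPart s2 μ = Function.update (jPart s1 μ) d 1 ∧
      (∀ ν, ν ≠ μ → jPart s2 ν = jPart s1 ν) ∧
      lPart s2 = lPart s1) ∨
  (∃ (c : ℕ) (μ : Option ℂ) (d : ℕ),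
      lPart s1 c = 1 ∧ (∀ i, c < i → lPart s1 i = 0) ∧
      lPart s2 = Function.update (lPart s1) c 0 ∧
      jPart s1 μ d = 0 ∧ (∀ i, i < d → 1 ≤ jPart s1 μ i) ∧
      jPart s2 μ = Function.update (jPart s1 μ) d 1 ∧
      (∀ ν, ν ≠ μ → jPart s2 ν = jPart s1 ν) ∧
      rPart s2 = rPart s1)

/-- Rule C3: a minimum leftward coin move in some `J_μ`; all other partitions
are unchanged. -/
def RuleC3 (s1 s2 : Multiset KBlock) : Prop :=
  ∃ μ, MinLeftCoinMove (jPart s1 μ) (jPart s2 μ) ∧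
    (∀ ν, ν ≠ μ → jPart s2 ν = jPart s1 ν) ∧
    rPart s2 = rPart s1 ∧ lPart s2 = lPart s1

/-- Rule C4: let `k` be the total number of coins in all of the longest
(= lowest) rows of all the `J_μ`; remove these `k` coins, add one more coin,
and distribute the `k + 1` coins to the columns `r_0, …, r_t` of `R` and
`l_0, …, l_{k-t-1}` of `L` (for some `t`), in such a way that every previously
nonzero column of `R` and of `L` receives a coin. -/
def RuleC4 (s1 s2 : Multiset KBlock) : Prop :=
  ∃ (ek : List (Option ℂ × ℕ)) (t : ℕ),
    (ek.map Prod.fst).Nodup ∧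
    (∀ x ∈ ek, 1 ≤ x.2 ∧ jPart s1 x.1 (x.2 - 1) ≠ 0 ∧ ∀ i, x.2 ≤ i → jPart s1 x.1 i = 0) ∧
    (∀ ν, jPart s1 ν 0 ≠ 0 → ν ∈ ek.map Prod.fst) ∧
    (let k := (ek.map Prod.snd).sum
     t < k ∧
     (∀ ν i, jPart s2 ν i = jPart s1 ν i - 1) ∧
     (∀ i, rPart s2 i = rPart s1 i + (if i ≤ t then 1 else 0)) ∧
     (∀ i, lPart s2 i = lPart s1 i + (if i ≤ k - t - 1 then 1 else 0)) ∧
     (∀ i, rPart s1 i ≠ 0 → i ≤ t) ∧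
     (∀ i, lPart s1 i ≠ 0 → i ≤ k - t - 1))

/-! ### Kronecker modules: pairs of linear maps between finite-dimensional spaces -/

/-- A Kronecker module: a pair of parallel linear maps between finite-dimensional complex
vector spaces. -/
structure KMod where
  V : Type
  W : Type
  [acV : AddCommGroup V]
  [mV : Module ℂ V]
  [fV : FiniteDimensional ℂ V]
  [acW : AddCommGroup W]
  [mW : Module ℂ W]
  [fW : FiniteDimensional ℂ W]
  a : V →ₗ[ℂ] W
  b : V →ₗ[ℂ] W

attribute [instance] KMod.acV KMod.mV KMod.fV KMod.acW KMod.mW KMod.fW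

namespace KMod

/-- Isomorphism of Kronecker modules. -/
def Iso (M N : KMod) : Prop :=
  ∃ (e : M.V ≃ₗ[ℂ] N.V) (f : M.W ≃ₗ[ℂ] N.W),
    (∀ x, f (M.a x) = N.a (e x)) ∧ ∀ x, f (M.b x) = N.b (e x)

theorem Iso.refl (M : KMod) : Iso M M :=
  ⟨LinearEquiv.refl ℂ _, LinearEquiv.refl ℂ _, fun _ => rfl, fun _ => rfl⟩

theorem Iso.symm {M N : KMod} : Iso M N → Iso N M := by
  rintro ⟨e, f, h1, h2⟩
  refine ⟨e.symm, f.symm, fun x => ?_, fun x => ?_⟩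
  · rw [LinearEquiv.symm_apply_eq, h1, LinearEquiv.apply_symm_apply]
  · rw [LinearEquiv.symm_apply_eq, h2, LinearEquiv.apply_symm_apply]

theorem Iso.trans {M N K : KMod} : Iso M N → Iso N K → Iso M K := by
  rintro ⟨e, f, h1, h2⟩ ⟨e', f', h1', h2'⟩
  exact ⟨e.trans e', f.trans f', fun x => by simp [h1, h1'], fun x => by simp [h2, h2']⟩

/-- An intertwining pair of injective maps between modules of equal dimensions is an
isomorphism. -/
theorem Iso.of_injective {M N : KMod} (e : M.V →ₗ[ℂ] N.V) (f : M.W →ₗ[ℂ] N.W)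
    (he : Function.Injective e) (hf : Function.Injective f)
    (hV : Module.finrank ℂ M.V = Module.finrank ℂ N.V)
    (hW : Module.finrank ℂ M.W = Module.finrank ℂ N.W)
    (h1 : ∀ x, f (M.a x) = N.a (e x)) (h2 : ∀ x, f (M.b x) = N.b (e x)) : Iso M N :=
  ⟨LinearEquiv.ofInjectiveOfFinrankEq e he hV, LinearEquiv.ofInjectiveOfFinrankEq f hf hW,
    fun x => h1 x, fun x => h2 x⟩

/-- Direct sum of Kronecker modules. -/
def prod (M N : KMod) : KMod :=
  ⟨M.V × N.V, M.W × N.W, M.a.prodMap N.a, M.b.prodMap N.b⟩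

/-- The zero module. -/
def zero : KMod := ⟨PUnit, PUnit, 0, 0⟩

/-- Exchange of the two maps. -/
def swap (M : KMod) : KMod := ⟨M.V, M.W, M.b, M.a⟩

theorem Iso.swap {M N : KMod} : Iso M N → Iso M.swap N.swap := by
  rintro ⟨e, f, h1, h2⟩
  exact ⟨e, f, h2, h1⟩

theorem Iso.prod {M M' N N' : KMod} : Iso M M' → Iso N N' → Iso (M.prod N) (M'.prod N') := by
  rintro ⟨e, f, h1, h2⟩ ⟨e', f', h1', h2'⟩
  exact ⟨e.prodCongr e', f.prodCongr f', fun x => Prod.ext (h1 _) (h1' _),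
    fun x => Prod.ext (h2 _) (h2' _)⟩

theorem prod_comm_iso (M N : KMod) : Iso (M.prod N) (N.prod M) :=
  ⟨LinearEquiv.prodComm ℂ _ _, LinearEquiv.prodComm ℂ _ _, fun _ => rfl, fun _ => rfl⟩

theorem prod_assoc_iso (M N K : KMod) : Iso ((M.prod N).prod K) (M.prod (N.prod K)) :=
  ⟨LinearEquiv.prodAssoc ℂ _ _ _, LinearEquiv.prodAssoc ℂ _ _ _, fun _ => rfl, fun _ => rfl⟩

theorem prod_subsingleton_iso (M N : KMod) [Subsingleton M.V] [Subsingleton M.W] :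
    Iso (M.prod N) N :=
  ⟨{ toFun := fun x => x.2, map_add' := fun _ _ => rfl, map_smul' := fun _ _ => rfl,
     invFun := fun x => (0, x), left_inv := fun _ => Prod.ext (Subsingleton.elim _ _) rfl,
     right_inv := fun _ => rfl },
   { toFun := fun x => x.2, map_add' := fun _ _ => rfl, map_smul' := fun _ _ => rfl,
     invFun := fun x => (0, x), left_inv := fun _ => Prod.ext (Subsingleton.elim _ _) rfl,
     right_inv := fun _ => rfl }, fun _ => rfl, fun _ => rfl⟩

theorem iso_of_subsingleton (M N : KMod) [Subsingleton M.V] [Subsingleton M.W]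
    [Subsingleton N.V] [Subsingleton N.W] : Iso M N :=
  ⟨0, 0, fun _ => Subsingleton.elim _ _, fun _ => Subsingleton.elim _ _⟩

/-- The Kronecker module of a pencil. -/
def ofMat {ι κ : Type} [Fintype ι] [Fintype κ] (P : Matrix ι κ ℂ × Matrix ι κ ℂ) : KMod :=
  ⟨κ → ℂ, ι → ℂ, P.1.mulVecLin, P.2.mulVecLin⟩

theorem ofMat_iso_of {ι κ ι' κ' : Type} [Fintype ι] [Fintype κ] [Fintype ι'] [Fintype κ']
    {P : Matrix ι κ ℂ × Matrix ι κ ℂ} {Q : Matrix ι' κ' ℂ × Matrix ι' κ' ℂ}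
    (e : (κ → ℂ) ≃ₗ[ℂ] (κ' → ℂ)) (f : (ι → ℂ) ≃ₗ[ℂ] (ι' → ℂ))
    (h1 : ∀ x : κ → ℂ, f (P.1 *ᵥ x) = Q.1 *ᵥ e x) (h2 : ∀ x : κ → ℂ, f (P.2 *ᵥ x) = Q.2 *ᵥ e x) :
    Iso (ofMat P) (ofMat Q) := ⟨e, f, h1, h2⟩

theorem ofMat_iso_iff_strictEquiv {m n : ℕ} (P Q : Pencil m n) :
    Iso (ofMat P) (ofMat Q) ↔ Pencil.StrictEquiv P Q := by
  constructor
  · rintro ⟨e, f, h1, h2⟩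
    have e' : (Fin n → ℂ) ≃ₗ[ℂ] (Fin n → ℂ) := e
    have key : ∀ (X Y : Matrix (Fin m) (Fin n) ℂ) (e : (Fin n → ℂ) ≃ₗ[ℂ] (Fin n → ℂ))
        (f : (Fin m → ℂ) ≃ₗ[ℂ] (Fin m → ℂ)), (∀ x, f (X *ᵥ x) = Y *ᵥ e x) →
        LinearMap.toMatrix' f.toLinearMap * X * LinearMap.toMatrix' e.symm.toLinearMap = Y := by
      intro X Y e f h
      apply Matrix.toLin'.injective
      refine LinearMap.ext fun x => ?_
      have := h (e.symm x)
      simp only [Matrix.toLin'_mul, Matrix.toLin'_toMatrix', LinearMap.comp_apply,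
        Matrix.toLin'_apply, LinearEquiv.coe_coe]
      rw [this, LinearEquiv.apply_symm_apply]
    have inv : ∀ (k : ℕ) (f : (Fin k → ℂ) ≃ₗ[ℂ] (Fin k → ℂ)),
        LinearMap.toMatrix' f.symm.toLinearMap * LinearMap.toMatrix' f.toLinearMap = 1 := by
      intro k f
      rw [← LinearMap.toMatrix'_comp]
      simp
    have inv' : ∀ (k : ℕ) (f : (Fin k → ℂ) ≃ₗ[ℂ] (Fin k → ℂ)),
        LinearMap.toMatrix' f.toLinearMap * LinearMap.toMatrix' f.symm.toLinearMap = 1 := by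
      intro k f
      rw [← LinearMap.toMatrix'_comp]
      simp
    have unit : ∀ (k : ℕ) (f : (Fin k → ℂ) ≃ₗ[ℂ] (Fin k → ℂ)),
        IsUnit (LinearMap.toMatrix' f.symm.toLinearMap) := fun k f =>
      IsUnit.of_mul_eq_one _ (inv k f)
    have hinv :
        (LinearMap.toMatrix' (LinearEquiv.symm f : (Fin m → ℂ) ≃ₗ[ℂ] (Fin m → ℂ)).toLinearMap)⁻¹
        = LinearMap.toMatrix' (f : (Fin m → ℂ) ≃ₗ[ℂ] (Fin m → ℂ)).toLinearMap :=
      Matrix.inv_eq_right_inv (inv m f)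
    exact ⟨LinearMap.toMatrix' (LinearEquiv.symm f : (Fin m → ℂ) ≃ₗ[ℂ] (Fin m → ℂ)).toLinearMap,
      LinearMap.toMatrix' (LinearEquiv.symm e : (Fin n → ℂ) ≃ₗ[ℂ] (Fin n → ℂ)).toLinearMap,
      unit m f, unit n e, by rw [hinv]; exact key _ _ e f h1, by rw [hinv]; exact key _ _ e f h2⟩
  · rintro ⟨S, R, hS, hR, h1, h2⟩
    have hSd := (Matrix.isUnit_iff_isUnit_det S).1 hS
    have hRd := (Matrix.isUnit_iff_isUnit_det R).1 hR
    have key : ∀ (X Y : Matrix (Fin m) (Fin n) ℂ), S⁻¹ * X * R = Y → ∀ x : Fin n → ℂ,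
        S⁻¹ *ᵥ (X *ᵥ x) = Y *ᵥ (R⁻¹ *ᵥ x) := by
      rintro X _ rfl x
      simp [Matrix.mulVec_mulVec, Matrix.mul_assoc, Matrix.mul_nonsing_inv _ hRd]
    exact ofMat_iso_of (Matrix.toLinearEquiv' R (Matrix.invertibleOfIsUnitDet R hRd)).symm
      (Matrix.toLinearEquiv' S (Matrix.invertibleOfIsUnitDet S hSd)).symm (key _ _ h1) (key _ _ h2)

theorem ofMat_submatrix_iso {ι κ ι' κ' : Type} [Fintype ι] [Fintype κ] [Fintype ι'] [Fintype κ']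
    (P : Matrix ι κ ℂ × Matrix ι κ ℂ) (e : ι' ≃ ι) (f : κ' ≃ κ) :
    Iso (ofMat (P.1.submatrix e f, P.2.submatrix e f)) (ofMat P) := by
  have key : ∀ (X : Matrix ι κ ℂ) (x : κ' → ℂ),
      (X.submatrix e f *ᵥ x) ∘ e.symm = X *ᵥ (x ∘ f.symm) := by
    intro X x
    rw [Matrix.submatrix_mulVec_equiv]
    ext i
    simp
  exact ofMat_iso_of (LinearEquiv.funCongrLeft ℂ ℂ f.symm) (LinearEquiv.funCongrLeft ℂ ℂ e.symm)
    (key _) (key _)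

theorem ofMat_fromBlocks_iso {ι κ ι' κ' : Type} [Fintype ι] [Fintype κ] [Fintype ι'] [Fintype κ']
    (P : Matrix ι κ ℂ × Matrix ι κ ℂ) (Q : Matrix ι' κ' ℂ × Matrix ι' κ' ℂ) :
    Iso (ofMat (fromBlocks P.1 0 0 Q.1, fromBlocks P.2 0 0 Q.2)) ((ofMat P).prod (ofMat Q)) := by
  have key : ∀ (X : Matrix ι κ ℂ) (Y : Matrix ι' κ' ℂ) (x : κ ⊕ κ' → ℂ),
      LinearEquiv.sumArrowLequivProdArrow _ _ ℂ ℂ (fromBlocks X 0 0 Y *ᵥ x) =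
        (X *ᵥ (x ∘ Sum.inl), Y *ᵥ (x ∘ Sum.inr)) := by
    intro X Y x
    rw [Matrix.fromBlocks_mulVec]
    apply Prod.ext <;> ext i <;> simp
  exact ⟨LinearEquiv.sumArrowLequivProdArrow _ _ ℂ ℂ, LinearEquiv.sumArrowLequivProdArrow _ _ ℂ ℂ,
    key _ _, key _ _⟩

theorem ofMat_dsum_iso {m n p q : ℕ} (P : Pencil m n) (Q : Pencil p q) :
    Iso (ofMat (Pencil.dsum P Q)) ((ofMat P).prod (ofMat Q)) :=
  (ofMat_submatrix_iso (fromBlocks P.1 0 0 Q.1, fromBlocks P.2 0 0 Q.2) _ _).trans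
    (ofMat_fromBlocks_iso P Q)

theorem ofMat_cast_iso {m n m' n' : ℕ} (hm : m = m') (hn : n = n') (P : Pencil m n) :
    Iso (ofMat (Pencil.cast hm hn P)) (ofMat P) :=
  ofMat_submatrix_iso P _ _

/-- The Kronecker module of a canonical block. -/
def blk (b : KBlock) : KMod := ofMat b.toPencil

/-- The direct sum of canonical blocks. -/
def sum : List KBlock → KMod
  | [] => zero
  | b :: t => (blk b).prod (sum t)

theorem sum_iso_pencilOfList (l : List KBlock) : Iso (sum l) (ofMat (pencilOfList l)) := by
  induction l with
  | nil =>
    have : Subsingleton (sum []).V := inferInstanceAs (Subsingleton PUnit)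
    have : Subsingleton (sum []).W := inferInstanceAs (Subsingleton PUnit)
    have : Subsingleton (ofMat (pencilOfList [])).V := inferInstanceAs (Subsingleton (Fin 0 → ℂ))
    have : Subsingleton (ofMat (pencilOfList [])).W := inferInstanceAs (Subsingleton (Fin 0 → ℂ))
    exact iso_of_subsingleton _ _
  | cons b t ih => exact ((Iso.refl (blk b)).prod ih).trans (ofMat_dsum_iso _ _).symm

theorem finrank_ofMat_V {ι κ : Type} [Fintype ι] [Fintype κ] (P : Matrix ι κ ℂ × Matrix ι κ ℂ) :
    Module.finrank ℂ (ofMat P).V = Fintype.card κ := Module.finrank_fintype_fun_eq_card ℂ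

theorem finrank_ofMat_W {ι κ : Type} [Fintype ι] [Fintype κ] (P : Matrix ι κ ℂ × Matrix ι κ ℂ) :
    Module.finrank ℂ (ofMat P).W = Fintype.card ι := Module.finrank_fintype_fun_eq_card ℂ

theorem Iso.finrank_V {M N : KMod} (h : Iso M N) :
    Module.finrank ℂ M.V = Module.finrank ℂ N.V := h.choose.finrank_eq

theorem Iso.finrank_W {M N : KMod} (h : Iso M N) :
    Module.finrank ℂ M.W = Module.finrank ℂ N.W := h.choose_spec.choose.finrank_eq

theorem weakRepresentsE_iff {m n : ℕ} (P : Pencil m n) (s : Multiset KBlock) :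
    WeakRepresentsE P s ↔ ∃ l : List KBlock, (l : Multiset KBlock) = s ∧ Iso (sum l) (ofMat P) := by
  constructor
  · rintro ⟨l, hm, hn, hl, h⟩
    exact ⟨l, hl, (sum_iso_pencilOfList l).trans ((ofMat_cast_iso hm hn _).symm.trans
      ((ofMat_iso_iff_strictEquiv _ _).2 h))⟩
  · rintro ⟨l, hl, h⟩
    have h' := (sum_iso_pencilOfList l).symm.trans h
    have hm : rowsSum l = m := by
      have := h'.finrank_W
      simpa only [finrank_ofMat_W, Fintype.card_fin] using this
    have hn : colsSum l = n := by
      have := h'.finrank_V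
      simpa only [finrank_ofMat_V, Fintype.card_fin] using this
    exact ⟨l, hm, hn, hl, (ofMat_iso_iff_strictEquiv _ _).1 ((ofMat_cast_iso hm hn _).trans h')⟩

theorem Iso.sum_cons (b : KBlock) {l l' : List KBlock} (h : Iso (sum l) (sum l')) :
    Iso (sum (b :: l)) (sum (b :: l')) := (Iso.refl _).prod h

theorem sum_perm_iso {l l' : List KBlock} (h : l.Perm l') : Iso (sum l) (sum l') := by
  induction h with
  | nil => exact Iso.refl _
  | cons x _ ih => exact ih.sum_cons x
  | swap x y l =>
    exact (prod_assoc_iso _ _ _).symm.trans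
      (((prod_comm_iso _ _).prod (Iso.refl _)).trans (prod_assoc_iso _ _ _))
  | trans _ _ ih1 ih2 => exact ih1.trans ih2

theorem sum_append_iso (l l' : List KBlock) : Iso (sum (l ++ l')) ((sum l).prod (sum l')) := by
  induction l with
  | nil =>
    have : Subsingleton (sum []).V := inferInstanceAs (Subsingleton PUnit)
    have : Subsingleton (sum []).W := inferInstanceAs (Subsingleton PUnit)
    exact (prod_subsingleton_iso (sum []) (sum l')).symm
  | cons b t ih => exact ((Iso.refl (blk b)).prod ih).trans (prod_assoc_iso _ _ _).symm

theorem sum_singleton_iso (b : KBlock) : Iso (sum [b]) (blk b) := by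
  have : Subsingleton (sum []).V := inferInstanceAs (Subsingleton PUnit)
  have : Subsingleton (sum []).W := inferInstanceAs (Subsingleton PUnit)
  exact (prod_comm_iso _ _).trans (prod_subsingleton_iso (sum []) (blk b))

end KMod

/-! ### Action of the canonical matrices on vectors -/

theorem Jmat_mulVec {k : ℕ} (μ : ℂ) (x : Fin k → ℂ) (i : Fin k) :
    (Jmat k μ *ᵥ x) i = μ * x i + if h : (i : ℕ) + 1 < k then x ⟨i + 1, h⟩ else 0 := by
  have h1 : ∀ j : Fin k, Jmat k μ i j * x j =
      (if j = i then μ * x i else 0) + if (j : ℕ) = i + 1 then x j else 0 := by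
    intro j
    simp only [Jmat, Matrix.of_apply, Fin.ext_iff]
    by_cases hj : (j : ℕ) = i
    · have : j = i := Fin.ext hj
      subst this
      simp
    · simp [hj]
  rw [Matrix.mulVec, dotProduct, Finset.sum_congr rfl fun j _ => h1 j, Finset.sum_add_distrib,
    Finset.sum_ite_eq' Finset.univ i, if_pos (Finset.mem_univ _)]
  congr 1
  split_ifs with h
  · rw [Finset.sum_eq_single ⟨i + 1, h⟩]
    · simp
    · intro j _ hj
      rw [if_neg fun h' => hj (Fin.ext h')]
    · simp
  · exact Finset.sum_eq_zero fun j _ => if_neg fun h' => h (by rw [← h']; exact j.2)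

theorem Fmat_mulVec {k : ℕ} (x : Fin (k + 1) → ℂ) : Fmat k *ᵥ x = fun i => x i.succ := by
  ext i
  rw [Matrix.mulVec, dotProduct, Finset.sum_eq_single i.succ]
  · simp [Fmat]
  · intro j _ hj
    have : ¬ (j : ℕ) = i + 1 := fun h => hj (Fin.ext h)
    simp [Fmat, this]
  · simp

theorem Gmat_mulVec {k : ℕ} (x : Fin (k + 1) → ℂ) : Gmat k *ᵥ x = fun i => x i.castSucc := by
  ext i
  rw [Matrix.mulVec, dotProduct, Finset.sum_eq_single i.castSucc]
  · simp [Gmat]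
  · intro j _ hj
    have : ¬ (j : ℕ) = i := fun h => hj (Fin.ext h)
    simp [Gmat, this]
  · simp

theorem Fmat_transpose_mulVec {k : ℕ} (x : Fin k → ℂ) :
    (Fmat k)ᵀ *ᵥ x = Fin.cons 0 x := by
  ext i
  refine Fin.cases ?_ (fun i => ?_) i
  · simp [Matrix.mulVec, dotProduct, Fmat]
  · rw [Fin.cons_succ, Matrix.mulVec, dotProduct, Finset.sum_eq_single i]
    · simp [Fmat]
    · intro j _ hj
      have : ¬ (i : ℕ) = j := fun h => hj (Fin.ext h.symm)
      simp [Fmat, this]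
    · simp

theorem Gmat_transpose_mulVec {k : ℕ} (x : Fin k → ℂ) :
    (Gmat k)ᵀ *ᵥ x = (Fin.snoc x 0 : Fin (k + 1) → ℂ) := by
  ext i
  refine Fin.lastCases ?_ (fun i => ?_) i
  · rw [Fin.snoc_last, Matrix.mulVec, dotProduct]
    refine Finset.sum_eq_zero fun j _ => ?_
    have : ¬ (k : ℕ) = j := fun h => absurd j.2 (by omega)
    simp [Gmat, this]
  · rw [Fin.snoc_castSucc, Matrix.mulVec, dotProduct, Finset.sum_eq_single i]
    · simp [Gmat]
    · intro j _ hj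
      have : ¬ (i : ℕ) = j := fun h => hj (Fin.ext h.symm)
      simp [Gmat, this]
    · simp

namespace KMod

/-! ### Duality -/

/-- The dual module. -/
def dual (M : KMod) : KMod :=
  ⟨Module.Dual ℂ M.W, Module.Dual ℂ M.V, M.a.dualMap, M.b.dualMap⟩

theorem Iso.dual {M N : KMod} : Iso M N → Iso N.dual M.dual := by
  rintro ⟨e, f, h1, h2⟩
  have h1' : ∀ φ : Module.Dual ℂ N.W, e.dualMap (N.a.dualMap φ) = M.a.dualMap (f.dualMap φ) :=
    fun φ => LinearMap.ext fun x => (congrArg φ (h1 x)).symm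
  have h2' : ∀ φ : Module.Dual ℂ N.W, e.dualMap (N.b.dualMap φ) = M.b.dualMap (f.dualMap φ) :=
    fun φ => LinearMap.ext fun x => (congrArg φ (h2 x)).symm
  exact ⟨f.dualMap, e.dualMap, h1', h2'⟩

theorem dual_dual_iso (M : KMod) : Iso M M.dual.dual :=
  ⟨Module.evalEquiv ℂ M.V, Module.evalEquiv ℂ M.W, fun _ => rfl, fun _ => rfl⟩

theorem dual_prod_iso (M N : KMod) : Iso (M.dual.prod N.dual) (M.prod N).dual :=
  ⟨Module.dualProdDualEquivDual ℂ M.W N.W, Module.dualProdDualEquivDual ℂ M.V N.V,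
    fun _ => LinearMap.ext fun _ => rfl, fun _ => LinearMap.ext fun _ => rfl⟩

theorem dual_ofMat_iso {ι κ : Type} [Fintype ι] [Fintype κ] (P : Matrix ι κ ℂ × Matrix ι κ ℂ) :
    Iso (ofMat (P.1ᵀ, P.2ᵀ)) (ofMat P).dual := by
  have key : ∀ (X : Matrix ι κ ℂ) (x : ι → ℂ),
      dotProductEquiv ℂ κ (Xᵀ *ᵥ x) = (X.mulVecLin).dualMap (dotProductEquiv ℂ ι x) := by
    intro X x
    refine LinearMap.ext fun y => ?_
    simp [Matrix.dotProduct_mulVec, Matrix.mulVec_transpose]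
  exact ⟨dotProductEquiv ℂ ι, dotProductEquiv ℂ κ, key _, key _⟩

/-- The type of the dual of a block. -/
def dualBlock : KBlock → KBlock
  | .L k => .LT k
  | .LT k => .L k
  | b => b

theorem Jmat_submatrix_rev (k : ℕ) (μ : ℂ) : (Jmat k μ).submatrix Fin.revPerm Fin.revPerm =
    (Jmat k μ)ᵀ := by
  ext i j
  simp only [Jmat, Matrix.submatrix_apply, Matrix.of_apply, Matrix.transpose_apply,
    Fin.revPerm_apply, Fin.val_rev]
  have := i.2
  have := j.2
  congr 1
  · apply propext; omega
  · congr 1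
    apply propext; omega

theorem dual_blk_iso (b : KBlock) : Iso (blk (dualBlock b)) (blk b).dual := by
  refine Iso.trans ?_ (dual_ofMat_iso _)
  cases b with
  | L k => exact Iso.refl _
  | LT k => exact Iso.refl _
  | E k μ =>
    refine (ofMat_submatrix_iso (Eblk k μ) Fin.revPerm Fin.revPerm).symm.trans ?_
    change Iso (ofMat ((Jmat k μ).submatrix _ _, (1 : Matrix (Fin k) (Fin k) ℂ).submatrix _ _))
      (ofMat ((Jmat k μ)ᵀ, (1)ᵀ))
    rw [Jmat_submatrix_rev, Matrix.submatrix_one_equiv, Matrix.transpose_one]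
    exact Iso.refl _
  | Einf k =>
    refine (ofMat_submatrix_iso (EInfblk k) Fin.revPerm Fin.revPerm).symm.trans ?_
    change Iso (ofMat ((1 : Matrix (Fin k) (Fin k) ℂ).submatrix _ _, (Jmat k 0).submatrix _ _))
      (ofMat ((1)ᵀ, (Jmat k 0)ᵀ))
    rw [Jmat_submatrix_rev, Matrix.submatrix_one_equiv, Matrix.transpose_one]
    exact Iso.refl _

theorem dual_sum_iso (l : List KBlock) : Iso (sum (l.map dualBlock)) (sum l).dual := by
  induction l with
  | nil =>
    have : Subsingleton (sum ([].map dualBlock)).V := inferInstanceAs (Subsingleton PUnit)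
    have : Subsingleton (sum ([].map dualBlock)).W := inferInstanceAs (Subsingleton PUnit)
    have : Subsingleton (sum []).dual.V := inferInstanceAs (Subsingleton (Module.Dual ℂ PUnit))
    have : Subsingleton (sum []).dual.W := inferInstanceAs (Subsingleton (Module.Dual ℂ PUnit))
    exact iso_of_subsingleton _ _
  | cons b t ih => exact ((dual_blk_iso b).prod ih).trans (dual_prod_iso _ _)

/-! ### Reflection -/

/-- Pull-back reflection. -/
def left (N : KMod) : KMod :=
  let K := LinearMap.ker (N.b ∘ₗ LinearMap.fst ℂ N.V N.V - N.a ∘ₗ LinearMap.snd ℂ N.V N.V)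
  ⟨K, N.V, LinearMap.fst ℂ N.V N.V ∘ₗ K.subtype, LinearMap.snd ℂ N.V N.V ∘ₗ K.subtype⟩

theorem left_rel (N : KMod) (v : N.left.V) : N.b (N.left.a v) = N.a (N.left.b v) :=
  sub_eq_zero.1 (LinearMap.mem_ker.1 v.2)

theorem left_ext (N : KMod) {v w : N.left.V} (h1 : N.left.a v = N.left.a w)
    (h2 : N.left.b v = N.left.b w) : v = w := Subtype.ext (Prod.ext h1 h2)

theorem iso_left {M N : KMod} (f : M.W ≃ₗ[ℂ] N.V) (h : ∀ v, N.b (f (M.a v)) = N.a (f (M.b v)))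
    (inj : ∀ v, M.a v = 0 → M.b v = 0 → v = 0)
    (surj : ∀ x y, N.b x = N.a y → ∃ v, f (M.a v) = x ∧ f (M.b v) = y) : Iso M N.left := by
  let g : M.V →ₗ[ℂ] N.left.V := LinearMap.codRestrict _
    ((f.toLinearMap ∘ₗ M.a).prod (f.toLinearMap ∘ₗ M.b))
    fun v => LinearMap.mem_ker.2 (sub_eq_zero.2 (h v))
  have hg : Function.Bijective g := by
    constructor
    · rw [injective_iff_map_eq_zero]
      intro v hv
      have h1 : f (M.a v) = 0 := congrArg (fun z : N.left.V => N.left.a z) hv |>.trans (map_zero _)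
      have h2 : f (M.b v) = 0 := congrArg (fun z : N.left.V => N.left.b z) hv |>.trans (map_zero _)
      exact inj v (f.map_eq_zero_iff.1 h1) (f.map_eq_zero_iff.1 h2)
    · intro z
      obtain ⟨v, h1, h2⟩ := surj _ _ (left_rel N z)
      exact ⟨v, left_ext N h1 h2⟩
  exact ⟨LinearEquiv.ofBijective g hg, f, fun _ => rfl, fun _ => rfl⟩

theorem Iso.left {N N' : KMod} : Iso N N' → Iso N.left N'.left := by
  rintro ⟨e, f, h1, h2⟩
  refine iso_left e (fun v => ?_) (fun v ha hb => left_ext N (ha.trans (map_zero _).symm)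
    (hb.trans (map_zero _).symm)) fun x y hxy => ?_
  · exact ((h2 _).symm.trans (congrArg f (left_rel N v))).trans (h1 _)
  · refine ⟨⟨(e.symm x, e.symm y), LinearMap.mem_ker.2 (sub_eq_zero.2 ?_)⟩,
      e.apply_symm_apply x, e.apply_symm_apply y⟩
    apply f.injective
    change f (N.b (e.symm x)) = f (N.a (e.symm y))
    rw [h1, h2, e.apply_symm_apply, e.apply_symm_apply, hxy]

theorem left_prod_iso (N N' : KMod) : Iso (N.left.prod N'.left) (N.prod N').left := by
  refine iso_left (LinearEquiv.refl ℂ _) (fun v => Prod.ext (left_rel N v.1) (left_rel N' v.2))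
    (fun v ha hb => Prod.ext (left_ext N ?_ ?_) (left_ext N' ?_ ?_)) fun x y hxy => ?_
  · exact (congrArg Prod.fst ha).trans (map_zero _).symm
  · exact (congrArg Prod.fst hb).trans (map_zero _).symm
  · exact (congrArg Prod.snd ha).trans (map_zero _).symm
  · exact (congrArg Prod.snd hb).trans (map_zero _).symm
  · exact ⟨(⟨(x.1, y.1), LinearMap.mem_ker.2 (sub_eq_zero.2 (congrArg Prod.fst hxy))⟩,
      ⟨(x.2, y.2), LinearMap.mem_ker.2 (sub_eq_zero.2 (congrArg Prod.snd hxy))⟩), rfl, rfl⟩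

theorem left_blk_L (k : ℕ) : Iso (blk (.L (k + 1))) (blk (.L k)).left := by
  have hF : ∀ (n : ℕ) (x : Fin (n + 1) → ℂ), (Lblk n).1 *ᵥ x = fun i => x i.succ :=
    fun n => Fmat_mulVec
  have hG : ∀ (n : ℕ) (x : Fin (n + 1) → ℂ), (Lblk n).2 *ᵥ x = fun i => x i.castSucc :=
    fun n => Gmat_mulVec
  have h1 : ∀ x : Fin (k + 2) → ℂ, (Lblk k).2 *ᵥ ((Lblk (k + 1)).1 *ᵥ x) =
      (Lblk k).1 *ᵥ ((Lblk (k + 1)).2 *ᵥ x) := by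
    intro x
    simp only [hF, hG, Fin.succ_castSucc]
  have h2 : ∀ x : Fin (k + 2) → ℂ, (Lblk (k + 1)).1 *ᵥ x = 0 → (Lblk (k + 1)).2 *ᵥ x = 0 →
      x = 0 := by
    intro x hx hy
    rw [hF] at hx
    rw [hG] at hy
    ext i
    refine Fin.cases ?_ (fun i => congrFun hx i) i
    exact congrFun hy 0
  have h3 : ∀ x y : Fin (k + 1) → ℂ, (Lblk k).2 *ᵥ x = (Lblk k).1 *ᵥ y →
      ∃ v : Fin (k + 2) → ℂ, (Lblk (k + 1)).1 *ᵥ v = x ∧ (Lblk (k + 1)).2 *ᵥ v = y := by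
    intro x y h
    rw [hF, hG] at h
    refine ⟨Fin.cons (y 0) x, ?_, ?_⟩
    · rw [hF]
      ext i
      simp
    · rw [hG]
      ext i
      refine Fin.cases ?_ (fun i => ?_) i
      · simp
      · rw [← Fin.succ_castSucc, Fin.cons_succ]
        exact congrFun h i
  exact iso_left (LinearEquiv.refl ℂ _) h1 h2 h3

theorem left_blk_LT (k : ℕ) : Iso (blk (.LT k)) (blk (.LT (k + 1))).left := by
  have hF : ∀ (n : ℕ) (x : Fin n → ℂ), (LTblk n).1 *ᵥ x = Fin.cons 0 x :=
    fun n => Fmat_transpose_mulVec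
  have hG : ∀ (n : ℕ) (x : Fin n → ℂ), (LTblk n).2 *ᵥ x = (Fin.snoc x 0 : Fin (n + 1) → ℂ) :=
    fun n => Gmat_transpose_mulVec
  have h1 : ∀ x : Fin k → ℂ, (LTblk (k + 1)).2 *ᵥ ((LTblk k).1 *ᵥ x) =
      (LTblk (k + 1)).1 *ᵥ ((LTblk k).2 *ᵥ x) := by
    intro x
    rw [hF, hG, hF, hG, Fin.cons_snoc_eq_snoc_cons]
  have h2 : ∀ x : Fin k → ℂ, (LTblk k).1 *ᵥ x = 0 → (LTblk k).2 *ᵥ x = 0 → x = 0 := by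
    intro x hx _
    rw [hF] at hx
    ext i
    simpa using congrFun hx i.succ
  have h3 : ∀ x y : Fin (k + 1) → ℂ, (LTblk (k + 1)).2 *ᵥ x = (LTblk (k + 1)).1 *ᵥ y →
      ∃ v : Fin k → ℂ, (LTblk k).1 *ᵥ v = x ∧ (LTblk k).2 *ᵥ v = y := by
    intro x y h
    rw [hF, hG] at h
    refine ⟨Fin.tail x, ?_, ?_⟩
    · rw [hF]
      ext i
      refine Fin.cases ?_ (fun i => ?_) i
      · have := congrFun h (Fin.castSucc 0)
        rw [Fin.snoc_castSucc] at this
        simpa using this.symm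
      · simp [Fin.tail]
    · rw [hG]
      ext i
      have := congrFun h i.succ
      rw [Fin.cons_succ] at this
      rw [← this]
      refine Fin.lastCases ?_ (fun i => ?_) i
      · rw [Fin.snoc_last, Fin.succ_last, Fin.snoc_last]
      · rw [Fin.snoc_castSucc, Fin.succ_castSucc, Fin.snoc_castSucc]
        rfl
  exact iso_left (LinearEquiv.refl ℂ _) h1 h2 h3

theorem left_blk_E (k : ℕ) (μ : ℂ) : Iso (blk (.E k μ)) (blk (.E k μ)).left := by
  have hG : ∀ x : Fin k → ℂ, (Eblk k μ).2 *ᵥ x = x := Matrix.one_mulVec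
  have h1 : ∀ x : Fin k → ℂ, (Eblk k μ).2 *ᵥ ((Eblk k μ).1 *ᵥ x) =
      (Eblk k μ).1 *ᵥ ((Eblk k μ).2 *ᵥ x) := fun x => by simp only [hG]
  have h2 : ∀ x : Fin k → ℂ, (Eblk k μ).1 *ᵥ x = 0 → (Eblk k μ).2 *ᵥ x = 0 → x = 0 :=
    fun x _ hx => by rwa [hG] at hx
  have h3 : ∀ x y : Fin k → ℂ, (Eblk k μ).2 *ᵥ x = (Eblk k μ).1 *ᵥ y →
      ∃ v : Fin k → ℂ, (Eblk k μ).1 *ᵥ v = x ∧ (Eblk k μ).2 *ᵥ v = y :=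
    fun x y h => ⟨y, by rw [← h, hG], hG y⟩
  exact iso_left (LinearEquiv.refl ℂ _) h1 h2 h3

theorem left_blk_Einf (k : ℕ) : Iso (blk (.Einf k)) (blk (.Einf k)).left := by
  have hG : ∀ x : Fin k → ℂ, (EInfblk k).1 *ᵥ x = x := Matrix.one_mulVec
  have h1 : ∀ x : Fin k → ℂ, (EInfblk k).2 *ᵥ ((EInfblk k).1 *ᵥ x) =
      (EInfblk k).1 *ᵥ ((EInfblk k).2 *ᵥ x) := fun x => by simp only [hG]
  have h2 : ∀ x : Fin k → ℂ, (EInfblk k).1 *ᵥ x = 0 → (EInfblk k).2 *ᵥ x = 0 → x = 0 :=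
    fun x hx _ => by rwa [hG] at hx
  have h3 : ∀ x y : Fin k → ℂ, (EInfblk k).2 *ᵥ x = (EInfblk k).1 *ᵥ y →
      ∃ v : Fin k → ℂ, (EInfblk k).1 *ᵥ v = x ∧ (EInfblk k).2 *ᵥ v = y :=
    fun x y h => ⟨x, hG x, by rw [h, hG]⟩
  exact iso_left (LinearEquiv.refl ℂ _) h1 h2 h3

/-- The module is isomorphic to a direct sum of canonical blocks. -/
def IsSum (M : KMod) : Prop := ∃ l, Iso (sum l) M

theorem IsSum.of_iso {M N : KMod} (h : IsSum M) (hMN : Iso M N) : IsSum N :=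
  h.imp fun _ hl => hl.trans hMN

theorem IsSum.prod {M N : KMod} : IsSum M → IsSum N → IsSum (M.prod N) := by
  rintro ⟨l, hl⟩ ⟨l', hl'⟩
  exact ⟨l ++ l', (sum_append_iso l l').trans (hl.prod hl')⟩

theorem isSum_blk (b : KBlock) : IsSum (blk b) := ⟨[b], sum_singleton_iso b⟩

theorem isSum_of_subsingleton (M : KMod) [Subsingleton M.V] [Subsingleton M.W] : IsSum M := by
  have : Subsingleton (sum []).V := inferInstanceAs (Subsingleton PUnit)
  have : Subsingleton (sum []).W := inferInstanceAs (Subsingleton PUnit)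
  exact ⟨[], iso_of_subsingleton _ _⟩

theorem IsSum.left {N : KMod} : IsSum N → IsSum N.left := by
  rintro ⟨l, hl⟩
  refine IsSum.of_iso ?_ hl.left
  clear hl
  induction l with
  | nil =>
    have : Subsingleton (sum []).left.V := inferInstanceAs
      (Subsingleton (LinearMap.ker (_ : PUnit × PUnit →ₗ[ℂ] PUnit)))
    have : Subsingleton (sum []).left.W := inferInstanceAs (Subsingleton PUnit)
    exact isSum_of_subsingleton _
  | cons b t ih =>
    refine (IsSum.prod ?_ ih).of_iso (left_prod_iso _ _)
    rcases b with ⟨k, μ⟩ | k | k | k | k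
    · exact (isSum_blk _).of_iso (left_blk_E k μ)
    · exact (isSum_blk _).of_iso (left_blk_Einf k)
    · exact (isSum_blk _).of_iso (left_blk_L k)
    · have : Subsingleton (blk (.LT 0)).left.V := inferInstanceAs
        (Subsingleton (LinearMap.ker (_ : (Fin 0 → ℂ) × (Fin 0 → ℂ) →ₗ[ℂ] (Fin 1 → ℂ))))
      have : Subsingleton (blk (.LT 0)).left.W := inferInstanceAs (Subsingleton (Fin 0 → ℂ))
      exact isSum_of_subsingleton _
    · exact (isSum_blk _).of_iso (left_blk_LT k)

theorem IsSum.of_dual {M : KMod} : IsSum M.dual → IsSum M := by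
  rintro ⟨l, hl⟩
  exact ⟨_, (dual_sum_iso l).trans (hl.dual.symm.trans (dual_dual_iso M).symm)⟩

end KMod

/-! ### Existence of the Kronecker canonical form -/

theorem exists_shift_splitting {V : Type} [AddCommGroup V] [Module ℂ V] [FiniteDimensional ℂ V]
    (S : V →ₗ[ℂ] V) (hS : ¬ Function.Injective S) :
    ∃ (k : ℕ) (U : Submodule ℂ V) (hU : ∀ u ∈ U, S u ∈ U)
      (e : ((Fin (k + 1) → ℂ) × U) ≃ₗ[ℂ] V),
      ∀ c u, e (Jmat (k + 1) 0 *ᵥ c, S.restrict hU u) = S (e (c, u)) := by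
  have hex : ∃ k : ℕ, LinearMap.ker (S ^ k) = LinearMap.ker (S ^ (k + 1)) :=
    (Module.End.exists_ker_pow_eq_ker_pow_succ S).imp fun _ h => h.2
  obtain ⟨k, hk⟩ : ∃ k, Nat.find hex = k + 1 := by
    refine Nat.exists_eq_succ_of_ne_zero fun h0 => hS ?_
    have := Nat.find_spec hex
    rw [h0, zero_add, pow_one, pow_zero] at this
    rw [← LinearMap.ker_eq_bot, ← this]
    exact LinearMap.ker_id
  have hker : LinearMap.ker (S ^ (k + 1)) = LinearMap.ker (S ^ (k + 2)) := by
    have := Nat.find_spec hex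
    rwa [hk] at this
  have hlt : ¬ LinearMap.ker (S ^ k) = LinearMap.ker (S ^ (k + 1)) :=
    Nat.find_min hex (by omega)
  obtain ⟨x, hx1, hx0⟩ : ∃ x, (S ^ (k + 1)) x = 0 ∧ (S ^ k) x ≠ 0 := by
    by_contra! h
    refine hlt (le_antisymm (fun y hy => ?_) h)
    rw [LinearMap.mem_ker] at hy ⊢
    rw [pow_succ', Module.End.mul_apply, hy, map_zero]
  have hnot : (S ^ k) x ∉ LinearMap.range (S ^ (k + 1)) := by
    rintro ⟨y, hy⟩
    have h1 : (S ^ (k + 2)) y = 0 := by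
      rw [pow_succ', Module.End.mul_apply, hy, ← Module.End.mul_apply, ← pow_succ', hx1]
    have h2 : y ∈ LinearMap.ker (S ^ (k + 1)) := by rw [hker]; exact h1
    exact hx0 (hy.symm.trans h2)
  obtain ⟨φ, hφ0, hφ⟩ := Submodule.exists_dual_map_eq_bot_of_notMem hnot inferInstance
  have hφ' : ∀ j y, k + 1 ≤ j → φ ((S ^ j) y) = 0 := by
    intro j y hj
    obtain ⟨d, rfl⟩ := Nat.exists_eq_add_of_le hj
    have : φ ((S ^ (k + 1 + d)) y) ∈ (LinearMap.range (S ^ (k + 1))).map φ :=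
      ⟨_, ⟨(S ^ d) y, rfl⟩, by rw [pow_add S (k + 1) d, Module.End.mul_apply]⟩
    rwa [hφ] at this
  have hxj : ∀ j, k + 1 ≤ j → (S ^ j) x = 0 := by
    intro j hj
    obtain ⟨d, rfl⟩ := Nat.exists_eq_add_of_le hj
    rw [add_comm, pow_add, Module.End.mul_apply, hx1, map_zero]
  let Φ : V →ₗ[ℂ] (Fin (k + 1) → ℂ) := LinearMap.pi fun j => φ ∘ₗ (S ^ (j : ℕ))
  let U := LinearMap.ker Φ
  have hmem : ∀ u ∈ U, ∀ j : ℕ, φ ((S ^ j) u) = 0 := by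
    intro u hu j
    by_cases hj : k + 1 ≤ j
    · exact hφ' j u hj
    · exact congrFun (LinearMap.mem_ker.1 hu) (⟨j, by omega⟩ : Fin (k + 1))
  have hU : ∀ u ∈ U, S u ∈ U := by
    intro u hu
    refine LinearMap.mem_ker.2 (funext fun j => ?_)
    change φ ((S ^ (j : ℕ)) (S u)) = 0
    rw [← Module.End.mul_apply, ← pow_succ]
    exact hmem u hu _
  let C : (Fin (k + 1) → ℂ) →ₗ[ℂ] V := Fintype.linearCombination ℂ fun i => (S ^ (k - i)) x
  have hC : ∀ c, C c = ∑ i, c i • (S ^ (k - i)) x := fun c => rfl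
  let e₀ : ((Fin (k + 1) → ℂ) × U) →ₗ[ℂ] V := C.coprod U.subtype
  have inj : Function.Injective e₀ := by
    rw [injective_iff_map_eq_zero]
    rintro ⟨c, u⟩ h
    have hcu : C c = -(u : V) := eq_neg_of_add_eq_zero_left h
    have hsum : ∀ j : ℕ, ∑ i, c i * φ ((S ^ (j + (k - i))) x) = 0 := by
      intro j
      have h1 := hmem u u.2 j
      have h2 : φ ((S ^ j) (C c)) = 0 := by rw [hcu, map_neg, map_neg, h1, neg_zero]
      rw [hC, map_sum, map_sum] at h2
      rw [← h2]
      refine Finset.sum_congr rfl fun i _ => ?_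
      rw [map_smul, map_smul, smul_eq_mul, pow_add, Module.End.mul_apply]
    have hc : ∀ n, ∀ j : Fin (k + 1), k - j = n → c j = 0 := by
      intro n
      induction n using Nat.strong_induction_on with
      | _ n ih =>
        intro j hj
        have h1 := hsum j
        rw [Finset.sum_eq_single j] at h1
        · rw [show (j : ℕ) + (k - j) = k by omega] at h1
          exact (mul_eq_zero.1 h1).resolve_right hφ0
        · intro i _ hij
          rcases lt_or_gt_of_ne hij with h | h
          · rw [hxj _ (by have := j.2; rw [Fin.lt_def] at h; omega), map_zero, mul_zero]
          · rw [ih (k - i) (by have := i.2; rw [Fin.lt_def] at h; omega) i rfl, zero_mul]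
        · simp
    have hc0 : c = 0 := funext fun j => hc _ j rfl
    subst hc0
    rw [map_zero] at hcu
    exact Prod.ext rfl (Subtype.ext (neg_eq_zero.1 hcu.symm))
  have hdim : Module.finrank ℂ ((Fin (k + 1) → ℂ) × U) = Module.finrank ℂ V := by
    refine le_antisymm (LinearMap.finrank_le_finrank_of_injective inj) ?_
    have h1 := LinearMap.finrank_range_add_finrank_ker Φ
    have h2 := Submodule.finrank_le (LinearMap.range Φ)
    have h3 : Module.finrank ℂ U = Module.finrank ℂ (LinearMap.ker Φ) := rfl
    rw [Module.finrank_prod]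
    omega
  refine ⟨k, U, hU, LinearEquiv.ofInjectiveOfFinrankEq e₀ inj hdim, fun c u => ?_⟩
  change C (Jmat (k + 1) 0 *ᵥ c) + S u = S (C c + u)
  rw [map_add]
  congr 1
  rw [hC, hC, Fin.sum_univ_castSucc, Fin.sum_univ_succ (fun i => c i • (S ^ (k - i)) x), map_add,
    map_smul, map_sum]
  have h0 : S ((S ^ (k - ((0 : Fin (k + 1)) : ℕ))) x) = 0 := by
    rw [← Module.End.mul_apply, ← pow_succ']
    exact hx1
  have h1 : (Jmat (k + 1) 0 *ᵥ c) (Fin.last k) = 0 := by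
    rw [Jmat_mulVec]
    simp
  rw [h0, h1, zero_smul, smul_zero, zero_add, add_zero]
  refine Finset.sum_congr rfl fun i _ => ?_
  have h2 : (Jmat (k + 1) 0 *ᵥ c) i.castSucc = c i.succ := by
    rw [Jmat_mulVec, dif_pos (by simp), zero_mul, zero_add]
    rfl
  rw [h2, map_smul, ← Module.End.mul_apply, ← pow_succ']
  congr 3
  have := i.2
  simp only [Fin.val_castSucc, Fin.val_succ]
  omega

theorem Jmat_mulVec_eq_add {k : ℕ} (μ : ℂ) (x : Fin k → ℂ) :
    Jmat k μ *ᵥ x = Jmat k 0 *ᵥ x + μ • x := by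
  ext i
  rw [Pi.add_apply, Jmat_mulVec, Jmat_mulVec, Pi.smul_apply, smul_eq_mul]
  ring

namespace KMod

theorem exists_ofMat_iso (M : KMod) :
    ∃ P : Pencil (Module.finrank ℂ M.W) (Module.finrank ℂ M.V), Iso (ofMat P) M := by
  let e := (Module.finBasis ℂ M.V).equivFun
  let f := (Module.finBasis ℂ M.W).equivFun
  refine ⟨(LinearMap.toMatrix' (f.toLinearMap ∘ₗ M.a ∘ₗ e.symm.toLinearMap),
    LinearMap.toMatrix' (f.toLinearMap ∘ₗ M.b ∘ₗ e.symm.toLinearMap)), Iso.symm ?_⟩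
  have key : ∀ (c : M.V →ₗ[ℂ] M.W) (x : M.V), f (c x) =
      LinearMap.toMatrix' (f.toLinearMap ∘ₗ c ∘ₗ e.symm.toLinearMap) *ᵥ (e x) := by
    intro c x
    rw [← Matrix.toLin'_apply, Matrix.toLin'_toMatrix']
    simp
  exact ⟨e, f, key _, key _⟩

theorem exists_split_E (M : KMod) (hb : Function.Bijective M.b) (μ : ℂ)
    (hμ : ¬ Function.Injective (M.a - μ • M.b)) :
    ∃ (k : ℕ) (N : KMod), Iso ((blk (.E (k + 1) μ)).prod N) M := by
  let B := LinearEquiv.ofBijective M.b hb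
  have hB : ∀ x, B x = M.b x := fun _ => rfl
  let S : M.V →ₗ[ℂ] M.V := B.symm.toLinearMap ∘ₗ M.a - μ • LinearMap.id
  have hS : ∀ x, M.b (S x) = M.a x - μ • M.b x := by
    intro x
    change M.b (B.symm (M.a x) - μ • x) = _
    rw [map_sub, map_smul, ← hB, B.apply_symm_apply]
  obtain ⟨k, U, hU, e, he⟩ := exists_shift_splitting S (fun h => hμ fun x y hxy => h (hb.1 (by
    rw [hS, hS]; exact hxy)))
  refine ⟨k, ⟨U, U, S.restrict hU + μ • LinearMap.id, LinearMap.id⟩, e, e.trans B, ?_, ?_⟩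
  · have key : ∀ (c : Fin (k + 1) → ℂ) (u : U),
        M.b (e (Jmat (k + 1) μ *ᵥ c, S.restrict hU u + μ • u)) = M.a (e (c, u)) := by
      intro c u
      have h := hS (e (c, u))
      rw [← he] at h
      rw [Jmat_mulVec_eq_add, ← Prod.mk_add_mk, ← Prod.smul_mk, map_add, map_add, map_smul,
        map_smul, h, sub_add_cancel]
    exact fun x => key x.1 x.2
  · have key : ∀ (c : Fin (k + 1) → ℂ) (u : U),
        M.b (e ((1 : Matrix (Fin (k + 1)) (Fin (k + 1)) ℂ) *ᵥ c, u)) = M.b (e (c, u)) := by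
      intro c u
      rw [Matrix.one_mulVec]
    exact fun x => key x.1 x.2

/-- Both maps are jointly injective on a right reflection. -/
def right (M : KMod) : KMod :=
  ⟨M.W, (M.W × M.W) ⧸ LinearMap.range (M.b.prod (-M.a)),
    (LinearMap.range (M.b.prod (-M.a))).mkQ ∘ₗ LinearMap.inl ℂ M.W M.W,
    (LinearMap.range (M.b.prod (-M.a))).mkQ ∘ₗ LinearMap.inr ℂ M.W M.W⟩

theorem right_rel (M : KMod) (x : M.V) : M.right.a (M.b x) = M.right.b (M.a x) := by
  refine (Submodule.Quotient.eq (LinearMap.range (M.b.prod (-M.a)))).2 ?_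
  exact ⟨x, by simp⟩

theorem iso_left_right (M : KMod) (h : ∀ x, M.a x = 0 → M.b x = 0 → x = 0) :
    Iso M M.right.left := by
  refine iso_left (LinearEquiv.refl ℂ _) (fun v => (right_rel M v).symm) h fun x y hxy => ?_
  obtain ⟨v, hv⟩ := (Submodule.Quotient.eq (LinearMap.range (M.b.prod (-M.a)))).1 hxy
  have h1 : M.b v = 0 - (show M.W from y) := congrArg Prod.fst hv
  have h2 : -M.a v = (show M.W from x) - 0 := congrArg Prod.snd hv
  refine ⟨-v, ?_, ?_⟩
  · change M.a (-v) = x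
    rw [map_neg, h2, sub_zero]
  · change M.b (-v) = y
    rw [map_neg, h1, zero_sub, neg_neg]

theorem finrank_right_W (M : KMod) (h : ∀ x, M.a x = 0 → M.b x = 0 → x = 0) :
    Module.finrank ℂ M.right.W + Module.finrank ℂ M.V = 2 * Module.finrank ℂ M.W := by
  have h1 := Submodule.finrank_quotient_add_finrank (LinearMap.range (M.b.prod (-M.a)))
  rw [LinearMap.finrank_range_of_inj, Module.finrank_prod, ← two_mul] at h1
  · exact h1
  · rw [injective_iff_map_eq_zero]
    intro x hx
    refine h x ?_ (congrArg Prod.fst hx)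
    exact neg_eq_zero.1 (congrArg Prod.snd hx)

theorem exists_split_L_zero (M : KMod) (x : M.V) (hx : x ≠ 0) (ha : M.a x = 0) (hb : M.b x = 0) :
    ∃ N : KMod, Iso ((blk (.L 0)).prod N) M := by
  obtain ⟨U, hU⟩ := Submodule.exists_isCompl (ℂ ∙ x)
  let e : ((Fin 1 → ℂ) × U) ≃ₗ[ℂ] M.V :=
    (((LinearEquiv.funUnique (Fin 1) ℂ ℂ).trans
      (LinearEquiv.toSpanNonzeroSingleton ℂ M.V x hx)).prodCongr (LinearEquiv.refl ℂ U)).trans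
      (Submodule.prodEquivOfIsCompl _ _ hU)
  have he : ∀ c u, e (c, u) = c 0 • x + u := fun _ _ => rfl
  let f : ((Fin 0 → ℂ) × M.W) ≃ₗ[ℂ] M.W :=
    { toFun := fun y => y.2
      map_add' := fun _ _ => rfl
      map_smul' := fun _ _ => rfl
      invFun := fun y => (0, y)
      left_inv := fun _ => Prod.ext (Subsingleton.elim _ _) rfl
      right_inv := fun _ => rfl }
  refine ⟨⟨U, M.W, M.a ∘ₗ U.subtype, M.b ∘ₗ U.subtype⟩, e, f, ?_, ?_⟩
  · rintro ⟨c, u⟩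
    refine Eq.trans ?_ (congrArg M.a (he c u)).symm
    rw [map_add, map_smul, ha, smul_zero, zero_add]
    rfl
  · rintro ⟨c, u⟩
    refine Eq.trans ?_ (congrArg M.b (he c u)).symm
    rw [map_add, map_smul, hb, smul_zero, zero_add]
    rfl

/-- A nonzero polynomial vector of degree at most `n` in the kernel of the pencil. -/
def HasKernelPoly (M : KMod) (n : ℕ) : Prop :=
  ∃ x : ℕ → M.V, x ≠ 0 ∧ M.a (x 0) = 0 ∧ (∀ i, M.a (x (i + 1)) = M.b (x i)) ∧ ∀ i, n < i → x i = 0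

theorem exists_shift_injective_or_hasKernelPoly {n : ℕ} (P : Pencil n n) :
    (∃ c : ℂ, Function.Injective ((ofMat P).a - c • (ofMat P).b)) ∨
      ∃ k, HasKernelPoly (ofMat P) k := by
  let X : Matrix (Fin n) (Fin n) (Polynomial ℂ) :=
    P.1.map Polynomial.C - (Polynomial.X : Polynomial ℂ) • P.2.map Polynomial.C
  by_cases hX : X.det = 0
  · right
    obtain ⟨v, hv0, hv⟩ := Matrix.exists_mulVec_eq_zero_iff.2 hX
    have hcoeff : ∀ (Q : Matrix (Fin n) (Fin n) ℂ) (i : Fin n) (k : ℕ),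
        ((Q.map Polynomial.C *ᵥ v) i).coeff k = (Q *ᵥ fun j => (v j).coeff k) i := by
      intro Q i k
      simp [Matrix.mulVec, dotProduct, Polynomial.finsetSum_coeff]
    have hv' : P.1.map Polynomial.C *ᵥ v =
        (Polynomial.X : Polynomial ℂ) • (P.2.map Polynomial.C *ᵥ v) := by
      rw [Matrix.sub_mulVec, sub_eq_zero, Matrix.smul_mulVec] at hv
      exact hv
    refine ⟨Finset.univ.sup fun j => (v j).natDegree, fun k j => (v j).coeff k, ?_, ?_, ?_, ?_⟩
    · intro h
      exact hv0 (funext fun j => Polynomial.ext fun k => congrFun (congrFun h k) j)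
    · refine funext fun i => ?_
      change (P.1 *ᵥ _) i = 0
      rw [← hcoeff, hv', Pi.smul_apply, smul_eq_mul, Polynomial.coeff_X_mul_zero]
    · intro k
      refine funext fun i => ?_
      change (P.1 *ᵥ _) i = (P.2 *ᵥ _) i
      rw [← hcoeff, ← hcoeff, hv', Pi.smul_apply, smul_eq_mul, Polynomial.coeff_X_mul]
    · intro k hk
      refine funext fun j => ?_
      refine Polynomial.coeff_eq_zero_of_natDegree_lt (lt_of_le_of_lt ?_ hk)
      exact Finset.le_sup (f := fun j => (v j).natDegree) (Finset.mem_univ j)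
  · left
    obtain ⟨c, hc⟩ : ∃ c : ℂ, X.det.eval c ≠ 0 := by
      by_contra! h
      exact hX (Polynomial.funext fun c => by rw [h c, Polynomial.eval_zero])
    refine ⟨c, ?_⟩
    have h1 : (P.1 - c • P.2).det ≠ 0 := by
      rw [← Polynomial.coe_evalRingHom, RingHom.map_det] at hc
      convert hc using 2
      ext i j
      simp only [X, RingHom.mapMatrix_apply, Matrix.map_apply, Matrix.sub_apply, Matrix.smul_apply,
        smul_eq_mul, map_sub, Polynomial.coe_evalRingHom, Polynomial.eval_C, Polynomial.eval_mul,
        Polynomial.eval_X]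
    have h2 : Function.Injective (P.1 - c • P.2).mulVec :=
      Matrix.mulVec_injective_iff_isUnit.2 ((Matrix.isUnit_iff_isUnit_det _).2 h1.isUnit)
    have h3 : ∀ x : Fin n → ℂ, (P.1 - c • P.2) *ᵥ x = ((ofMat P).a - c • (ofMat P).b) x := by
      intro x
      rw [Matrix.sub_mulVec, Matrix.smul_mulVec]
      rfl
    exact fun x y hxy => h2 ((h3 x).trans (hxy.trans (h3 y).symm))

/-- Total dimension. -/
def dim (M : KMod) : ℕ := Module.finrank ℂ M.V + Module.finrank ℂ M.W

theorem Iso.dim_eq {M N : KMod} (h : Iso M N) : M.dim = N.dim := by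
  rw [dim, dim, h.finrank_V, h.finrank_W]

theorem dim_prod (M N : KMod) : (M.prod N).dim = M.dim + N.dim := by
  have h1 : Module.finrank ℂ (M.prod N).V = _ := Module.finrank_prod (R := ℂ) (M := M.V) (M' := N.V)
  have h2 : Module.finrank ℂ (M.prod N).W = _ := Module.finrank_prod (R := ℂ) (M := M.W) (M' := N.W)
  rw [dim, dim, dim, h1, h2]
  omega

theorem dim_blk_pos {b : KBlock} (hb : b.rows + b.cols ≠ 0) : 0 < (blk b).dim := by
  have h1 : Module.finrank ℂ (blk b).V = _ := finrank_ofMat_V b.toPencil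
  have h2 : Module.finrank ℂ (blk b).W = _ := finrank_ofMat_W b.toPencil
  rw [dim, h1, h2, Fintype.card_fin, Fintype.card_fin]
  omega

theorem isSum_of_split {d : ℕ} (ih : ∀ M : KMod, M.dim < d → IsSum M) {M N : KMod} {b : KBlock}
    (hb : b.rows + b.cols ≠ 0) (h : Iso ((blk b).prod N) M) (hd : M.dim ≤ d) : IsSum M := by
  refine ((isSum_blk b).prod (ih N ?_)).of_iso h
  have := h.dim_eq
  rw [dim_prod] at this
  have := dim_blk_pos hb
  omega

theorem isSum_of_bijective_a {d : ℕ} (ih : ∀ M : KMod, M.dim < d → IsSum M) (M : KMod)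
    (ha : Function.Bijective M.a) (hb : ¬ Function.Injective M.b) (hd : M.dim ≤ d) : IsSum M := by
  obtain ⟨k, N, hN⟩ := exists_split_E M.swap ha 0 (by
    intro h
    rw [zero_smul, sub_zero] at h
    exact hb h)
  have h : Iso ((blk (.Einf (k + 1))).prod N.swap) M := hN.swap
  exact isSum_of_split ih (b := .Einf (k + 1)) (by simp [KBlock.rows]) h hd

theorem isSum_of_bijective_b {d : ℕ} (ih : ∀ M : KMod, M.dim < d → IsSum M) (M : KMod)
    (hb : Function.Bijective M.b) (hd : M.dim ≤ d) : IsSum M := by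
  rcases subsingleton_or_nontrivial M.V with hV | hV
  · have : Subsingleton M.W := hb.surjective.subsingleton
    exact isSum_of_subsingleton M
  · let B := LinearEquiv.ofBijective M.b hb
    obtain ⟨μ, hμ⟩ := Module.End.exists_eigenvalue (B.symm.toLinearMap ∘ₗ M.a)
    obtain ⟨x, hx, hx0⟩ := hμ.exists_hasEigenvector
    rw [Module.End.mem_eigenspace_iff] at hx
    have hx' : M.a x = μ • M.b x := by
      have := congrArg B hx
      rw [map_smul] at this
      exact (B.apply_symm_apply _).symm.trans this
    obtain ⟨k, N, hN⟩ := exists_split_E M hb μ (fun h => hx0 (h (by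
      rw [LinearMap.sub_apply, LinearMap.smul_apply, hx', sub_self, map_zero])))
    exact isSum_of_split ih (b := .E (k + 1) μ) (by simp [KBlock.rows]) hN hd

theorem isSum_of_bijective_shift {d : ℕ} (ih : ∀ M : KMod, M.dim < d → IsSum M) (M : KMod)
    (c : ℂ) (hc : Function.Bijective (M.a - c • M.b)) (hb : ¬ Function.Injective M.b)
    (hd : M.dim ≤ d) : IsSum M := by
  let B := LinearEquiv.ofBijective (M.a - c • M.b) hc
  have hB : ∀ x, B x = M.a x - c • M.b x := fun _ => rfl
  let S : M.V →ₗ[ℂ] M.V := B.symm.toLinearMap ∘ₗ M.b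
  have hS : ∀ x, B (S x) = M.b x := fun x => B.apply_symm_apply _
  obtain ⟨k, U, hU, e, he⟩ := exists_shift_splitting S (fun h => hb fun x y hxy => h
    (congrArg B.symm hxy))
  let J : (Fin (k + 1) → ℂ) →ₗ[ℂ] (Fin (k + 1) → ℂ) := (Jmat (k + 1) 0).mulVecLin
  let P : KMod := ⟨Fin (k + 1) → ℂ, Fin (k + 1) → ℂ, LinearMap.id + c • J, J⟩
  let N : KMod := ⟨U, U, LinearMap.id + c • S.restrict hU, S.restrict hU⟩
  have hJ : ∀ x : Fin (k + 1) → ℂ, J x (Fin.last k) = 0 := by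
    intro x
    change (Jmat (k + 1) 0 *ᵥ x) _ = 0
    rw [Jmat_mulVec]
    simp
  have hPb : ¬ Function.Injective J := by
    intro h
    obtain ⟨x, hx⟩ := (LinearMap.injective_iff_surjective (f := J)).1 h (Pi.single (Fin.last k) 1)
    have := hJ x
    rw [hx, Pi.single_eq_same] at this
    exact one_ne_zero this
  have hJs : ∀ (x : Fin (k + 1) → ℂ) (i : Fin k), J x i.castSucc = x i.succ := by
    intro x i
    change (Jmat (k + 1) 0 *ᵥ x) _ = _
    rw [Jmat_mulVec, dif_pos (by simp), zero_mul, zero_add]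
    rfl
  have hPa : Function.Bijective ((LinearMap.id : (Fin (k + 1) → ℂ) →ₗ[ℂ] _) + c • J) := by
    have h1 : Function.Injective ((LinearMap.id : (Fin (k + 1) → ℂ) →ₗ[ℂ] _) + c • J) := by
      rw [injective_iff_map_eq_zero]
      intro x hx
      have hx' : ∀ i, x i + c * J x i = 0 := fun i => congrFun hx i
      refine funext fun i => ?_
      refine Fin.reverseInduction ?_ (fun i hi => ?_) i
      · have := hx' (Fin.last k)
        rwa [hJ, mul_zero, add_zero] at this
      · have := hx' i.castSucc
        rwa [hJs, hi, Pi.zero_apply, mul_zero, add_zero] at this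
    exact ⟨h1, LinearMap.injective_iff_surjective.1 h1⟩
  have hiso : Iso (P.prod N) M := by
    refine ⟨e, e.trans B, ?_, ?_⟩
    · rintro ⟨x, u⟩
      change B (e (x + c • J x, u + c • S.restrict hU u)) = M.a (e (x, u))
      have h1 : e (J x, S.restrict hU u) = S (e (x, u)) := he x u
      rw [← Prod.mk_add_mk, ← Prod.smul_mk, map_add, map_add, map_smul, map_smul, h1, hS, hB,
        sub_add_cancel]
    · rintro ⟨x, u⟩
      change B (e (Jmat (k + 1) 0 *ᵥ x, S.restrict hU u)) = M.b (e (x, u))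
      rw [he, hS]
  have hdim := hiso.dim_eq
  rw [dim_prod] at hdim
  have hPd : 0 < P.dim := by
    have : Module.finrank ℂ P.V = k + 1 := Module.finrank_fin_fun ℂ
    rw [dim]
    omega
  exact ((isSum_of_bijective_a ih P hPa hPb (by omega)).prod (ih N (by omega))).of_iso hiso

theorem isSum_of_hasKernelPoly {d : ℕ} (ih : ∀ M : KMod, M.dim < d → IsSum M) (n : ℕ) :
    ∀ M : KMod, M.dim = d → Module.finrank ℂ M.V = Module.finrank ℂ M.W → HasKernelPoly M n →
      IsSum M := by
  induction n with
  | zero =>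
    rintro M hd - ⟨x, hx, h0, hs, hn⟩
    have hx0 : x 0 ≠ 0 := fun h => hx (funext fun i => by
      rcases i with _ | i
      · exact h
      · exact hn _ i.succ_pos)
    have hb : M.b (x 0) = 0 := by rw [← hs, hn 1 one_pos, map_zero]
    obtain ⟨N, hN⟩ := exists_split_L_zero M (x 0) hx0 h0 hb
    exact isSum_of_split ih (b := .L 0) (by simp [KBlock.cols]) hN hd.le
  | succ n ihn =>
    rintro M hd hVW ⟨x, hx, h0, hs, hn⟩
    by_cases hker : ∀ x, M.a x = 0 → M.b x = 0 → x = 0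
    · refine IsSum.of_iso (IsSum.left ?_) (iso_left_right M hker).symm
      have hW := finrank_right_W M hker
      have hV : Module.finrank ℂ M.right.V = Module.finrank ℂ M.W := rfl
      refine ihn M.right ?_ (by omega) ⟨fun i => M.b (x i), fun h => hx (funext fun i => ?_), ?_,
        fun i => ?_, fun i hi => ?_⟩
      · rw [dim] at hd ⊢
        omega
      · refine hker _ ?_ (congrFun h i)
        rcases i with _ | i
        · exact h0
        · rw [hs]
          exact congrFun h i
      · refine (right_rel M _).trans ?_
        rw [h0]
        exact map_zero _
      · refine (right_rel M _).trans ?_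
        rw [hs]
      · change M.b (x i) = 0
        rw [← hs, hn _ (by omega), map_zero]
    · push Not at hker
      obtain ⟨y, ha, hb, hy⟩ := hker
      obtain ⟨N, hN⟩ := exists_split_L_zero M y hy ha hb
      exact isSum_of_split ih (b := .L 0) (by simp [KBlock.cols]) hN hd.le

theorem isSum_of_finrank_lt {d : ℕ} (ih : ∀ M : KMod, M.dim < d → IsSum M) (M : KMod)
    (hd : M.dim = d) (h : Module.finrank ℂ M.W < Module.finrank ℂ M.V) : IsSum M := by
  by_cases hker : ∀ x, M.a x = 0 → M.b x = 0 → x = 0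
  · refine IsSum.of_iso (IsSum.left (ih _ ?_)) (iso_left_right M hker).symm
    have hW := finrank_right_W M hker
    have hV : Module.finrank ℂ M.right.V = Module.finrank ℂ M.W := rfl
    rw [dim] at hd ⊢
    omega
  · push Not at hker
    obtain ⟨y, ha, hb, hy⟩ := hker
    obtain ⟨N, hN⟩ := exists_split_L_zero M y hy ha hb
    exact isSum_of_split ih (b := .L 0) (by simp [KBlock.cols]) hN hd.le

theorem isSum_of_finrank_eq {d : ℕ} (ih : ∀ M : KMod, M.dim < d → IsSum M) (M : KMod)
    (hd : M.dim = d) (h : Module.finrank ℂ M.V = Module.finrank ℂ M.W) : IsSum M := by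
  have := exists_ofMat_iso M
  rw [h] at this
  obtain ⟨P, hP⟩ := this
  refine IsSum.of_iso ?_ hP
  have hd' := hP.dim_eq.trans hd
  rcases exists_shift_injective_or_hasKernelPoly P with ⟨c, hc⟩ | ⟨n, hn⟩
  · have hfin : Module.finrank ℂ (ofMat P).V = Module.finrank ℂ (ofMat P).W := rfl
    by_cases hb : Function.Injective (ofMat P).b
    · exact isSum_of_bijective_b ih _
        ⟨hb, (LinearMap.injective_iff_surjective_of_finrank_eq_finrank hfin).1 hb⟩ hd'.le
    · exact isSum_of_bijective_shift ih _ c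
        ⟨hc, (LinearMap.injective_iff_surjective_of_finrank_eq_finrank hfin).1 hc⟩ hb hd'.le
  · exact isSum_of_hasKernelPoly ih n _ hd' rfl hn

/-- Every Kronecker module is a direct sum of canonical blocks. -/
theorem isSum (M : KMod) : IsSum M := by
  obtain ⟨d, hd⟩ : ∃ d, M.dim = d := ⟨_, rfl⟩
  induction d using Nat.strong_induction_on generalizing M with
  | _ d ih =>
    have ih' : ∀ M : KMod, M.dim < d → IsSum M := fun M hM => ih _ hM M rfl
    rcases lt_trichotomy (Module.finrank ℂ M.V) (Module.finrank ℂ M.W) with h | h | h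
    · have hV : Module.finrank ℂ M.dual.V = Module.finrank ℂ M.W := Subspace.dual_finrank_eq
      have hW : Module.finrank ℂ M.dual.W = Module.finrank ℂ M.V := Subspace.dual_finrank_eq
      refine IsSum.of_dual (isSum_of_finrank_lt ih' M.dual ?_ (by omega))
      rw [dim] at hd ⊢
      omega
    · exact isSum_of_finrank_eq ih' M hd h
    · exact isSum_of_finrank_lt ih' M hd h

end KMod

/-! ### Dimensions of chain spaces -/

/-- Extension of a finite sequence by zero. -/
def extZ {X : Type} [Zero X] {k : ℕ} (x : Fin k → X) (i : ℕ) : X :=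
  if h : i < k then x ⟨i, h⟩ else 0

theorem extZ_of_lt {X : Type} [Zero X] {k : ℕ} (x : Fin k → X) {i : ℕ} (h : i < k) :
    extZ x i = x ⟨i, h⟩ := dif_pos h

theorem extZ_of_le {X : Type} [Zero X] {k : ℕ} (x : Fin k → X) {i : ℕ} (h : k ≤ i) :
    extZ x i = 0 := dif_neg (not_lt.2 h)

theorem extZ_comp {X Y : Type} [Zero X] [Zero Y] {k : ℕ} (x : Fin k → X) (g : X → Y) (hg : g 0 = 0)
    (i : ℕ) : extZ (fun j => g (x j)) i = g (extZ x i) := by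
  unfold extZ
  split_ifs <;> simp [hg]

namespace KMod

/-- The map whose kernel consists of the chains `x₀, …, x_{k-1}` with `a x₀ = 0` and
`a x_{i+1} = b x_i` for `i + 1 < K`. -/
def chainMap (M : KMod) (k K : ℕ) : (Fin k → M.V) →ₗ[ℂ] (Fin K → M.W) where
  toFun x i := M.a (extZ x i) - if (i : ℕ) = 0 then 0 else M.b (extZ x (i - 1))
  map_add' x y := by
    have h : ∀ i, extZ (x + y) i = extZ x i + extZ y i := by
      intro i
      unfold extZ
      split_ifs <;> simp
    ext i
    simp only [h, map_add, Pi.add_apply]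
    split_ifs <;> abel
  map_smul' c x := by
    have h : ∀ i, extZ (c • x) i = c • extZ x i := by
      intro i
      unfold extZ
      split_ifs <;> simp
    ext i
    simp only [h, map_smul, Pi.smul_apply, RingHom.id_apply]
    split_ifs <;> simp [smul_sub]

theorem mem_ker_chainMap {M : KMod} {k K : ℕ} {x : Fin k → M.V} :
    x ∈ LinearMap.ker (M.chainMap k K) ↔
      (0 < K → M.a (extZ x 0) = 0) ∧ ∀ i, i + 1 < K → M.a (extZ x (i + 1)) = M.b (extZ x i) := by
  rw [LinearMap.mem_ker, funext_iff]
  constructor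
  · intro h
    refine ⟨fun h0 => ?_, fun i hi => ?_⟩
    · simpa [chainMap] using h ⟨0, h0⟩
    · simpa [chainMap, sub_eq_zero] using h ⟨i + 1, hi⟩
  · rintro ⟨h0, hs⟩ ⟨i, hi⟩
    rcases i with _ | i
    · simpa [chainMap] using h0 hi
    · simpa [chainMap, sub_eq_zero] using hs i hi

/-- Dimension of the space of chains. -/
def chainDim (M : KMod) (k K : ℕ) : ℕ := Module.finrank ℂ (LinearMap.ker (M.chainMap k K))

theorem Iso.chainDim_le {M N : KMod} (k K : ℕ) : Iso M N → M.chainDim k K ≤ N.chainDim k K := by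
  rintro ⟨e, f, h1, h2⟩
  have hmem : ∀ x ∈ LinearMap.ker (M.chainMap k K),
      (fun i => e (x i)) ∈ LinearMap.ker (N.chainMap k K) := by
    intro x hx
    rw [mem_ker_chainMap] at hx ⊢
    refine ⟨fun h0 => ?_, fun i hi => ?_⟩
    · rw [extZ_comp x e (map_zero e), ← h1, hx.1 h0, map_zero]
    · rw [extZ_comp x e (map_zero e), extZ_comp x e (map_zero e), ← h1, ← h2, hx.2 i hi]
  let φ : LinearMap.ker (M.chainMap k K) →ₗ[ℂ] LinearMap.ker (N.chainMap k K) :=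
    { toFun := fun x => ⟨fun i => e (x.1 i), hmem x.1 x.2⟩
      map_add' := fun x y => Subtype.ext (funext fun i => map_add e _ _)
      map_smul' := fun c x => Subtype.ext (funext fun i => map_smul e _ _) }
  refine LinearMap.finrank_le_finrank_of_injective (f := φ) fun x y hxy => ?_
  exact Subtype.ext (funext fun i => e.injective (congrFun (congrArg Subtype.val hxy) i))

theorem Iso.chainDim_eq {M N : KMod} (k K : ℕ) (h : Iso M N) : M.chainDim k K = N.chainDim k K :=
  le_antisymm (h.chainDim_le k K) (h.symm.chainDim_le k K)

theorem chainDim_prod (M N : KMod) (k K : ℕ) :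
    (M.prod N).chainDim k K = M.chainDim k K + N.chainDim k K := by
  have h1 : ∀ x : Fin k → M.V × N.V, x ∈ LinearMap.ker ((M.prod N).chainMap k K) ↔
      (fun i => (x i).1) ∈ LinearMap.ker (M.chainMap k K) ∧
      (fun i => (x i).2) ∈ LinearMap.ker (N.chainMap k K) := by
    intro x
    have ha : ∀ y : M.V × N.V, (M.prod N).a y = (M.a y.1, N.a y.2) := fun _ => rfl
    have hb : ∀ y : M.V × N.V, (M.prod N).b y = (M.b y.1, N.b y.2) := fun _ => rfl
    have e1 := extZ_comp x Prod.fst rfl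
    have e2 := extZ_comp x Prod.snd rfl
    refine (mem_ker_chainMap (M := M.prod N)).trans ?_
    rw [mem_ker_chainMap, mem_ker_chainMap]
    simp only [e1, e2]
    constructor
    · rintro ⟨h0, hs⟩
      exact ⟨⟨fun h => congrArg Prod.fst (h0 h), fun i hi => congrArg Prod.fst (hs i hi)⟩,
        ⟨fun h => congrArg Prod.snd (h0 h), fun i hi => congrArg Prod.snd (hs i hi)⟩⟩
    · rintro ⟨⟨h0, hs⟩, ⟨h0', hs'⟩⟩
      exact ⟨fun h => Prod.ext (h0 h) (h0' h), fun i hi => Prod.ext (hs i hi) (hs' i hi)⟩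
  let φ : LinearMap.ker ((M.prod N).chainMap k K) ≃ₗ[ℂ]
      LinearMap.ker (M.chainMap k K) × LinearMap.ker (N.chainMap k K) :=
    { toFun := fun x => (⟨fun i => (x.1 i).1, ((h1 x.1).1 x.2).1⟩,
        ⟨fun i => (x.1 i).2, ((h1 x.1).1 x.2).2⟩)
      map_add' := fun _ _ => rfl
      map_smul' := fun _ _ => rfl
      invFun := fun y => ⟨fun i => (y.1.1 i, y.2.1 i), (h1 _).2 ⟨y.1.2, y.2.2⟩⟩
      left_inv := fun _ => rfl
      right_inv := fun _ => rfl }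
  exact φ.finrank_eq.trans Module.finrank_prod

theorem chainDim_of_subsingleton (M : KMod) [Subsingleton M.V] (k K : ℕ) :
    M.chainDim k K = 0 := by
  have : Subsingleton (Fin k → M.V) := inferInstance
  exact Module.finrank_zero_of_subsingleton

theorem chainDim_eq_zero {M : KMod} {k K : ℕ}
    (h : ∀ x ∈ LinearMap.ker (M.chainMap k K), ∀ i, extZ x i = 0) : M.chainDim k K = 0 := by
  have : Subsingleton (LinearMap.ker (M.chainMap k K)) := by
    refine ⟨fun x y => Subtype.ext (funext fun i => ?_)⟩
    rw [← extZ_of_lt x.1 i.2, h _ x.2, ← extZ_of_lt y.1 i.2, h _ y.2]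
  exact Module.finrank_zero_of_subsingleton

theorem chainDim_eq_zero_of_injective_a (M : KMod) {k K : ℕ} (hK : k ≤ K)
    (ha : Function.Injective M.a) : M.chainDim k K = 0 := by
  refine chainDim_eq_zero fun x hx i => ?_
  rw [mem_ker_chainMap] at hx
  induction i with
  | zero =>
    by_cases hk : 0 < k
    · exact ha ((hx.1 (by omega)).trans (map_zero _).symm)
    · exact extZ_of_le x (by omega)
  | succ i ih =>
    by_cases hk : i + 1 < k
    · exact ha ((hx.2 i (by omega)).trans (by rw [ih, map_zero, map_zero]))
    · exact extZ_of_le x (by omega)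

theorem chainDim_eq_zero_of_injective_b (M : KMod) {k : ℕ} (hb : Function.Injective M.b) :
    M.chainDim k (k + 1) = 0 := by
  refine chainDim_eq_zero fun x hx => ?_
  rw [mem_ker_chainMap] at hx
  have : ∀ n i, k - i = n → extZ x i = 0 := by
    intro n
    induction n with
    | zero => exact fun i hi => extZ_of_le x (by omega)
    | succ n ih =>
      intro i hi
      exact hb ((hx.2 i (by omega)).symm.trans (by rw [ih (i + 1) (by omega), map_zero, map_zero]))
  exact fun i => this _ i rfl

theorem chainDim_of_surjective_a (M : KMod) (k : ℕ) (ha : Function.Surjective M.a) :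
    M.chainDim k k + k * Module.finrank ℂ M.W = k * Module.finrank ℂ M.V := by
  have hsurj : Function.Surjective (M.chainMap k k) := by
    intro y
    let z : ℕ → M.V := fun n => Nat.rec (Classical.choose (ha (extZ y 0)))
      (fun n zn => Classical.choose (ha (extZ y (n + 1) + M.b zn))) n
    have h0 : M.a (z 0) = extZ y 0 := Classical.choose_spec (ha (extZ y 0))
    have hs : ∀ n, M.a (z (n + 1)) = extZ y (n + 1) + M.b (z n) := fun n =>
      Classical.choose_spec (ha (extZ y (n + 1) + M.b (z n)))
    refine ⟨fun i => z i, funext fun i => ?_⟩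
    have hz : ∀ j, j < k → extZ (fun i : Fin k => z i) j = z j := fun j hj => extZ_of_lt _ hj
    obtain ⟨i, hi⟩ := i
    rcases i with _ | i
    · have : M.a (extZ (fun i : Fin k => z i) 0) = y ⟨0, hi⟩ := by
        rw [hz 0 hi, h0, extZ_of_lt y hi]
      simpa [chainMap] using this
    · have : M.a (extZ (fun i : Fin k => z i) (i + 1)) - M.b (extZ (fun i : Fin k => z i) i) =
          y ⟨i + 1, hi⟩ := by
        rw [hz _ hi, hz i (by omega), hs, add_sub_cancel_right, extZ_of_lt y hi]
      simpa [chainMap] using this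
  have h := LinearMap.finrank_range_add_finrank_ker (M.chainMap k k)
  rw [LinearMap.range_eq_top.2 hsurj, finrank_top, Module.finrank_pi_fintype,
    Module.finrank_pi_fintype] at h
  simp only [Finset.sum_const, Finset.card_univ, Fintype.card_fin, smul_eq_mul] at h
  rw [chainDim, ← h, add_comm]

theorem le_chainDim (M : KMod) (k K : ℕ) :
    k * Module.finrank ℂ M.V ≤ M.chainDim k K + K * Module.finrank ℂ M.W := by
  have h := LinearMap.finrank_range_add_finrank_ker (M.chainMap k K)
  have h2 := Submodule.finrank_le (LinearMap.range (M.chainMap k K))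
  rw [Module.finrank_pi_fintype] at h h2
  simp only [Finset.sum_const, Finset.card_univ, Fintype.card_fin, smul_eq_mul] at h h2
  rw [chainDim]
  omega

/-- Lower semicontinuity of the dimension of chain spaces. -/
theorem le_chainDim_of_mem_closure {m n p q : ℕ} (F : Pencil m n → Pencil p q) (hF : Continuous F)
    {s : Set (Pencil m n)} {P : Pencil m n} (hP : P ∈ closure s) (k K d : ℕ)
    (hd : ∀ X ∈ s, d ≤ (ofMat (F X)).chainDim k K) : d ≤ (ofMat (F P)).chainDim k K := by
  let T : Pencil p q → (Fin k → Fin q → ℂ) →ₗ[ℂ] (Fin K → Fin p → ℂ) :=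
    fun X => (ofMat X).chainMap k K
  have hT : ∀ x, Continuous fun X => T (F X) x := by
    intro x
    refine continuous_pi fun i => ?_
    have : ∀ X, T (F X) x i = (F X).1 *ᵥ (extZ x i) -
      if (i : ℕ) = 0 then 0 else (F X).2 *ᵥ (extZ x (i - 1)) := fun _ => rfl
    simp only [this]
    refine Continuous.sub ((continuous_fst.comp hF).matrix_mulVec continuous_const) ?_
    split_ifs
    · exact continuous_const
    · exact (continuous_snd.comp hF).matrix_mulVec continuous_const
  let B := Module.finBasis ℂ (LinearMap.range (T (F P)))
  have hv : ∀ i, ∃ x, T (F P) x = B i := fun i => (B i).2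
  choose v hv using hv
  have hli : LinearIndependent ℂ fun i => T (F P) (v i) := by
    simp only [hv]
    exact B.linearIndependent.map' (Submodule.subtype _) (Submodule.ker_subtype _)
  have hopen : IsOpen {X | LinearIndependent ℂ fun i => T (F X) (v i)} :=
    isOpen_setOfPred_linearIndependent.preimage (continuous_pi fun i => hT (v i))
  obtain ⟨X, hX, hXs⟩ := mem_closure_iff.1 hP _ hopen hli
  have h1 : Module.finrank ℂ (LinearMap.range (T (F P))) ≤
      Module.finrank ℂ (LinearMap.range (T (F X))) := by
    have : LinearIndependent ℂ fun i => (⟨T (F X) (v i), ⟨v i, rfl⟩⟩ : LinearMap.range (T (F X))) :=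
      LinearIndependent.of_comp (Submodule.subtype _) hX
    simpa using this.fintype_card_le_finrank
  have h2 := LinearMap.finrank_range_add_finrank_ker (T (F P))
  have h3 := LinearMap.finrank_range_add_finrank_ker (T (F X))
  have h4 := hd X hXs
  change d ≤ Module.finrank ℂ (LinearMap.ker (T (F X))) at h4
  change d ≤ Module.finrank ℂ (LinearMap.ker (T (F P)))
  omega

end KMod

/-! ### Chain dimensions of the canonical blocks -/

theorem Jmat_mulVec_extZ {k : ℕ} (μ : ℂ) (x : Fin k → ℂ) (i : Fin k) :
    (Jmat k μ *ᵥ x) i = μ * x i + extZ x (i + 1) := Jmat_mulVec μ x i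

theorem eq_zero_of_recurrence {k : ℕ} (x : Fin k → ℂ) (α β : ℂ) (hα : α ≠ 0)
    (h : ∀ i : Fin k, α * x i + β * extZ x (i + 1) = 0) : x = 0 := by
  have : ∀ n i, k - i = n → extZ x i = 0 := by
    intro n
    induction n with
    | zero => exact fun i hi => extZ_of_le x (by omega)
    | succ n ih =>
      intro i hi
      have h2 := h ⟨i, by omega⟩
      rw [ih (i + 1) (by omega), mul_zero, add_zero] at h2
      rw [extZ_of_lt x (show i < k by omega)]
      exact (mul_eq_zero.1 h2).resolve_left hα
  funext i
  rw [← extZ_of_lt x i.2, this _ _ rfl]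
  rfl

namespace KMod

theorem chainDim_le_of_linearMap {M : KMod} {k K d : ℕ} (φ : (Fin k → M.V) →ₗ[ℂ] (Fin d → ℂ))
    (h : ∀ x ∈ LinearMap.ker (M.chainMap k K), φ x = 0 → x = 0) : M.chainDim k K ≤ d := by
  have : Function.Injective (φ ∘ₗ (LinearMap.ker (M.chainMap k K)).subtype) := by
    rw [injective_iff_map_eq_zero]
    exact fun x hx => Subtype.ext (h x.1 x.2 hx)
  simpa [chainDim] using LinearMap.finrank_le_finrank_of_injective this

theorem le_chainDim_of_linearMap {M : KMod} {k K d : ℕ} (ψ : (Fin d → ℂ) →ₗ[ℂ] (Fin k → M.V))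
    (hψ : ∀ y, ψ y = 0 → y = 0) (h : ∀ y, ψ y ∈ LinearMap.ker (M.chainMap k K)) :
    d ≤ M.chainDim k K := by
  have : Function.Injective (ψ.codRestrict (LinearMap.ker (M.chainMap k K)) h) := by
    rw [injective_iff_map_eq_zero]
    exact fun y hy => hψ y (congrArg Subtype.val hy)
  simpa [chainDim] using LinearMap.finrank_le_finrank_of_injective this

/-- The module with a given eigenvalue moved to zero. -/
def localAt (M : KMod) (μ : Option ℂ) : KMod :=
  ⟨M.V, M.W, μ.elim M.b fun c => M.a - c • M.b, μ.elim M.a fun _ => M.b⟩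

theorem Iso.localAt {M N : KMod} (μ : Option ℂ) : Iso M N → Iso (M.localAt μ) (N.localAt μ) := by
  rintro ⟨e, f, h1, h2⟩
  rcases μ with _ | c
  · exact ⟨e, f, h2, h1⟩
  · have : ∀ x : M.V, f (M.a x - c • M.b x) = N.a (e x) - c • N.b (e x) := fun x => by
      rw [map_sub, map_smul, h1, h2]
    exact ⟨e, f, this, h2⟩

theorem localAt_prod_iso (M N : KMod) (μ : Option ℂ) :
    Iso ((M.prod N).localAt μ) ((M.localAt μ).prod (N.localAt μ)) := by
  rcases μ with _ | c
  · exact Iso.refl _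
  · exact ⟨LinearEquiv.refl ℂ _, LinearEquiv.refl ℂ _, fun _ => rfl, fun _ => rfl⟩

/-- The invariant counting the minimal indices of the right kernel. -/
def dimR (M : KMod) (k : ℕ) : ℕ := M.chainDim k (k + 1)

/-- The invariant counting the chains at an eigenvalue. -/
def dimJ (M : KMod) (μ : Option ℂ) (k : ℕ) : ℕ := (M.localAt μ).chainDim k k

theorem Iso.dimR_eq {M N : KMod} (h : Iso M N) (k : ℕ) : M.dimR k = N.dimR k := h.chainDim_eq _ _

theorem Iso.dimJ_eq {M N : KMod} (h : Iso M N) (μ : Option ℂ) (k : ℕ) :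
    M.dimJ μ k = N.dimJ μ k := (h.localAt μ).chainDim_eq _ _

theorem dimR_prod (M N : KMod) (k : ℕ) : (M.prod N).dimR k = M.dimR k + N.dimR k :=
  chainDim_prod _ _ _ _

theorem dimJ_prod (M N : KMod) (μ : Option ℂ) (k : ℕ) :
    (M.prod N).dimJ μ k = M.dimJ μ k + N.dimJ μ k :=
  ((localAt_prod_iso M N μ).chainDim_eq _ _).trans (chainDim_prod _ _ _ _)

theorem injective_of_zero {V W : Type} [AddCommGroup V] [AddCommGroup W] [Module ℂ V] [Module ℂ W]
    (a : V →ₗ[ℂ] W) (h : ∀ x, a x = 0 → x = 0) : Function.Injective a :=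
  (injective_iff_map_eq_zero a).2 h

theorem snoc_zero_succ {k : ℕ} (x : Fin k → ℂ) (i : Fin k) :
    (Fin.snoc x 0 : Fin (k + 1) → ℂ) i.succ = extZ x (i + 1) := by
  unfold extZ Fin.snoc
  simp only [Fin.val_succ]
  split_ifs <;> rfl

theorem dimR_blk_of_ne_L {b : KBlock} (hb : ∀ a, b ≠ .L a) (k : ℕ) : (blk b).dimR k = 0 := by
  cases b with
  | L a => exact absurd rfl (hb a)
  | E j ν =>
    refine chainDim_eq_zero_of_injective_b _ ?_
    have : ∀ x y : Fin j → ℂ, (1 : Matrix (Fin j) (Fin j) ℂ) *ᵥ x = (1 : Matrix _ _ ℂ) *ᵥ y →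
        x = y := fun x y h => by simpa using h
    exact this
  | Einf j =>
    refine chainDim_eq_zero_of_injective_a _ (Nat.le_succ k) ?_
    have : ∀ x y : Fin j → ℂ, (1 : Matrix (Fin j) (Fin j) ℂ) *ᵥ x = (1 : Matrix _ _ ℂ) *ᵥ y →
        x = y := fun x y h => by simpa using h
    exact this
  | LT j =>
    refine chainDim_eq_zero_of_injective_a _ (Nat.le_succ k) ?_
    have : ∀ x y : Fin j → ℂ, (Fmat j)ᵀ *ᵥ x = (Fmat j)ᵀ *ᵥ y → x = y := by
      intro x y h
      rw [Fmat_transpose_mulVec, Fmat_transpose_mulVec] at h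
      exact funext fun i => congrFun h i.succ
    exact this

theorem dimJ_blk_L (a : ℕ) (μ : Option ℂ) (k : ℕ) : (blk (.L a)).dimJ μ k = k := by
  have hs : Function.Surjective ((blk (.L a)).localAt μ).a := by
    rcases μ with _ | c
    · have : ∀ y : Fin a → ℂ, ∃ x : Fin (a + 1) → ℂ, Gmat a *ᵥ x = y := by
        intro y
        refine ⟨Fin.snoc y 0, ?_⟩
        rw [Gmat_mulVec]
        simp
      exact this
    · have : ∀ y : Fin a → ℂ, ∃ x : Fin (a + 1) → ℂ, Fmat a *ᵥ x - c • (Gmat a *ᵥ x) = y := by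
        intro y
        let z : ℕ → ℂ := fun n => Nat.rec 0 (fun n zn => extZ y n + c * zn) n
        refine ⟨fun i => z i, ?_⟩
        rw [Gmat_mulVec, Fmat_mulVec]
        ext i
        have h1 : z (i + 1) = extZ y i + c * z i := rfl
        rw [extZ_of_lt y i.2] at h1
        simp [h1]
      exact this
  have h := chainDim_of_surjective_a _ k hs
  have hV : Module.finrank ℂ ((blk (.L a)).localAt μ).V = a + 1 :=
    (finrank_ofMat_V (Lblk a)).trans (Fintype.card_fin _)
  have hW : Module.finrank ℂ ((blk (.L a)).localAt μ).W = a :=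
    (finrank_ofMat_W (Lblk a)).trans (Fintype.card_fin _)
  rw [hV, hW, mul_add, mul_one] at h
  unfold dimJ
  omega

theorem dimJ_blk_LT (a : ℕ) (μ : Option ℂ) (k : ℕ) : (blk (.LT a)).dimJ μ k = 0 := by
  refine chainDim_eq_zero_of_injective_a _ le_rfl (injective_of_zero _ ?_)
  rcases μ with _ | c
  · have : ∀ x : Fin a → ℂ, (Gmat a)ᵀ *ᵥ x = 0 → x = 0 := by
      intro x h
      rw [Gmat_transpose_mulVec] at h
      exact funext fun i => by simpa using congrFun h i.castSucc
    exact this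
  · have : ∀ x : Fin a → ℂ, (Fmat a)ᵀ *ᵥ x - c • ((Gmat a)ᵀ *ᵥ x) = 0 → x = 0 := by
      intro x h
      rw [Gmat_transpose_mulVec, Fmat_transpose_mulVec] at h
      refine eq_zero_of_recurrence x 1 (-c) one_ne_zero fun i => ?_
      have h1 : x i - c * (Fin.snoc x 0 : Fin (a + 1) → ℂ) i.succ = 0 := congrFun h i.succ
      rw [snoc_zero_succ] at h1
      linear_combination h1
    exact this

theorem dimJ_blk_Eb_of_ne {μ ν : Option ℂ} (h : μ ≠ ν) (j k : ℕ) :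
    (blk (Eb ν j)).dimJ μ k = 0 := by
  refine chainDim_eq_zero_of_injective_a _ le_rfl (injective_of_zero _ ?_)
  rcases ν with _ | ν <;> rcases μ with _ | c
  · exact absurd rfl h
  · have : ∀ x : Fin j → ℂ, (1 : Matrix (Fin j) (Fin j) ℂ) *ᵥ x - c • (Jmat j 0 *ᵥ x) = 0 →
        x = 0 := by
      intro x h
      refine eq_zero_of_recurrence x 1 (-c) one_ne_zero fun i => ?_
      have h1 := congrFun h i
      simp only [one_mulVec, Pi.sub_apply, Pi.smul_apply, smul_eq_mul, Jmat_mulVec_extZ,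
        Pi.zero_apply] at h1
      linear_combination h1
    exact this
  · have : ∀ x : Fin j → ℂ, (1 : Matrix (Fin j) (Fin j) ℂ) *ᵥ x = 0 → x = 0 := by simp
    exact this
  · have : ∀ x : Fin j → ℂ, Jmat j ν *ᵥ x - c • ((1 : Matrix (Fin j) (Fin j) ℂ) *ᵥ x) = 0 →
        x = 0 := by
      intro x h2
      refine eq_zero_of_recurrence x (ν - c) 1 ?_ fun i => ?_
      · intro h3
        exact h (congrArg some (sub_eq_zero.1 h3).symm)
      have h1 := congrFun h2 i
      simp only [one_mulVec, Pi.sub_apply, Pi.smul_apply, smul_eq_mul, Jmat_mulVec_extZ,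
        Pi.zero_apply] at h1
      linear_combination h1
    exact this

theorem localAt_blk_Eb_iso (μ : Option ℂ) (j : ℕ) :
    Iso ((blk (Eb μ j)).localAt μ) (ofMat (Jmat j 0, (1 : Matrix (Fin j) (Fin j) ℂ))) := by
  rcases μ with _ | c
  · exact Iso.refl _
  · have : ∀ x : Fin j → ℂ, Jmat j c *ᵥ x - c • ((1 : Matrix (Fin j) (Fin j) ℂ) *ᵥ x) =
        Jmat j 0 *ᵥ x := by
      intro x
      rw [Jmat_mulVec_eq_add, one_mulVec, add_sub_cancel_right]
    exact ⟨LinearEquiv.refl ℂ _, LinearEquiv.refl ℂ _, this, fun _ => rfl⟩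

theorem chainDim_Jmat_zero (j k : ℕ) :
    (ofMat (Jmat j 0, (1 : Matrix (Fin j) (Fin j) ℂ))).chainDim k k = min j k := by
  have hJ : ∀ (x : Fin j → ℂ), Jmat j 0 *ᵥ x = fun i : Fin j => extZ x (i + 1) := fun x =>
    funext fun i => by rw [Jmat_mulVec_extZ, zero_mul, zero_add]
  have hmem : ∀ x : Fin k → Fin j → ℂ,
      x ∈ LinearMap.ker ((ofMat (Jmat j 0, (1 : Matrix (Fin j) (Fin j) ℂ))).chainMap k k) ↔
      (0 < k → Jmat j 0 *ᵥ extZ x 0 = 0) ∧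
        ∀ i, i + 1 < k → Jmat j 0 *ᵥ extZ x (i + 1) = extZ x i := by
    intro x
    have h := mem_ker_chainMap (M := ofMat (Jmat j 0, (1 : Matrix (Fin j) (Fin j) ℂ)))
      (k := k) (K := k) (x := x)
    have h1 : ∀ i, (ofMat (Jmat j 0, (1 : Matrix (Fin j) (Fin j) ℂ))).b (extZ x i) = extZ x i :=
      fun i => one_mulVec _
    refine h.trans (and_congr Iff.rfl (forall_congr' fun i => imp_congr Iff.rfl ?_))
    exact Iff.of_eq (congrArg (Jmat j 0 *ᵥ extZ x (i + 1) = ·) (h1 i))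
  rcases Nat.eq_zero_or_pos k with rfl | hk
  · have : ∀ x y : Fin 0 → Fin j → ℂ, x = y := fun x y => funext fun i => i.elim0
    have : Subsingleton (Fin 0 → (ofMat (Jmat j 0, (1 : Matrix (Fin j) (Fin j) ℂ))).V) := ⟨this⟩
    rw [Nat.min_zero]
    exact Module.finrank_zero_of_subsingleton
  refine le_antisymm (le_min ?_ ?_) ?_
  · let φ : (Fin k → Fin j → ℂ) →ₗ[ℂ] (Fin j → ℂ) := LinearMap.proj ⟨k - 1, by omega⟩
    refine chainDim_le_of_linearMap φ ?_
    have : ∀ x : Fin k → Fin j → ℂ,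
      x ∈ LinearMap.ker ((ofMat (Jmat j 0, (1 : Matrix (Fin j) (Fin j) ℂ))).chainMap k k) →
      x ⟨k - 1, by omega⟩ = 0 → x = 0 := by
      intro x hx h0
      rw [hmem] at hx
      have : ∀ n i, i + n + 1 = k → extZ x i = 0 := by
        intro n
        induction n with
        | zero =>
          intro i hi
          rw [extZ_of_lt x (by omega), ← h0]
          congr 2
          omega
        | succ n ih =>
          intro i hi
          rw [← hx.2 i (by omega), ih (i + 1) (by omega), mulVec_zero]
      funext i
      rw [← extZ_of_lt x i.2, this (k - i - 1) i (by omega)]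
      rfl
    exact this
  · rcases Nat.eq_zero_or_pos j with rfl | hj
    · have : ∀ x y : Fin 0 → ℂ, x = y := fun x y => funext fun i => i.elim0
      have : Subsingleton (ofMat (Jmat 0 0, (1 : Matrix (Fin 0) (Fin 0) ℂ))).V := ⟨this⟩
      rw [chainDim_of_subsingleton]
      exact Nat.zero_le _
    let φ : (Fin k → Fin j → ℂ) →ₗ[ℂ] (Fin k → ℂ) :=
      { toFun := fun x i => x i ⟨0, hj⟩
        map_add' := fun _ _ => rfl
        map_smul' := fun _ _ => rfl }
    refine chainDim_le_of_linearMap φ ?_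
    have : ∀ x : Fin k → Fin j → ℂ,
      x ∈ LinearMap.ker ((ofMat (Jmat j 0, (1 : Matrix (Fin j) (Fin j) ℂ))).chainMap k k) →
      (fun i => x i ⟨0, hj⟩) = (0 : Fin k → ℂ) → x = 0 := by
      intro x hx h0
      rw [hmem] at hx
      simp only [hJ] at hx
      have : ∀ p i (hp : p < j) (hi : i < k), x ⟨i, hi⟩ ⟨p, hp⟩ = 0 := by
        intro p
        induction p with
        | zero => exact fun i hp hi => congrFun h0 ⟨i, hi⟩
        | succ p ih =>
          intro i hp hi
          rcases i with _ | i
          · have h1 := congrFun (hx.1 hk) ⟨p, by omega⟩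
            rw [extZ_of_lt x hk, extZ_of_lt _ hp] at h1
            exact h1
          · have h1 := congrFun (hx.2 i hi) ⟨p, by omega⟩
            rw [extZ_of_lt x hi, extZ_of_lt x (show i < k by omega), extZ_of_lt _ hp] at h1
            rw [h1, ih]
      exact funext fun i => funext fun p => this p i p.2 i.2
    exact this
  · let ψ : (Fin (min j k) → ℂ) →ₗ[ℂ] (Fin k → Fin j → ℂ) :=
      { toFun := fun y i p => extZ y (p + (k - 1 - i))
        map_add' := fun x y => by
          ext i p
          simp only [extZ, Pi.add_apply]
          split_ifs <;> simp
        map_smul' := fun c x => by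
          ext i p
          simp only [extZ, Pi.smul_apply, RingHom.id_apply]
          split_ifs <;> simp }
    refine le_chainDim_of_linearMap ψ (fun y hy => ?_) fun y => ?_
    · have : ∀ i p, extZ y ((p : Fin j) + (k - 1 - (i : Fin k))) = 0 := fun i p =>
        congrFun (congrFun hy i) p
      funext p
      have h1 := this ⟨k - 1, by omega⟩ ⟨p, by omega⟩
      simp only [Nat.sub_self, add_zero] at h1
      rw [extZ_of_lt y p.2] at h1
      exact h1
    · let X : Fin k → Fin j → ℂ := fun i p => extZ y (p + (k - 1 - i))
      suffices h : (0 < k → Jmat j 0 *ᵥ extZ X 0 = 0) ∧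
          ∀ i, i + 1 < k → Jmat j 0 *ᵥ extZ X (i + 1) = extZ X i from (hmem X).2 h
      refine ⟨fun _ => ?_, fun i hi => ?_⟩
      · rw [hJ, extZ_of_lt _ hk]
        funext p
        change extZ (fun p : Fin j => extZ y (p + (k - 1 - 0))) (p + 1) = 0
        by_cases hp : (p : ℕ) + 1 < j
        · rw [extZ_of_lt _ hp]
          exact extZ_of_le y (by simp only; omega)
        · exact extZ_of_le _ (by omega)
      · rw [hJ, extZ_of_lt _ hi, extZ_of_lt _ (show i < k by omega)]
        funext p
        change extZ (fun p : Fin j => extZ y (p + (k - 1 - (i + 1)))) (p + 1) =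
          extZ y (p + (k - 1 - i))
        have h3 : (p : ℕ) + 1 + (k - 1 - (i + 1)) = p + (k - 1 - i) := by omega
        by_cases hp : (p : ℕ) + 1 < j
        · rw [extZ_of_lt _ hp]
          exact congrArg (extZ y) h3
        · rw [extZ_of_le _ (by omega), extZ_of_le y (by omega)]

theorem dimJ_blk_Eb (μ : Option ℂ) (j k : ℕ) : (blk (Eb μ j)).dimJ μ k = min j k :=
  ((localAt_blk_Eb_iso μ j).chainDim_eq k k).trans (chainDim_Jmat_zero j k)

theorem dimR_blk_L (a k : ℕ) : (blk (.L a)).dimR k = k - a := by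
  have hmem : ∀ x : Fin k → Fin (a + 1) → ℂ,
      x ∈ LinearMap.ker ((blk (.L a)).chainMap k (k + 1)) ↔
      (∀ p : Fin a, extZ x 0 p.succ = 0) ∧
        ∀ i, i < k → ∀ p : Fin a, extZ x (i + 1) p.succ = extZ x i p.castSucc := by
    intro x
    refine (mem_ker_chainMap (M := blk (.L a))).trans ?_
    have hF : ∀ x : Fin (a + 1) → ℂ, (blk (.L a)).a x = fun i => x i.succ := fun x => Fmat_mulVec x
    have hG : ∀ x : Fin (a + 1) → ℂ, (blk (.L a)).b x = fun i => x i.castSucc :=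
      fun x => Gmat_mulVec x
    constructor
    · rintro ⟨h1, h2⟩
      refine ⟨fun p => ?_, fun i hi p => ?_⟩
      · exact congrFun ((hF _).symm.trans (h1 (Nat.succ_pos k))) p
      · exact congrFun ((hF _).symm.trans ((h2 i (by omega)).trans (hG _))) p
    · rintro ⟨h1, h2⟩
      refine ⟨fun _ => (hF _).trans (funext h1), fun i hi => ?_⟩
      exact (hF _).trans ((funext (h2 i (by omega))).trans (hG _).symm)
  refine le_antisymm ?_ ?_
  · let φ : (Fin k → Fin (a + 1) → ℂ) →ₗ[ℂ] (Fin (k - a) → ℂ) :=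
      { toFun := fun x i => x ⟨i, by omega⟩ 0
        map_add' := fun _ _ => rfl
        map_smul' := fun _ _ => rfl }
    refine chainDim_le_of_linearMap φ ?_
    have : ∀ x : Fin k → Fin (a + 1) → ℂ,
      x ∈ LinearMap.ker ((blk (.L a)).chainMap k (k + 1)) →
      (fun i : Fin (k - a) => x ⟨i, by omega⟩ 0) = 0 → x = 0 := by
      intro x hx h0
      rw [hmem] at hx
      have hA : ∀ q i (hq : q < a + 1), i + q ≤ k → extZ x (i + q) ⟨q, hq⟩ = extZ x i 0 := by
        intro q
        induction q with
        | zero => exact fun i hq hi => rfl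
        | succ q ih =>
          intro i hq hi
          rw [← ih i (by omega) (by omega)]
          exact hx.2 (i + q) (by omega) ⟨q, by omega⟩
      have hB : ∀ i, i < k → extZ x i 0 = 0 := by
        intro i hi
        by_cases h : i < k - a
        · rw [extZ_of_lt x hi]
          exact congrFun h0 ⟨i, h⟩
        · rw [← hA (k - i) i (by omega) (by omega), extZ_of_le x (by omega)]
          rfl
      have hC : ∀ p i (hp : p < a + 1), i < k → extZ x i ⟨p, hp⟩ = 0 := by
        intro p
        induction p with
        | zero => exact fun i hp hi => hB i hi
        | succ p ih =>
          intro i hp hi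
          rcases i with _ | i
          · exact hx.1 ⟨p, by omega⟩
          · exact (hx.2 i (by omega) ⟨p, by omega⟩).trans (ih i (by omega) (by omega))
      funext i p
      have := hC p i p.2 i.2
      rw [extZ_of_lt x i.2] at this
      exact this
    exact this
  · have h := le_chainDim (blk (.L a)) k (k + 1)
    have hV : Module.finrank ℂ (blk (.L a)).V = a + 1 :=
      (finrank_ofMat_V (Lblk a)).trans (Fintype.card_fin _)
    have hW : Module.finrank ℂ (blk (.L a)).W = a :=
      (finrank_ofMat_W (Lblk a)).trans (Fintype.card_fin _)
    rw [hV, hW, mul_add, mul_one, add_mul, one_mul] at h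
    unfold dimR
    omega

end KMod

/-! ### Invariants in terms of the Weyr characteristics -/

theorem Eb_injective {μ ν : Option ℂ} {i j : ℕ} (h : Eb μ i = Eb ν j) : μ = ν ∧ i = j := by
  rcases μ with _ | μ <;> rcases ν with _ | ν <;> simp_all [Eb]

theorem Eb_ne_L (μ : Option ℂ) (i j : ℕ) : Eb μ i ≠ .L j := by
  rcases μ with _ | μ <;> simp [Eb]

theorem Eb_ne_LT (μ : Option ℂ) (i j : ℕ) : Eb μ i ≠ .LT j := by
  rcases μ with _ | μ <;> simp [Eb]

open KMod (dualBlock)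

/-- Case analysis on blocks that treats all eigenvalues alike. -/
@[elab_as_elim]
theorem KBlock.cases_Eb {p : KBlock → Prop} (hL : ∀ a, p (.L a)) (hLT : ∀ a, p (.LT a))
    (hE : ∀ μ a, p (Eb μ a)) (b : KBlock) : p b := by
  cases b with
  | E k μ => exact hE (some μ) k
  | Einf k => exact hE none k
  | L k => exact hL k
  | LT k => exact hLT k

theorem card_filter_cons (p : KBlock → Prop) (b : KBlock) (s : Multiset KBlock) :
    Multiset.card ((b ::ₘ s).filter p) = (if p b then 1 else 0) + Multiset.card (s.filter p) := by
  split_ifs with h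
  · rw [Multiset.filter_cons_of_pos _ h, Multiset.card_cons, add_comm]
  · rw [Multiset.filter_cons_of_neg _ h, zero_add]

theorem psum_succ (p : ℕ → ℕ) (k : ℕ) : psum p (k + 1) = psum p k + p k :=
  Finset.sum_range_succ p k

theorem psum_zero (p : ℕ → ℕ) : psum p 0 = 0 := rfl

theorem psum_add (p q : ℕ → ℕ) (k : ℕ) : psum (fun i => p i + q i) k = psum p k + psum q k :=
  Finset.sum_add_distrib

theorem psum_indicator (a k : ℕ) : psum (fun i => if i < a then 1 else 0) k = min k a := by
  induction k with
  | zero => simp [psum_zero]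
  | succ k ih =>
    rw [psum_succ, ih]
    split_ifs <;> omega

theorem rPart_cons_L (a : ℕ) (s : Multiset KBlock) :
    rPart (.L a ::ₘ s) = fun i => (if i < a + 1 then 1 else 0) + rPart s i := by
  funext i
  refine (card_filter_cons _ _ _).trans ?_
  simp [rPart, rW]

theorem rPart_cons_of_ne {b : KBlock} (hb : ∀ a, b ≠ .L a) (s : Multiset KBlock) :
    rPart (b ::ₘ s) = rPart s := by
  funext i
  refine (card_filter_cons _ _ _).trans ?_
  simp [rPart, rW, hb]

theorem lPart_cons_LT (a : ℕ) (s : Multiset KBlock) :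
    lPart (.LT a ::ₘ s) = fun i => (if i < a + 1 then 1 else 0) + lPart s i := by
  funext i
  refine (card_filter_cons _ _ _).trans ?_
  simp [lPart, lW]

theorem lPart_cons_of_ne {b : KBlock} (hb : ∀ a, b ≠ .LT a) (s : Multiset KBlock) :
    lPart (b ::ₘ s) = lPart s := by
  funext i
  refine (card_filter_cons _ _ _).trans ?_
  simp [lPart, lW, hb]

theorem jPart_cons_Eb (μ : Option ℂ) (a : ℕ) (s : Multiset KBlock) :
    jPart (Eb μ a ::ₘ s) μ = fun i => (if i < a then 1 else 0) + jPart s μ i := by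
  funext i
  refine (card_filter_cons _ _ _).trans ?_
  have : (∃ a_1, Eb μ a = Eb μ a_1 ∧ i + 1 ≤ a_1) ↔ i < a := by
    constructor
    · rintro ⟨c, hc, hi⟩
      have := (Eb_injective hc).2
      omega
    · exact fun h => ⟨a, rfl, h⟩
  simp only [this]
  rfl

theorem jPart_cons_of_ne {b : KBlock} {μ : Option ℂ} (hb : ∀ a, b ≠ Eb μ a) (s : Multiset KBlock) :
    jPart (b ::ₘ s) μ = jPart s μ := by
  funext i
  refine (card_filter_cons _ _ _).trans ?_
  simp [jPart, jW, hb]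

theorem rPart_zero : rPart 0 = 0 := rfl
theorem lPart_zero : lPart 0 = 0 := rfl
theorem jPart_zero (μ : Option ℂ) : jPart 0 μ = 0 := rfl

theorem psum_fun_zero (k : ℕ) : psum 0 k = 0 := by
  simp [psum]

theorem lPart_map_dualBlock (s : Multiset KBlock) : lPart (s.map dualBlock) = rPart s := by
  induction s using Multiset.induction_on with
  | empty => rfl
  | cons b s ih =>
    rw [Multiset.map_cons]
    cases b with
    | L k =>
      rw [rPart_cons_L, ← ih]
      exact lPart_cons_LT k _
    | E k μ => rw [rPart_cons_of_ne (by simp), lPart_cons_of_ne (by simp [dualBlock]), ih]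
    | Einf k => rw [rPart_cons_of_ne (by simp), lPart_cons_of_ne (by simp [dualBlock]), ih]
    | LT k => rw [rPart_cons_of_ne (by simp), lPart_cons_of_ne (by simp [dualBlock]), ih]

theorem dualBlock_dualBlock (b : KBlock) : dualBlock (dualBlock b) = b := by
  cases b <;> rfl

theorem map_dualBlock_dualBlock (s : Multiset KBlock) :
    (s.map dualBlock).map dualBlock = s := by
  simp [Multiset.map_map, dualBlock_dualBlock]

theorem rPart_map_dualBlock (s : Multiset KBlock) : rPart (s.map dualBlock) = lPart s := by
  rw [← lPart_map_dualBlock, map_dualBlock_dualBlock]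

theorem dualBlock_Eb (μ : Option ℂ) (k : ℕ) : dualBlock (Eb μ k) = Eb μ k := by
  rcases μ with _ | μ <;> rfl

theorem jPart_map_dualBlock (s : Multiset KBlock) (μ : Option ℂ) :
    jPart (s.map dualBlock) μ = jPart s μ := by
  induction s using Multiset.induction_on with
  | empty => rfl
  | cons b s ih =>
    rw [Multiset.map_cons]
    by_cases hb : ∃ a, b = Eb μ a
    · obtain ⟨a, rfl⟩ := hb
      rw [dualBlock_Eb, jPart_cons_Eb, jPart_cons_Eb, ih]
    · push Not at hb
      rw [jPart_cons_of_ne hb, jPart_cons_of_ne, ih]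
      intro a h
      exact hb a (by rw [← dualBlock_dualBlock b, h, dualBlock_Eb])

/-- The three Weyr characteristics agree. -/
def SameData (s s' : Multiset KBlock) : Prop :=
  rPart s = rPart s' ∧ lPart s = lPart s' ∧ ∀ μ, jPart s μ = jPart s' μ

theorem rPart_eq_count (s : Multiset KBlock) (i : ℕ) :
    rPart s i = s.count (.L i) + rPart s (i + 1) := by
  induction s using Multiset.induction_on with
  | empty => rfl
  | cons b s ih =>
    by_cases hb : ∃ a, b = .L a
    · obtain ⟨a, rfl⟩ := hb
      rw [rPart_cons_L, Multiset.count_cons]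
      simp only [KBlock.L.injEq]
      split_ifs <;> omega
    · push Not at hb
      rw [rPart_cons_of_ne hb, Multiset.count_cons_of_ne (hb i).symm, ih]

theorem lPart_eq_count (s : Multiset KBlock) (i : ℕ) :
    lPart s i = s.count (.LT i) + lPart s (i + 1) := by
  induction s using Multiset.induction_on with
  | empty => rfl
  | cons b s ih =>
    by_cases hb : ∃ a, b = .LT a
    · obtain ⟨a, rfl⟩ := hb
      rw [lPart_cons_LT, Multiset.count_cons]
      simp only [KBlock.LT.injEq]
      split_ifs <;> omega
    · push Not at hb
      rw [lPart_cons_of_ne hb, Multiset.count_cons_of_ne (hb i).symm, ih]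

theorem jPart_eq_count (s : Multiset KBlock) (μ : Option ℂ) (i : ℕ) :
    jPart s μ i = s.count (Eb μ (i + 1)) + jPart s μ (i + 1) := by
  induction s using Multiset.induction_on with
  | empty => rfl
  | cons b s ih =>
    by_cases hb : ∃ a, b = Eb μ a
    · obtain ⟨a, rfl⟩ := hb
      have : Eb μ (i + 1) = Eb μ a ↔ i + 1 = a :=
        ⟨fun h => (Eb_injective h).2, fun h => by rw [h]⟩
      rw [jPart_cons_Eb, Multiset.count_cons]
      simp only [this]
      split_ifs <;> omega
    · push Not at hb
      rw [jPart_cons_of_ne hb, Multiset.count_cons_of_ne (hb _).symm, ih]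

theorem SameData.filter_valid_eq {s s' : Multiset KBlock} (h : SameData s s') :
    s.filter KBlock.valid = s'.filter KBlock.valid := by
  obtain ⟨hr, hl, hj⟩ := h
  ext b
  rw [Multiset.count_filter, Multiset.count_filter]
  split_ifs with hb
  · induction b using KBlock.cases_Eb with
    | hL a =>
      have h1 := rPart_eq_count s a
      have h2 := rPart_eq_count s' a
      rw [hr] at h1
      omega
    | hLT a =>
      have h1 := lPart_eq_count s a
      have h2 := lPart_eq_count s' a
      rw [hl] at h1
      omega
    | hE μ a =>
      obtain ⟨a, rfl⟩ : ∃ c, a = c + 1 := by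
        refine Nat.exists_eq_succ_of_ne_zero ?_
        rintro rfl
        rcases μ with _ | μ <;> simp [Eb, KBlock.valid] at hb
      have h1 := jPart_eq_count s μ a
      have h2 := jPart_eq_count s' μ a
      rw [hj] at h1
      omega
  · rfl

namespace KMod

theorem iso_sum_filter_valid (l : List KBlock) :
    Iso (sum (l.filter fun b => decide b.valid)) (sum l) := by
  induction l with
  | nil => exact Iso.refl _
  | cons b l ih =>
    by_cases hb : b.valid
    · rw [List.filter_cons_of_pos (by simpa using hb)]
      exact ih.sum_cons b
    · rw [List.filter_cons_of_neg (by simpa using hb)]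
      have h0 : b.rows = 0 ∧ b.cols = 0 := by
        cases b <;> simp_all [KBlock.valid, KBlock.rows, KBlock.cols]
      have h1 : ∀ x y : Fin b.cols → ℂ, x = y := fun x y =>
        funext fun i => (Fin.cast h0.2 i).elim0
      have h2 : ∀ x y : Fin b.rows → ℂ, x = y := fun x y =>
        funext fun i => (Fin.cast h0.1 i).elim0
      have : Subsingleton (blk b).V := ⟨h1⟩
      have : Subsingleton (blk b).W := ⟨h2⟩
      exact ih.trans (prod_subsingleton_iso (blk b) (sum l)).symm

theorem iso_of_sameData {l l' : List KBlock} (h : SameData l l') : Iso (sum l) (sum l') := by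
  refine ((iso_sum_filter_valid l).symm.trans (sum_perm_iso ?_)).trans (iso_sum_filter_valid l')
  have := h.filter_valid_eq
  rw [Multiset.filter_coe, Multiset.filter_coe, Multiset.coe_eq_coe] at this
  exact this

theorem dimR_zero (k : ℕ) : zero.dimR k = 0 := by
  have : Subsingleton zero.V := inferInstanceAs (Subsingleton PUnit)
  exact chainDim_of_subsingleton _ _ _

theorem dimJ_zero (μ : Option ℂ) (k : ℕ) : zero.dimJ μ k = 0 := by
  have : Subsingleton (zero.localAt μ).V := inferInstanceAs (Subsingleton PUnit)
  exact chainDim_of_subsingleton _ _ _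

theorem dimR_sum (l : List KBlock) (k : ℕ) :
    (sum l).dimR k + psum (rPart l) (k + 1) = (k + 1) * rPart l 0 := by
  induction l with
  | nil => exact (congrArg (· + _) (dimR_zero k)).trans (by simp [rPart_zero, psum_fun_zero])
  | cons b l ih =>
    have h : (sum (b :: l)).dimR k = (blk b).dimR k + (sum l).dimR k := dimR_prod _ _ k
    rw [h, ← Multiset.cons_coe]
    by_cases hb : ∃ a, b = .L a
    · obtain ⟨a, rfl⟩ := hb
      rw [rPart_cons_L, dimR_blk_L, psum_add, psum_indicator]
      simp only [Nat.succ_pos, if_true, mul_add, ← ih, mul_one]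
      omega
    · push Not at hb
      rw [rPart_cons_of_ne hb, dimR_blk_of_ne_L hb, ← ih, zero_add]

theorem dimL_sum (l : List KBlock) (k : ℕ) :
    (sum l).dual.dimR k + psum (lPart l) (k + 1) = (k + 1) * lPart l 0 := by
  have h := dimR_sum (l.map dualBlock) k
  rw [← Multiset.map_coe, rPart_map_dualBlock, (dual_sum_iso l).dimR_eq] at h
  exact h

theorem dimJ_sum (l : List KBlock) (μ : Option ℂ) (k : ℕ) :
    (sum l).dimJ μ k = k * rPart l 0 + psum (jPart l μ) k := by
  induction l with
  | nil => exact (dimJ_zero μ k).trans (by simp [rPart_zero, psum_fun_zero, jPart_zero])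
  | cons b l ih =>
    have h : (sum (b :: l)).dimJ μ k = (blk b).dimJ μ k + (sum l).dimJ μ k := dimJ_prod _ _ μ k
    rw [h, ih, ← Multiset.cons_coe]
    induction b using KBlock.cases_Eb with
    | hL a =>
      rw [dimJ_blk_L, rPart_cons_L, jPart_cons_of_ne fun c => (Eb_ne_L μ c a).symm]
      simp only [Nat.succ_pos, if_true, mul_add, mul_one]
      omega
    | hLT a =>
      rw [dimJ_blk_LT, rPart_cons_of_ne (by simp), jPart_cons_of_ne fun c => (Eb_ne_LT μ c a).symm,
        zero_add]
    | hE ν a =>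
      rw [rPart_cons_of_ne fun c => Eb_ne_L ν a c]
      by_cases hμ : μ = ν
      · subst hμ
        rw [dimJ_blk_Eb, jPart_cons_Eb, psum_add, psum_indicator, min_comm]
        omega
      · rw [dimJ_blk_Eb_of_ne hμ, jPart_cons_of_ne fun c h => hμ (Eb_injective h).1.symm, zero_add]

end KMod

/-- The closure order on Weyr characteristics. -/
def WGe (s1 s2 : Multiset KBlock) : Prop :=
  (∀ k, k * rPart s1 0 + psum (rPart s2) k ≤ k * rPart s2 0 + psum (rPart s1) k) ∧
  (∀ k, k * lPart s1 0 + psum (lPart s2) k ≤ k * lPart s2 0 + psum (lPart s1) k) ∧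
  ∀ μ k, k * rPart s1 0 + psum (jPart s1 μ) k ≤ k * rPart s2 0 + psum (jPart s2 μ) k

namespace KMod

theorem wGe_of_dims {l1 l2 : List KBlock}
    (hR : ∀ k, (sum l1).dimR k ≤ (sum l2).dimR k)
    (hL : ∀ k, (sum l1).dual.dimR k ≤ (sum l2).dual.dimR k)
    (hJ : ∀ μ k, (sum l1).dimJ μ k ≤ (sum l2).dimJ μ k) :
    WGe l1 l2 := by
  refine ⟨fun k => ?_, fun k => ?_, fun μ k => ?_⟩
  · rcases k with _ | k
    · simp [psum_zero]
    · have h1 := dimR_sum l1 k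
      have h2 := dimR_sum l2 k
      have := hR k
      omega
  · rcases k with _ | k
    · simp [psum_zero]
    · have h1 := dimL_sum l1 k
      have h2 := dimL_sum l2 k
      have := hL k
      omega
  · have := hJ μ k
    rwa [dimJ_sum, dimJ_sum] at this

theorem wGe_of_subset_closure {m n : ℕ} {P1 P2 : Pencil m n} {l1 l2 : List KBlock}
    (h1 : Iso (sum l1) (ofMat P1)) (h2 : Iso (sum l2) (ofMat P2))
    (h : P2 ∈ closure (Pencil.orbE P1)) : WGe l1 l2 := by
  have hX : ∀ X ∈ Pencil.orbE P1, Iso (sum l1) (ofMat X) := fun X hX =>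
    h1.trans ((ofMat_iso_iff_strictEquiv _ _).2 hX)
  refine wGe_of_dims (fun k => ?_) (fun k => ?_) fun μ k => ?_
  · rw [h2.dimR_eq]
    exact le_chainDim_of_mem_closure id continuous_id h k (k + 1) _ fun X h =>
      ((hX X h).dimR_eq k).le
  · rw [(dual_sum_iso l1).symm.dimR_eq, (dual_sum_iso l2).symm.dimR_eq]
    rw [(dual_sum_iso l2).dimR_eq, (h2.symm.dual.trans (dual_ofMat_iso P2).symm).dimR_eq]
    refine le_chainDim_of_mem_closure (fun X : Pencil m n => (X.1ᵀ, X.2ᵀ))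
      (continuous_fst.matrix_transpose.prodMk continuous_snd.matrix_transpose) h k (k + 1) _
      fun X h => ?_
    exact (((dual_sum_iso l1).trans ((hX X h).symm.dual.trans
      (dual_ofMat_iso X).symm)).dimR_eq k).le
  · rw [h2.dimJ_eq]
    rcases μ with _ | c
    · exact le_chainDim_of_mem_closure Prod.swap continuous_swap h k k _ fun X h =>
        ((hX X h).dimJ_eq none k).le
    · have key : ∀ X : Pencil m n, Iso ((ofMat X).localAt (some c))
          (ofMat (X.1 - c • X.2, X.2)) := by
        intro X
        have : ∀ x : Fin n → ℂ, X.1 *ᵥ x - c • (X.2 *ᵥ x) = (X.1 - c • X.2) *ᵥ x := by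
          intro x
          rw [sub_mulVec, smul_mulVec]
        exact ⟨LinearEquiv.refl ℂ _, LinearEquiv.refl ℂ _, this, fun _ => rfl⟩
      unfold dimJ
      rw [(key P2).chainDim_eq]
      refine le_chainDim_of_mem_closure (fun X : Pencil m n => (X.1 - c • X.2, X.2))
        ((continuous_fst.sub (continuous_snd.const_smul c)).prodMk continuous_snd) h k k _
        fun X h => ?_
      exact ((((hX X h).localAt (some c)).trans (key X)).chainDim_eq k k).le

end KMod

/-! ### Degenerations -/

namespace KMod

/-- Every pencil isomorphic to `N` is a limit of pencils isomorphic to `M`. -/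
def Deg (M N : KMod) : Prop :=
  ∀ (m n : ℕ) (Q : Pencil m n), Iso N (ofMat Q) → Q ∈ closure {X : Pencil m n | Iso M (ofMat X)}

theorem Deg.of_rep {M N : KMod} {p q : ℕ} (Q₀ : Pencil p q) (hQ₀ : Iso N (ofMat Q₀))
    (h : Q₀ ∈ closure {X : Pencil p q | Iso M (ofMat X)}) : Deg M N := by
  intro m n Q hQ
  have hiso := hQ₀.symm.trans hQ
  obtain rfl : q = n := by
    have := hiso.finrank_V
    rwa [finrank_ofMat_V, finrank_ofMat_V, Fintype.card_fin, Fintype.card_fin] at this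
  obtain rfl : p = m := by
    have := hiso.finrank_W
    rwa [finrank_ofMat_W, finrank_ofMat_W, Fintype.card_fin, Fintype.card_fin] at this
  obtain ⟨S, R, hS, hR, h1, h2⟩ := (ofMat_iso_iff_strictEquiv Q₀ Q).1 hiso
  let Φ : Pencil p q → Pencil p q := fun X => (S⁻¹ * X.1 * R, S⁻¹ * X.2 * R)
  have hΦ : Continuous Φ := by
    refine Continuous.prodMk ?_ ?_
    · exact (continuous_const.matrix_mul continuous_fst).matrix_mul continuous_const
    · exact (continuous_const.matrix_mul continuous_snd).matrix_mul continuous_const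
  have hQ' : Q = Φ Q₀ := Prod.ext h1.symm h2.symm
  rw [hQ']
  refine map_mem_closure hΦ h fun X hX => ?_
  exact Iso.trans hX ((ofMat_iso_iff_strictEquiv X (Φ X)).2 ⟨S, R, hS, hR, rfl, rfl⟩)

theorem Deg.of_iso {M M' N N' : KMod} (h : Deg M N) (hM : Iso M M') (hN : Iso N N') :
    Deg M' N' := fun m n Q hQ =>
  closure_mono (fun _ hX => hM.symm.trans hX) (h m n Q (hN.trans hQ))

theorem Deg.refl (M : KMod) : Deg M M := fun _ _ _ hQ => subset_closure hQ

theorem Deg.trans {M N K : KMod} (h : Deg M N) (h' : Deg N K) : Deg M K := fun m n Q hQ =>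
  closure_minimal (fun X hX => h m n X hX) isClosed_closure (h' m n Q hQ)

theorem Deg.swap {M N : KMod} (h : Deg M N) : Deg M.swap N.swap := by
  intro m n Q hQ
  have h1 : Q.swap ∈ closure {X : Pencil m n | Iso M (ofMat X)} := h m n Q.swap hQ.swap
  exact map_mem_closure (f := Prod.swap) continuous_swap h1 fun X hX => Iso.swap hX

theorem Deg.dual {M N : KMod} (h : Deg M N) : Deg M.dual N.dual := by
  intro m n Q hQ
  have h0 : Iso N (ofMat (Q.1ᵀ, Q.2ᵀ)) :=
    (dual_dual_iso N).trans (hQ.symm.dual.trans (dual_ofMat_iso Q).symm)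
  have h1 := h n m (Q.1ᵀ, Q.2ᵀ) h0
  refine map_mem_closure (f := fun X : Pencil n m => ((X.1ᵀ, X.2ᵀ) : Pencil m n))
    (continuous_fst.matrix_transpose.prodMk continuous_snd.matrix_transpose) h1 fun X hX => ?_
  exact (Iso.symm hX).dual.trans (dual_ofMat_iso X).symm

theorem Deg.prod_right {M N : KMod} (h : Deg M N) (K : KMod) : Deg (M.prod K) (N.prod K) := by
  obtain ⟨Q₀, hQ₀⟩ := exists_ofMat_iso N
  obtain ⟨K₀, hK₀⟩ := exists_ofMat_iso K
  refine Deg.of_rep (Pencil.dsum Q₀ K₀) (((hQ₀.prod hK₀).symm).trans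
    (ofMat_dsum_iso Q₀ K₀).symm) ?_
  refine map_mem_closure (f := fun X => Pencil.dsum X K₀) ?_ (h _ _ Q₀ hQ₀.symm) fun X hX => ?_
  · refine Continuous.prodMk ?_ ?_
    · exact (continuous_fst.matrix_fromBlocks continuous_const continuous_const
        continuous_const).matrix_submatrix _ _
    · exact (continuous_snd.matrix_fromBlocks continuous_const continuous_const
        continuous_const).matrix_submatrix _ _
  · exact (Iso.prod hX hK₀.symm).trans (ofMat_dsum_iso X K₀).symm

theorem Deg.of_affine {M : KMod} {V W : Type} [AddCommGroup V] [Module ℂ V]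
    [FiniteDimensional ℂ V] [AddCommGroup W] [Module ℂ W] [FiniteDimensional ℂ W]
    (a a' b b' : V →ₗ[ℂ] W) (h : ∀ ε : ℂ, ε ≠ 0 → Deg M ⟨V, W, a + ε • a', b + ε • b'⟩) :
    Deg M ⟨V, W, a, b⟩ := by
  let e := Module.finBasis ℂ V
  let f := Module.finBasis ℂ W
  let T := LinearMap.toMatrix e f
  have hT : ∀ a b : V →ₗ[ℂ] W, Iso ⟨V, W, a, b⟩ (ofMat (T a, T b)) := by
    intro a b
    have key : ∀ (a : V →ₗ[ℂ] W) x, f.equivFun (a x) = T a *ᵥ e.equivFun x := fun a x =>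
      (LinearMap.toMatrix_mulVec_repr e f a x).symm
    exact ⟨e.equivFun, f.equivFun, key a, key b⟩
  refine Deg.of_rep (T a, T b) (hT a b) ?_
  have hc : Continuous fun ε : ℂ => ((T a + ε • T a', T b + ε • T b') : Pencil _ _) := by
    fun_prop
  have h0 : Filter.Tendsto (fun ε : ℂ => ((T a + ε • T a', T b + ε • T b') : Pencil _ _))
      (nhdsWithin 0 {0}ᶜ) (nhds (T a, T b)) := by
    have := hc.tendsto 0
    simp only [zero_smul, add_zero] at this
    exact this.mono_left nhdsWithin_le_nhds
  rw [← closure_closure]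
  refine mem_closure_of_tendsto h0 ?_
  filter_upwards [self_mem_nhdsWithin] with ε hε
  refine h ε hε _ _ _ ?_
  have := hT (a + ε • a') (b + ε • b')
  rwa [map_add, map_add, map_smul, map_smul] at this

/-- The extension of `N` by `M` with given gluing maps. -/
def glue (M N : KMod) (xa xb : N.V →ₗ[ℂ] M.W) : KMod :=
  ⟨M.V × N.V, M.W × N.W, (M.a.coprod xa).prod (N.a ∘ₗ LinearMap.snd ℂ M.V N.V),
    (M.b.coprod xb).prod (N.b ∘ₗ LinearMap.snd ℂ M.V N.V)⟩

/-- An extension degenerates to the direct sum. -/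
theorem deg_glue (M N : KMod) (xa xb : N.V →ₗ[ℂ] M.W) : Deg (glue M N xa xb) (M.prod N) := by
  refine Deg.of_affine (M.a.prodMap N.a)
    (LinearMap.inl ℂ M.W N.W ∘ₗ xa ∘ₗ LinearMap.snd ℂ M.V N.V) (M.b.prodMap N.b)
    (LinearMap.inl ℂ M.W N.W ∘ₗ xb ∘ₗ LinearMap.snd ℂ M.V N.V) fun ε hε =>
    (Deg.refl _).of_iso (Iso.refl _) (Iso.symm ?_)
  let u := LinearEquiv.smulOfNeZero ℂ N.V ε hε
  let w := LinearEquiv.smulOfNeZero ℂ N.W ε hε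
  refine ⟨(LinearEquiv.refl ℂ M.V).prodCongr u, (LinearEquiv.refl ℂ M.W).prodCongr w, ?_, ?_⟩
  · have : ∀ x : M.V × N.V, ((M.a x.1 + ε • xa x.2, ε • (N.a x.2 + ε • 0)) : M.W × N.W) =
        (M.a x.1 + xa (ε • x.2), N.a (ε • x.2)) := by
      intro x
      simp
    exact this
  · have : ∀ x : M.V × N.V, ((M.b x.1 + ε • xb x.2, ε • (N.b x.2 + ε • 0)) : M.W × N.W) =
        (M.b x.1 + xb (ε • x.2), N.b (ε • x.2)) := by
      intro x
      simp
    exact this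

end KMod

/-! ### Elementary degenerations of canonical blocks -/

/-- The coordinate functionals, extended by zero. -/
def ex {n : ℕ} (i : ℕ) : (Fin n → ℂ) →ₗ[ℂ] ℂ where
  toFun x := extZ x i
  map_add' x y := by
    unfold extZ
    split_ifs <;> simp
  map_smul' c x := by
    unfold extZ
    split_ifs <;> simp

theorem extZ_fun {n : ℕ} (g : ℕ → ℂ) (i : ℕ) :
    extZ (fun j : Fin n => g j) i = if i < n then g i else 0 := by
  unfold extZ
  split_ifs <;> rfl

theorem eq_zero_of_extZ {n : ℕ} {x : Fin n → ℂ} (h : ∀ i, i < n → extZ x i = 0) : x = 0 := by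
  funext i
  rw [← extZ_of_lt x i.2, h i i.2]
  rfl

namespace KMod

/-- The model of `L_k` in terms of coordinate functionals. -/
def Lmod (k : ℕ) : KMod :=
  ⟨Fin (k + 1) → ℂ, Fin k → ℂ, LinearMap.pi fun i => ex (i + 1), LinearMap.pi fun i => ex i⟩

/-- The model of `E_k(μ)` in terms of coordinate functionals. -/
def Emod (k : ℕ) (μ : ℂ) : KMod :=
  ⟨Fin k → ℂ, Fin k → ℂ, LinearMap.pi fun i => μ • ex i + ex (i + 1), LinearMap.pi fun i => ex i⟩

theorem Lmod_iso (k : ℕ) : Iso (Lmod k) (blk (.L k)) := by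
  have h1 : ∀ x : Fin (k + 1) → ℂ, (fun i : Fin k => extZ x (i + 1)) = Fmat k *ᵥ x := by
    intro x
    rw [Fmat_mulVec]
    exact funext fun i => extZ_of_lt x (Nat.succ_lt_succ i.2)
  have h2 : ∀ x : Fin (k + 1) → ℂ, (fun i : Fin k => extZ x i) = Gmat k *ᵥ x := by
    intro x
    rw [Gmat_mulVec]
    exact funext fun i => extZ_of_lt x (by omega)
  exact ⟨LinearEquiv.refl ℂ _, LinearEquiv.refl ℂ _, h1, h2⟩

theorem Emod_iso (k : ℕ) (μ : ℂ) : Iso (Emod k μ) (blk (.E k μ)) := by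
  have h1 : ∀ x : Fin k → ℂ, (fun i : Fin k => μ * extZ x i + extZ x (i + 1)) = Jmat k μ *ᵥ x := by
    intro x
    funext i
    rw [Jmat_mulVec_extZ, extZ_of_lt x i.2]
  have h2 : ∀ x : Fin k → ℂ, (fun i : Fin k => extZ x i) = (1 : Matrix (Fin k) (Fin k) ℂ) *ᵥ x := by
    intro x
    rw [one_mulVec]
    exact funext fun i => extZ_of_lt x i.2
  exact ⟨LinearEquiv.refl ℂ _, LinearEquiv.refl ℂ _, h1, h2⟩

theorem finrank_fin_prod (m n : ℕ) :
    Module.finrank ℂ ((Fin m → ℂ) × (Fin n → ℂ)) = m + n := by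
  simp [Module.finrank_prod]

theorem iso_glue_L_L {a b : ℕ} (hab : a ≤ b) :
    Iso (glue (Lmod (b + 1)) (Lmod a)
      (LinearMap.pi fun i : Fin (b + 1) => if (i : ℕ) = 0 then ex 0 else 0) 0)
      ((Lmod (a + 1)).prod (Lmod b)) := by
  let e : ∀ m n p q : ℕ, ((Fin m → ℂ) × (Fin n → ℂ)) →ₗ[ℂ] (Fin p → ℂ) × (Fin q → ℂ) :=
    fun m n p q =>
    (LinearMap.pi fun i : Fin p => ex i ∘ₗ LinearMap.fst ℂ _ _ +
      if (i : ℕ) = 0 then 0 else ex (i - 1) ∘ₗ LinearMap.snd ℂ _ _).prod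
    (LinearMap.pi fun i : Fin q => ex (i + 1) ∘ₗ LinearMap.fst ℂ _ _)
  have he : ∀ m n p q x, e m n p q x = (fun i : Fin p => extZ x.1 i +
      if (i : ℕ) = 0 then 0 else extZ x.2 (i - 1), fun i : Fin q => extZ x.1 (i + 1)) := by
    intro m n p q x
    refine Prod.ext (funext fun i => ?_) rfl
    change extZ x.1 i + (if (i : ℕ) = 0 then (0 : ((Fin m → ℂ) × (Fin n → ℂ)) →ₗ[ℂ] ℂ) else
      ex (i - 1) ∘ₗ LinearMap.snd ℂ _ _) x = extZ x.1 i +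
        if (i : ℕ) = 0 then 0 else extZ x.2 (i - 1)
    split_ifs <;> rfl
  have inj : ∀ m n, n ≤ m → Function.Injective (e (m + 1) n (n + 1) m) := by
    intro m n hmn
    refine injective_of_zero _ fun x hx => ?_
    rw [he] at hx
    have h1 := congrFun (congrArg Prod.fst hx)
    have h2 := congrFun (congrArg Prod.snd hx)
    simp only [Prod.fst_zero, Prod.snd_zero, Pi.zero_apply] at h1 h2
    have h3 : ∀ i, i < m + 1 → extZ x.1 i = 0 := by
      intro i hi
      rcases i with _ | i
      · simpa using h1 0
      · exact h2 ⟨i, by omega⟩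
    refine Prod.ext (eq_zero_of_extZ h3) (eq_zero_of_extZ fun i hi => ?_)
    have := h1 ⟨i + 1, by omega⟩
    simpa [h3 (i + 1) (by omega)] using this
  refine Iso.of_injective (e (b + 1 + 1) (a + 1) (a + 1 + 1) (b + 1)) (e (b + 1) a (a + 1) b)
    (inj _ _ (by omega)) (inj _ _ hab) ?_ ?_ ?_ ?_
  · exact (finrank_fin_prod _ _).trans (Eq.trans (by omega) (finrank_fin_prod _ _).symm)
  · exact (finrank_fin_prod _ _).trans (Eq.trans (by omega) (finrank_fin_prod _ _).symm)
  · have key : ∀ x : (Fin (b + 1 + 1) → ℂ) × (Fin (a + 1) → ℂ),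
        e (b + 1) a (a + 1) b (fun i => extZ x.1 (i + 1) +
          (if (i : ℕ) = 0 then (ex 0 : (Fin (a + 1) → ℂ) →ₗ[ℂ] ℂ) else 0) x.2,
          fun i => extZ x.2 (i + 1)) =
        (fun i : Fin (a + 1) => extZ (e (b + 1 + 1) (a + 1) (a + 1 + 1) (b + 1) x).1 (i + 1),
          fun i : Fin b => extZ (e (b + 1 + 1) (a + 1) (a + 1 + 1) (b + 1) x).2 (i + 1)) := by
      intro x
      have h0 : ∀ i : ℕ, (if i = 0 then (ex 0 : (Fin (a + 1) → ℂ) →ₗ[ℂ] ℂ) else 0) x.2 =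
          if i = 0 then extZ x.2 0 else 0 := fun i => by split_ifs <;> rfl
      rw [he, he]
      refine Prod.ext (funext fun i => ?_) (funext fun i => ?_)
      · have := i.2
        simp only [h0]
        rw [extZ_fun (fun i => extZ x.1 (i + 1) + if i = 0 then extZ x.2 0 else 0),
          extZ_fun (fun i => extZ x.2 (i + 1)),
          extZ_fun (fun i => extZ x.1 i + if i = 0 then 0 else extZ x.2 (i - 1)),
          if_pos (show (i : ℕ) < b + 1 by omega), if_pos (show (i : ℕ) + 1 < a + 1 + 1 by omega)]
        obtain ⟨_ | i, hi⟩ := i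
        · simp
        · simp only [Nat.succ_ne_zero, if_false, Nat.add_sub_cancel]
          rw [if_pos (by omega), add_zero]
      · have := i.2
        simp only [h0]
        rw [extZ_fun (fun i => extZ x.1 (i + 1) + if i = 0 then extZ x.2 0 else 0),
          extZ_fun (fun i => extZ x.1 (i + 1)), if_pos (show (i : ℕ) + 1 < b + 1 by omega),
          if_pos (show (i : ℕ) + 1 < b + 1 by omega)]
        simp
    exact key
  · have key : ∀ x : (Fin (b + 1 + 1) → ℂ) × (Fin (a + 1) → ℂ),
        e (b + 1) a (a + 1) b (fun i => extZ x.1 i + 0, fun i => extZ x.2 i) =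
        (fun i : Fin (a + 1) => extZ (e (b + 1 + 1) (a + 1) (a + 1 + 1) (b + 1) x).1 i,
          fun i : Fin b => extZ (e (b + 1 + 1) (a + 1) (a + 1 + 1) (b + 1) x).2 i) := by
      intro x
      rw [he, he]
      refine Prod.ext (funext fun i => ?_) (funext fun i => ?_)
      · have := i.2
        simp only [add_zero]
        rw [extZ_fun (fun i => extZ x.1 i), extZ_fun (fun i => extZ x.2 i),
          extZ_fun (fun i => extZ x.1 i + if i = 0 then 0 else extZ x.2 (i - 1)),
          if_pos (show (i : ℕ) < b + 1 by omega), if_pos (show (i : ℕ) < a + 1 + 1 by omega)]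
        obtain ⟨_ | i, hi⟩ := i
        · simp
        · simp only [Nat.succ_ne_zero, if_false, Nat.add_sub_cancel]
          rw [if_pos (by omega)]
      · have := i.2
        simp only [add_zero]
        rw [extZ_fun (fun i => extZ x.1 i), extZ_fun (fun i => extZ x.1 (i + 1)),
          if_pos (by omega), if_pos (by omega)]
    exact key

theorem deg_L_L {a b : ℕ} (hab : a ≤ b) :
    Deg ((blk (.L (a + 1))).prod (blk (.L b))) ((blk (.L a)).prod (blk (.L (b + 1)))) :=
  (deg_glue (Lmod (b + 1)) (Lmod a) _ _).of_iso
    ((iso_glue_L_L hab).trans ((Lmod_iso _).prod (Lmod_iso _)))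
    ((prod_comm_iso _ _).trans ((Lmod_iso _).prod (Lmod_iso _)))

theorem deg_L (c : ℕ) (ν : ℂ) :
    Deg (blk (.L (c + 1))) ((blk (.L c)).prod (blk (.E 1 ν))) := by
  let e : ∀ n q : ℕ, (Fin n → ℂ) →ₗ[ℂ] (Fin 1 → ℂ) × (Fin q → ℂ) := fun n q =>
    (LinearMap.pi fun _ => - ex 0).prod (LinearMap.pi fun i : Fin q => ν • ex i - ex (i + 1))
  have he : ∀ n q x, e n q x = (fun _ => - extZ x 0,
    fun i : Fin q => ν * extZ x i - extZ x (i + 1)) := fun n q x => rfl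
  have inj : ∀ n, Function.Injective (e (n + 1) n) := by
    refine fun n => injective_of_zero _ fun x hx => ?_
    rw [he] at hx
    have h1 := congrFun (congrArg Prod.fst hx) 0
    have h2 := congrFun (congrArg Prod.snd hx)
    simp only [Prod.fst_zero, Prod.snd_zero, Pi.zero_apply] at h1 h2
    refine eq_zero_of_extZ fun i => ?_
    induction i with
    | zero => exact fun _ => neg_eq_zero.1 h1
    | succ i ih =>
      intro hi
      have := h2 ⟨i, by omega⟩
      simpa [ih (by omega)] using this
  have hiso : Iso (Lmod (c + 1)) (glue (Emod 1 ν) (Lmod c) (LinearMap.pi fun _ => ex 0) 0) := by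
    refine Iso.of_injective (e (c + 1 + 1) (c + 1)) (e (c + 1) c) (inj _) (inj _) ?_ ?_ ?_ ?_
    · exact (Module.finrank_fin_fun ℂ).trans (Eq.trans (by omega) (finrank_fin_prod _ _).symm)
    · exact (Module.finrank_fin_fun ℂ).trans (Eq.trans (by omega) (finrank_fin_prod _ _).symm)
    · have key : ∀ x : Fin (c + 1 + 1) → ℂ, e (c + 1) c (fun i => extZ x (i + 1)) =
          (fun i : Fin 1 => ν * extZ (e (c + 1 + 1) (c + 1) x).1 i +
            extZ (e (c + 1 + 1) (c + 1) x).1 (i + 1) + extZ (e (c + 1 + 1) (c + 1) x).2 0,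
            fun i : Fin c => extZ (e (c + 1 + 1) (c + 1) x).2 (i + 1)) := by
        intro x
        rw [he, he, Prod.mk.injEq]
        refine ⟨funext fun i => ?_, funext fun i => ?_⟩
        · have := i.2
          simp only
          rw [extZ_fun (fun i => ν * extZ x i - extZ x (i + 1)), extZ_fun (fun i => extZ x (i + 1)),
            extZ_fun (fun i => - extZ x 0), extZ_fun (fun i => - extZ x 0), if_pos (by omega),
            if_pos (by omega), if_neg (by omega), if_pos (by omega)]
          ring
        · have := i.2
          simp only
          rw [extZ_fun (fun i => ν * extZ x i - extZ x (i + 1)), extZ_fun (fun i => extZ x (i + 1)),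
            extZ_fun (fun i => extZ x (i + 1)), if_pos (by omega),
            if_pos (by omega), if_pos (by omega)]
      exact key
    · have key : ∀ x : Fin (c + 1 + 1) → ℂ, e (c + 1) c (fun i => extZ x i) =
          (fun i : Fin 1 => extZ (e (c + 1 + 1) (c + 1) x).1 i + 0,
            fun i : Fin c => extZ (e (c + 1 + 1) (c + 1) x).2 i) := by
        intro x
        rw [he, he, Prod.mk.injEq]
        refine ⟨funext fun i => ?_, funext fun i => ?_⟩
        · have := i.2
          simp only
          rw [extZ_fun (fun i => extZ x i), extZ_fun (fun i => - extZ x 0), if_pos (by omega),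
            if_pos (by omega), add_zero]
        · have := i.2
          simp only
          rw [extZ_fun (fun i => ν * extZ x i - extZ x (i + 1)), extZ_fun (fun i => extZ x i),
            extZ_fun (fun i => extZ x i), if_pos (by omega), if_pos (by omega), if_pos (by omega)]
      exact key
  exact (deg_glue (Emod 1 ν) (Lmod c) _ _).of_iso (hiso.symm.trans (Lmod_iso _))
    ((prod_comm_iso _ _).trans ((Lmod_iso _).prod (Emod_iso _ _)))

/-- Separation of one eigenvalue from a Jordan block. -/
theorem iso_glue_E_one (d : ℕ) (μ ε : ℂ) (hε : ε ≠ 0) :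
    Iso ((Emod d μ).prod (Emod 1 (μ + ε)))
      (glue (Emod d μ) (Emod 1 (μ + ε))
        (LinearMap.pi fun i : Fin d => if (i : ℕ) + 1 = d then ex 0 else 0) 0) := by
  let e : ((Fin d → ℂ) × (Fin 1 → ℂ)) →ₗ[ℂ] (Fin d → ℂ) × (Fin 1 → ℂ) :=
    (LinearMap.pi fun i : Fin d => ex i ∘ₗ LinearMap.fst ℂ _ _ +
      (ε⁻¹) ^ (d - i) • ex 0 ∘ₗ LinearMap.snd ℂ _ _).prod (LinearMap.snd ℂ _ _)
  have he : ∀ x, e x = (fun i : Fin d => extZ x.1 i + (ε⁻¹) ^ (d - i) * extZ x.2 0, x.2) :=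
    fun x => rfl
  have inj : Function.Injective e := by
    refine injective_of_zero _ fun x hx => ?_
    rw [he] at hx
    have h1 := congrFun (congrArg Prod.fst hx)
    have h2 : x.2 = 0 := congrArg Prod.snd hx
    simp only [Prod.fst_zero, Pi.zero_apply, h2] at h1
    refine Prod.ext (eq_zero_of_extZ fun i hi => ?_) h2
    have h3 : extZ (0 : Fin 1 → ℂ) 0 = 0 := rfl
    simpa [h3] using h1 ⟨i, hi⟩
  refine Iso.of_injective e e inj inj rfl rfl ?_ ?_
  · have key : ∀ x : (Fin d → ℂ) × (Fin 1 → ℂ),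
        e (fun i => μ * extZ x.1 i + extZ x.1 (i + 1),
          fun i => (μ + ε) * extZ x.2 i + extZ x.2 (i + 1)) =
        (fun i : Fin d => μ * extZ (e x).1 i + extZ (e x).1 (i + 1) +
          (if (i : ℕ) + 1 = d then (ex 0 : (Fin 1 → ℂ) →ₗ[ℂ] ℂ) else 0) (e x).2,
          fun i : Fin 1 => (μ + ε) * extZ (e x).2 i + extZ (e x).2 (i + 1)) := by
      intro x
      have h0 : ∀ i : ℕ, (if i + 1 = d then (ex 0 : (Fin 1 → ℂ) →ₗ[ℂ] ℂ) else 0) x.2 =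
          if i + 1 = d then extZ x.2 0 else 0 := fun i => by split_ifs <;> rfl
      rw [he, he, Prod.mk.injEq]
      refine ⟨funext fun i => ?_, rfl⟩
      have := i.2
      simp only
      rw [h0, extZ_fun (fun i => μ * extZ x.1 i + extZ x.1 (i + 1)),
        extZ_fun (fun i => (μ + ε) * extZ x.2 i + extZ x.2 (i + 1)),
        extZ_fun (fun i => extZ x.1 i + (ε⁻¹) ^ (d - i) * extZ x.2 0),
        extZ_fun (fun i => extZ x.1 i + (ε⁻¹) ^ (d - i) * extZ x.2 0), if_pos (by omega),
        if_pos (by omega), if_pos (by omega)]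
      have h1 : extZ x.2 (0 + 1) = 0 := extZ_of_le x.2 le_rfl
      by_cases hi : (i : ℕ) + 1 = d
      · rw [if_neg (by omega), if_pos hi, show d - (i : ℕ) = 1 by omega, h1,
          extZ_of_le x.1 (show d ≤ (i : ℕ) + 1 by omega)]
        field_simp
        ring
      · rw [if_pos (by omega), if_neg hi, show d - (i : ℕ) = d - (i + 1) + 1 by omega, h1, pow_succ]
        field_simp
        ring
    exact key
  · have key : ∀ x : (Fin d → ℂ) × (Fin 1 → ℂ),
        e (fun i => extZ x.1 i, fun i => extZ x.2 i) =
        (fun i : Fin d => extZ (e x).1 i + 0, fun i : Fin 1 => extZ (e x).2 i) := by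
      intro x
      rw [he, he, Prod.mk.injEq]
      refine ⟨funext fun i => ?_, rfl⟩
      have := i.2
      simp only
      rw [extZ_fun (fun i => extZ x.1 i), extZ_fun (fun i => extZ x.2 i),
        extZ_fun (fun i => extZ x.1 i + (ε⁻¹) ^ (d - i) * extZ x.2 0), if_pos (by omega),
        if_pos (by omega), if_pos (by omega), add_zero]
    exact key

theorem iso_glue_E_E (δ a : ℕ) (μ : ℂ) :
    Iso (glue (Emod (δ + a) μ) (Emod (a + 1) μ)
      (LinearMap.pi fun i : Fin (δ + a) => if (i : ℕ) + 1 = δ + a then ex a else 0) 0)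
      ((Emod a μ).prod (Emod (δ + a + 1) μ)) := by
  let e : ((Fin (δ + a) → ℂ) × (Fin (a + 1) → ℂ)) →ₗ[ℂ] (Fin a → ℂ) × (Fin (δ + a + 1) → ℂ) :=
    (LinearMap.pi fun i : Fin a => ex (δ + i) ∘ₗ LinearMap.fst ℂ _ _ -
      ex i ∘ₗ LinearMap.snd ℂ _ _).prod
    (LinearMap.pi fun i : Fin (δ + a + 1) => ex i ∘ₗ LinearMap.fst ℂ _ _ +
      (if (i : ℕ) = δ + a then (1 : ℂ) else 0) • ex a ∘ₗ LinearMap.snd ℂ _ _)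
  have he : ∀ x, e x = (fun i : Fin a => extZ x.1 (δ + i) - extZ x.2 i,
      fun i : Fin (δ + a + 1) => extZ x.1 i +
        (if (i : ℕ) = δ + a then (1 : ℂ) else 0) * extZ x.2 a) := fun x => rfl
  have inj : Function.Injective e := by
    refine injective_of_zero _ fun x hx => ?_
    rw [he] at hx
    have h1 := congrFun (congrArg Prod.fst hx)
    have h2 := congrFun (congrArg Prod.snd hx)
    simp only [Prod.fst_zero, Prod.snd_zero, Pi.zero_apply] at h1 h2
    have h3 : ∀ i, i < δ + a → extZ x.1 i = 0 := by
      intro i hi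
      simpa [show i ≠ δ + a by omega] using h2 ⟨i, by omega⟩
    refine Prod.ext (eq_zero_of_extZ h3) (eq_zero_of_extZ fun i hi => ?_)
    rcases Nat.lt_succ_iff_lt_or_eq.1 hi with h | rfl
    · simpa [h3 (δ + i) (by omega)] using h1 ⟨i, h⟩
    · simpa [extZ_of_le x.1 (le_refl (δ + i))] using h2 ⟨δ + i, by omega⟩
  refine Iso.of_injective e e inj inj ?_ ?_ ?_ ?_
  · exact (finrank_fin_prod _ _).trans (Eq.trans (by omega) (finrank_fin_prod _ _).symm)
  · exact (finrank_fin_prod _ _).trans (Eq.trans (by omega) (finrank_fin_prod _ _).symm)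
  · have key : ∀ x : (Fin (δ + a) → ℂ) × (Fin (a + 1) → ℂ),
        e (fun i => μ * extZ x.1 i + extZ x.1 (i + 1) +
          (if (i : ℕ) + 1 = δ + a then (ex a : (Fin (a + 1) → ℂ) →ₗ[ℂ] ℂ) else 0) x.2,
          fun i => μ * extZ x.2 i + extZ x.2 (i + 1)) =
        (fun i : Fin a => μ * extZ (e x).1 i + extZ (e x).1 (i + 1),
          fun i : Fin (δ + a + 1) => μ * extZ (e x).2 i + extZ (e x).2 (i + 1)) := by
      intro x
      have h0 : ∀ i : ℕ, (if i + 1 = δ + a then (ex a : (Fin (a + 1) → ℂ) →ₗ[ℂ] ℂ) else 0) x.2 =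
          if i + 1 = δ + a then extZ x.2 a else 0 := fun i => by split_ifs <;> rfl
      rw [he, he, Prod.mk.injEq]
      simp only [h0]
      refine ⟨funext fun i => ?_, funext fun i => ?_⟩
      · have := i.2
        rw [extZ_fun (fun i => μ * extZ x.1 i + extZ x.1 (i + 1) +
            if i + 1 = δ + a then extZ x.2 a else 0),
          extZ_fun (fun i => μ * extZ x.2 i + extZ x.2 (i + 1)),
          extZ_fun (fun i => extZ x.1 (δ + i) - extZ x.2 i),
          extZ_fun (fun i => extZ x.1 (δ + i) - extZ x.2 i),
          if_pos (show δ + (i : ℕ) < δ + a by omega), if_pos (show (i : ℕ) < a + 1 by omega),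
          if_pos (show (i : ℕ) < a by omega)]
        by_cases hi : (i : ℕ) + 1 = a
        · rw [if_pos (show δ + (i : ℕ) + 1 = δ + a by omega),
            if_neg (show ¬ (i : ℕ) + 1 < a by omega), hi,
            extZ_of_le x.1 (show δ + a ≤ δ + (i : ℕ) + 1 by omega)]
          ring
        · rw [if_neg (show ¬ δ + (i : ℕ) + 1 = δ + a by omega),
            if_pos (show (i : ℕ) + 1 < a by omega), ← add_assoc]
          ring
      · have := i.2
        rw [extZ_fun (fun i => μ * extZ x.1 i + extZ x.1 (i + 1) +
            if i + 1 = δ + a then extZ x.2 a else 0),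
          extZ_fun (fun i => μ * extZ x.2 i + extZ x.2 (i + 1)),
          extZ_fun (fun i => extZ x.1 i + (if i = δ + a then (1 : ℂ) else 0) * extZ x.2 a),
          extZ_fun (fun i => extZ x.1 i + (if i = δ + a then (1 : ℂ) else 0) * extZ x.2 a),
          if_pos (show a < a + 1 by omega), if_pos (show (i : ℕ) < δ + a + 1 by omega),
          extZ_of_le x.2 (le_refl (a + 1))]
        by_cases hi : (i : ℕ) = δ + a
        · rw [if_neg (show ¬ (i : ℕ) < δ + a by omega), if_pos hi,
            if_neg (show ¬ (i : ℕ) + 1 < δ + a + 1 by omega), extZ_of_le x.1 (by omega)]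
          ring
        · rw [if_pos (show (i : ℕ) < δ + a by omega), if_neg hi,
            if_pos (show (i : ℕ) + 1 < δ + a + 1 by omega)]
          by_cases hi' : (i : ℕ) + 1 = δ + a
          · rw [if_pos hi', if_pos hi']
            ring
          · rw [if_neg hi', if_neg hi']
            ring
    exact key
  · have key : ∀ x : (Fin (δ + a) → ℂ) × (Fin (a + 1) → ℂ),
        e (fun i => extZ x.1 i + 0, fun i => extZ x.2 i) =
        (fun i : Fin a => extZ (e x).1 i, fun i : Fin (δ + a + 1) => extZ (e x).2 i) := by
      intro x
      rw [he, he, Prod.mk.injEq]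
      simp only [add_zero]
      refine ⟨funext fun i => ?_, funext fun i => ?_⟩
      · have := i.2
        rw [extZ_fun (fun i => extZ x.1 i), extZ_fun (fun i => extZ x.2 i),
          extZ_fun (fun i => extZ x.1 (δ + i) - extZ x.2 i), if_pos (by omega),
          if_pos (by omega), if_pos (by omega)]
      · have := i.2
        rw [extZ_fun (fun i => extZ x.1 i), extZ_fun (fun i => extZ x.2 i),
          extZ_fun (fun i => extZ x.1 i + (if i = δ + a then (1 : ℂ) else 0) * extZ x.2 a),
          if_pos (show a < a + 1 by omega), if_pos (show (i : ℕ) < δ + a + 1 by omega)]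
        by_cases hi : (i : ℕ) < δ + a
        · rw [if_pos hi]
        · rw [if_neg hi, extZ_of_le x.1 (by omega)]
    exact key

end KMod

namespace KMod

theorem iso_glue_E_succ (d : ℕ) (μ : ℂ) :
    Iso (glue (Emod d μ) (Emod 1 μ)
      (LinearMap.pi fun i : Fin d => if (i : ℕ) + 1 = d then ex 0 else 0) 0) (Emod (d + 1) μ) := by
  let e : ((Fin d → ℂ) × (Fin 1 → ℂ)) →ₗ[ℂ] (Fin (d + 1) → ℂ) :=
    LinearMap.pi fun i : Fin (d + 1) => ex i ∘ₗ LinearMap.fst ℂ _ _ +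
      (if (i : ℕ) = d then (1 : ℂ) else 0) • ex 0 ∘ₗ LinearMap.snd ℂ _ _
  have he : ∀ x, e x = fun i : Fin (d + 1) => extZ x.1 i +
      (if (i : ℕ) = d then (1 : ℂ) else 0) * extZ x.2 0 := fun x => rfl
  have inj : Function.Injective e := by
    refine injective_of_zero _ fun x hx => ?_
    rw [he] at hx
    have h1 := congrFun hx
    simp only [Pi.zero_apply] at h1
    refine Prod.ext (eq_zero_of_extZ fun i hi => ?_) (eq_zero_of_extZ fun i hi => ?_)
    · simpa [show i ≠ d by omega] using h1 ⟨i, by omega⟩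
    · obtain rfl : i = 0 := by omega
      simpa [extZ_of_le x.1 (le_refl d)] using h1 ⟨d, by omega⟩
  refine Iso.of_injective e e inj inj ?_ ?_ ?_ ?_
  · exact (finrank_fin_prod _ _).trans (Module.finrank_fin_fun ℂ).symm
  · exact (finrank_fin_prod _ _).trans (Module.finrank_fin_fun ℂ).symm
  · have key : ∀ x : (Fin d → ℂ) × (Fin 1 → ℂ),
        e (fun i => μ * extZ x.1 i + extZ x.1 (i + 1) +
          (if (i : ℕ) + 1 = d then (ex 0 : (Fin 1 → ℂ) →ₗ[ℂ] ℂ) else 0) x.2,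
          fun i => μ * extZ x.2 i + extZ x.2 (i + 1)) =
        fun i : Fin (d + 1) => μ * extZ (e x) i + extZ (e x) (i + 1) := by
      intro x
      have h0 : ∀ i : ℕ, (if i + 1 = d then (ex 0 : (Fin 1 → ℂ) →ₗ[ℂ] ℂ) else 0) x.2 =
          if i + 1 = d then extZ x.2 0 else 0 := fun i => by split_ifs <;> rfl
      rw [he, he]
      simp only [h0]
      refine funext fun i => ?_
      have := i.2
      rw [extZ_fun (fun i => μ * extZ x.1 i + extZ x.1 (i + 1) +
          if i + 1 = d then extZ x.2 0 else 0),
        extZ_fun (fun i => μ * extZ x.2 i + extZ x.2 (i + 1)),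
        extZ_fun (fun i => extZ x.1 i + (if i = d then (1 : ℂ) else 0) * extZ x.2 0),
        extZ_fun (fun i => extZ x.1 i + (if i = d then (1 : ℂ) else 0) * extZ x.2 0),
        if_pos (show 0 < 1 by omega), if_pos (show (i : ℕ) < d + 1 by omega),
        extZ_of_le x.2 (show 1 ≤ 0 + 1 by omega)]
      by_cases hi : (i : ℕ) = d
      · rw [if_neg (show ¬ (i : ℕ) < d by omega), if_pos hi,
          if_neg (show ¬ (i : ℕ) + 1 < d + 1 by omega), extZ_of_le x.1 (by omega)]
        ring
      · rw [if_pos (show (i : ℕ) < d by omega), if_neg hi,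
          if_pos (show (i : ℕ) + 1 < d + 1 by omega)]
        by_cases hi' : (i : ℕ) + 1 = d
        · rw [if_pos hi', if_pos hi']
          ring
        · rw [if_neg hi', if_neg hi']
          ring
    exact key
  · have key : ∀ x : (Fin d → ℂ) × (Fin 1 → ℂ),
        e (fun i => extZ x.1 i + 0, fun i => extZ x.2 i) =
        fun i : Fin (d + 1) => extZ (e x) i := by
      intro x
      rw [he, he]
      simp only [add_zero]
      refine funext fun i => ?_
      have := i.2
      rw [extZ_fun (fun i => extZ x.1 i), extZ_fun (fun i => extZ x.2 i),
        extZ_fun (fun i => extZ x.1 i + (if i = d then (1 : ℂ) else 0) * extZ x.2 0),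
        if_pos (show 0 < 1 by omega), if_pos (show (i : ℕ) < d + 1 by omega)]
      by_cases hi : (i : ℕ) < d
      · rw [if_pos hi]
      · rw [if_neg hi, extZ_of_le x.1 (by omega)]
    exact key

theorem deg_L_E (c d : ℕ) (μ : ℂ) :
    Deg ((blk (.L (c + 1))).prod (blk (.E d μ))) ((blk (.L c)).prod (blk (.E (d + 1) μ))) := by
  let N : ℂ → KMod := fun ν => glue (Emod d μ) (Emod 1 ν)
    (LinearMap.pi fun i : Fin d => if (i : ℕ) + 1 = d then ex 0 else 0) 0
  let D : ((Fin (c + 1) → ℂ) × ((Fin d → ℂ) × (Fin 1 → ℂ))) →ₗ[ℂ]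
      (Fin c → ℂ) × ((Fin d → ℂ) × (Fin 1 → ℂ)) :=
    LinearMap.inr ℂ _ _ ∘ₗ LinearMap.inr ℂ _ _ ∘ₗ LinearMap.snd ℂ _ _ ∘ₗ LinearMap.snd ℂ _ _
  have h : Deg ((blk (.L (c + 1))).prod (blk (.E d μ))) ((Lmod c).prod (N μ)) := by
    refine Deg.of_affine ((Lmod c).prod (N μ)).a D ((Lmod c).prod (N μ)).b 0 fun ε hε => ?_
    have h1 := (deg_L c (μ + ε)).prod_right (blk (.E d μ))
    refine h1.of_iso (Iso.refl _) ?_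
    refine (prod_assoc_iso _ _ _).trans ?_
    refine Iso.trans ((Lmod_iso c).symm.prod ((prod_comm_iso _ _).trans
      (((Emod_iso d μ).symm.prod (Emod_iso 1 (μ + ε)).symm).trans
        (iso_glue_E_one d μ ε hε)))) ?_
    refine ⟨LinearEquiv.refl ℂ _, LinearEquiv.refl ℂ _, ?_, ?_⟩
    · have key : ∀ x : (Fin (c + 1) → ℂ) × ((Fin d → ℂ) × (Fin 1 → ℂ)),
          ((Lmod c).a x.1, ((N (μ + ε)).a x.2)) =
            ((Lmod c).a x.1 + ε • 0, ((N μ).a x.2 + ε • (show (N μ).W from (0, x.2.2)))) := by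
        intro x
        rw [smul_zero, add_zero]
        refine congrArg _ (Prod.ext ?_ (funext fun i => ?_))
        · exact ((congrArg _ (smul_zero ε)).trans (add_zero ((N μ).a x.2).1)).symm
        · have h2 : ∀ y : Fin 1 → ℂ, (μ + ε) * extZ y i + extZ y (i + 1) =
              μ * extZ y i + extZ y (i + 1) + ε * y i := by
            intro y
            rw [extZ_of_lt y i.2]
            change (μ + ε) * y i + _ = μ * y i + _ + _
            ring
          exact h2 x.2.2
      exact key
    · have key : ∀ y : (Fin c → ℂ) × ((Fin d → ℂ) × (Fin 1 → ℂ)), y = y + ε • 0 := by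
        intro y
        rw [smul_zero, add_zero]
      exact fun x => key (((Lmod c).prod (N μ)).b x)
  exact h.of_iso (Iso.refl _)
    ((Lmod_iso c).prod ((iso_glue_E_succ d μ).trans (Emod_iso (d + 1) μ)))

theorem blk_L_swap_iso (c : ℕ) : Iso (blk (.L c)).swap (blk (.L c)) := by
  have h1 : ∀ x : Fin (c + 1) → ℂ, (fun i => (Gmat c *ᵥ x) (Fin.rev i)) =
      Fmat c *ᵥ (fun i => x (Fin.rev i)) := by
    intro x
    rw [Fmat_mulVec, Gmat_mulVec]
    exact funext fun i => congrArg x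
      (Fin.ext (by simp only [Fin.val_rev, Fin.val_succ, Fin.val_castSucc]; omega))
  have h2 : ∀ x : Fin (c + 1) → ℂ, (fun i => (Fmat c *ᵥ x) (Fin.rev i)) =
      Gmat c *ᵥ (fun i => x (Fin.rev i)) := by
    intro x
    rw [Fmat_mulVec, Gmat_mulVec]
    exact funext fun i => congrArg x
      (Fin.ext (by simp only [Fin.val_rev, Fin.val_succ, Fin.val_castSucc]; omega))
  exact ⟨LinearEquiv.funCongrLeft ℂ ℂ Fin.revPerm, LinearEquiv.funCongrLeft ℂ ℂ Fin.revPerm, h1, h2⟩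

theorem deg_L_Eb (c d : ℕ) (μ : Option ℂ) :
    Deg ((blk (.L (c + 1))).prod (blk (Eb μ d))) ((blk (.L c)).prod (blk (Eb μ (d + 1)))) := by
  cases μ with
  | some μ => exact deg_L_E c d μ
  | none =>
    have key : ∀ c d, Iso ((blk (.L c)).prod (blk (.E d 0))).swap
        ((blk (.L c)).prod (blk (Eb none d))) := fun c d =>
      (blk_L_swap_iso c).prod (Iso.refl (blk (Eb none d)))
    exact (deg_L_E c d 0).swap.of_iso (key _ _) (key _ _)

theorem deg_Eb_Eb {a b : ℕ} (hab : a ≤ b) (μ : Option ℂ) :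
    Deg ((blk (Eb μ a)).prod (blk (Eb μ (b + 1)))) ((blk (Eb μ (a + 1))).prod (blk (Eb μ b))) := by
  have key : ∀ μ : ℂ, Deg ((blk (.E a μ)).prod (blk (.E (b + 1) μ)))
      ((blk (.E (a + 1) μ)).prod (blk (.E b μ))) := by
    intro μ
    obtain ⟨δ, rfl⟩ : ∃ δ, b = δ + a := ⟨b - a, by omega⟩
    exact (deg_glue (Emod (δ + a) μ) (Emod (a + 1) μ) _ _).of_iso
      ((iso_glue_E_E δ a μ).trans ((Emod_iso _ _).prod (Emod_iso _ _)))
      ((prod_comm_iso _ _).trans ((Emod_iso _ _).prod (Emod_iso _ _)))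
  cases μ with
  | some μ => exact key μ
  | none => exact (key 0).swap

end KMod

/-! ### Sizes -/

/-- Total number of rows of the blocks of `s`. -/
def rowsOf (s : Multiset KBlock) : ℕ := (s.map KBlock.rows).sum

/-- Total number of columns of the blocks of `s`. -/
def colsOf (s : Multiset KBlock) : ℕ := (s.map KBlock.cols).sum

theorem rowsSum_eq (l : List KBlock) : rowsSum l = rowsOf l := by
  induction l with
  | nil => rfl
  | cons b t ih => simp [rowsSum, rowsOf, ih]

theorem colsSum_eq (l : List KBlock) : colsSum l = colsOf l := by
  induction l with
  | nil => rfl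
  | cons b t ih => simp [colsSum, colsOf, ih]

theorem rowsOf_cons (b : KBlock) (s : Multiset KBlock) : rowsOf (b ::ₘ s) = b.rows + rowsOf s := by
  simp [rowsOf]

theorem rowsOf_map_dualBlock (s : Multiset KBlock) : rowsOf (s.map dualBlock) = colsOf s := by
  rw [rowsOf, colsOf, Multiset.map_map]
  congr 2
  funext b
  cases b <;> rfl

theorem rPart_isPartitionFun_aux (s : Multiset KBlock) {i : ℕ} (hi : rowsOf s < i) :
    rPart s i = 0 ∧ lPart s i = 0 ∧ ∀ μ, jPart s μ i = 0 := by
  induction s using Multiset.induction_on with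
  | empty => exact ⟨rfl, rfl, fun _ => rfl⟩
  | cons b s ih =>
    rw [rowsOf_cons] at hi
    obtain ⟨h1, h2, h3⟩ := ih (by omega)
    induction b using KBlock.cases_Eb with
    | hL a =>
      have : (KBlock.L a).rows = a := rfl
      rw [rPart_cons_L, lPart_cons_of_ne (by simp)]
      refine ⟨?_, h2, fun μ => ?_⟩
      · simp only [h1]
        rw [if_neg (by omega)]
      · rw [jPart_cons_of_ne (fun c hc => Eb_ne_L μ c a hc.symm), h3]
    | hLT a =>
      have : (KBlock.LT a).rows = a + 1 := rfl
      rw [lPart_cons_LT, rPart_cons_of_ne (by simp)]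
      refine ⟨h1, ?_, fun μ => ?_⟩
      · simp only [h2]
        rw [if_neg (by omega)]
      · rw [jPart_cons_of_ne (fun c hc => Eb_ne_LT μ c a hc.symm), h3]
    | hE μ a =>
      have : (Eb μ a).rows = a := by rcases μ with _ | μ <;> rfl
      rw [lPart_cons_of_ne (fun c => Eb_ne_LT μ a c), rPart_cons_of_ne (fun c => Eb_ne_L μ a c)]
      refine ⟨h1, h2, fun ν => ?_⟩
      by_cases hν : ν = μ
      · subst hν
        rw [jPart_cons_Eb]
        simp only [h3]
        rw [if_neg (by omega)]
      · rw [jPart_cons_of_ne (fun c hc => hν (Eb_injective hc).1.symm), h3]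

theorem rPart_antitone_succ (s : Multiset KBlock) (i : ℕ) : rPart s (i + 1) ≤ rPart s i := by
  have := rPart_eq_count s i
  omega

theorem lPart_antitone_succ (s : Multiset KBlock) (i : ℕ) : lPart s (i + 1) ≤ lPart s i := by
  have := lPart_eq_count s i
  omega

theorem jPart_antitone_succ (s : Multiset KBlock) (μ : Option ℂ) (i : ℕ) :
    jPart s μ (i + 1) ≤ jPart s μ i := by
  have := jPart_eq_count s μ i
  omega

theorem isPartitionFun_rPart (s : Multiset KBlock) : IsPartitionFun (rPart s) :=
  ⟨rPart_antitone_succ s, rowsOf s + 1, fun _ hi => (rPart_isPartitionFun_aux s hi).1⟩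

theorem isPartitionFun_lPart (s : Multiset KBlock) : IsPartitionFun (lPart s) :=
  ⟨lPart_antitone_succ s, rowsOf s + 1, fun _ hi => (rPart_isPartitionFun_aux s hi).2.1⟩

theorem isPartitionFun_jPart (s : Multiset KBlock) (μ : Option ℂ) : IsPartitionFun (jPart s μ) :=
  ⟨jPart_antitone_succ s μ, rowsOf s + 1, fun _ hi => (rPart_isPartitionFun_aux s hi).2.2 μ⟩

/-- The eigenvalues occurring in `s`. -/
def evs (s : Multiset KBlock) : Set (Option ℂ) := {μ | jPart s μ 0 ≠ 0}

theorem jPart_eq_zero_of_zero {s : Multiset KBlock} {μ : Option ℂ} (h : jPart s μ 0 = 0) (i : ℕ) :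
    jPart s μ i = 0 := by
  induction i with
  | zero => exact h
  | succ i ih => have := jPart_antitone_succ s μ i; omega

theorem finite_evs (s : Multiset KBlock) : (evs s).Finite := by
  induction s using Multiset.induction_on with
  | empty => exact Set.finite_empty.subset fun μ h => h rfl
  | cons b s ih =>
    induction b using KBlock.cases_Eb with
    | hL a =>
      refine ih.subset fun μ h => ?_
      rwa [evs, Set.mem_ofPred_eq, jPart_cons_of_ne (fun c hc => Eb_ne_L μ c a hc.symm)] at h
    | hLT a =>
      refine ih.subset fun μ h => ?_
      rwa [evs, Set.mem_ofPred_eq, jPart_cons_of_ne (fun c hc => Eb_ne_LT μ c a hc.symm)] at h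
    | hE μ a =>
      refine (ih.insert μ).subset fun ν h => ?_
      by_cases hν : ν = μ
      · exact Or.inl hν
      · rw [evs, Set.mem_ofPred_eq, jPart_cons_of_ne (fun c hc => hν (Eb_injective hc).1.symm)] at h
        exact Or.inr h

theorem rowsOf_add (s : Multiset KBlock) {N : ℕ} (hN : rowsOf s < N) (F : Finset (Option ℂ))
    (hF : ∀ μ ∉ F, jPart s μ 0 = 0) :
    rowsOf s + rPart s 0 = psum (rPart s) N + psum (lPart s) N + ∑ μ ∈ F, psum (jPart s μ) N := by
  induction s using Multiset.induction_on with
  | empty => simp [rowsOf, rPart_zero, lPart_zero, jPart_zero, psum_fun_zero]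
  | cons b s ih =>
    rw [rowsOf_cons] at hN
    induction b using KBlock.cases_Eb with
    | hL a =>
      have hj : ∀ μ, jPart (.L a ::ₘ s) μ = jPart s μ := fun μ =>
        jPart_cons_of_ne (fun c hc => Eb_ne_L μ c a hc.symm) s
      have ha : (KBlock.L a).rows = a := rfl
      simp only [hj] at hF ⊢
      rw [rowsOf_cons, rPart_cons_L, lPart_cons_of_ne (by simp), psum_add, psum_indicator, ha]
      have := ih (by omega) hF
      simp only [Nat.zero_lt_succ, if_true]
      omega
    | hLT a =>
      have hj : ∀ μ, jPart (.LT a ::ₘ s) μ = jPart s μ := fun μ =>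
        jPart_cons_of_ne (fun c hc => Eb_ne_LT μ c a hc.symm) s
      have ha : (KBlock.LT a).rows = a + 1 := rfl
      simp only [hj] at hF ⊢
      rw [rowsOf_cons, lPart_cons_LT, rPart_cons_of_ne (by simp), psum_add, psum_indicator, ha]
      have := ih (by omega) hF
      omega
    | hE μ a =>
      have ha : (Eb μ a).rows = a := by rcases μ with _ | μ <;> rfl
      have hj : ∀ ν, jPart (Eb μ a ::ₘ s) ν =
          fun i => (if ν = μ ∧ i < a then 1 else 0) + jPart s ν i := by
        intro ν
        by_cases hν : ν = μ
        · subst hν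
          rw [jPart_cons_Eb]
          simp
        · rw [jPart_cons_of_ne (fun c hc => hν (Eb_injective hc).1.symm)]
          simp [hν]
      have hp : ∀ ν, psum (jPart (Eb μ a ::ₘ s) ν) N =
          (if ν = μ then a else 0) + psum (jPart s ν) N := by
        intro ν
        rw [hj, psum_add]
        by_cases hν : ν = μ
        · simp only [hν, true_and, if_true, psum_indicator]
          rw [min_eq_right (by omega)]
        · simp [hν, psum]
      rw [rowsOf_cons, lPart_cons_of_ne (fun c => Eb_ne_LT μ a c),
        rPart_cons_of_ne (fun c => Eb_ne_L μ a c), ha]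
      simp only [hp, Finset.sum_add_distrib, Finset.sum_ite_eq']
      have := ih (by omega) fun ν hν => by
        have := hF ν hν
        simp only [hj] at this
        omega
      by_cases hμ : μ ∈ F
      · rw [if_pos hμ]
        omega
      · have := hF μ hμ
        simp only [hj, true_and] at this
        rw [if_neg hμ]
        split_ifs at this <;> omega

theorem colsOf_add (s : Multiset KBlock) {N : ℕ} (hN : colsOf s < N) (F : Finset (Option ℂ))
    (hF : ∀ μ ∉ F, jPart s μ 0 = 0) :
    colsOf s + lPart s 0 = psum (rPart s) N + psum (lPart s) N + ∑ μ ∈ F, psum (jPart s μ) N := by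
  have := rowsOf_add (s.map dualBlock) (N := N) (by rwa [rowsOf_map_dualBlock]) F
    (by simpa only [jPart_map_dualBlock] using hF)
  simp only [rowsOf_map_dualBlock, rPart_map_dualBlock, lPart_map_dualBlock,
    jPart_map_dualBlock] at this
  omega

theorem exists_part_eq {α : Type*} (part : Multiset KBlock → ℕ → ℕ) (Φ : Multiset KBlock → α)
    (b : ℕ → KBlock)
    (hb : ∀ a s, part (b a ::ₘ s) = fun i => (if i < a + 1 then 1 else 0) + part s i)
    (hΦ : ∀ a s, Φ (b a ::ₘ s) = Φ s) {p : ℕ → ℕ} (hp : IsPartitionFun p) (s : Multiset KBlock)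
    (hs : part s = 0) : ∃ s', part s' = p ∧ Φ s' = Φ s := by
  obtain ⟨hp, N, hN⟩ := hp
  induction N generalizing p s with
  | zero => exact ⟨s, by rw [hs]; funext i; exact (hN i (by omega)).symm, rfl⟩
  | succ N ih =>
    have key : ∀ c, ∃ s', (part s' = fun i => (p i - p N) + if i < N + 1 then c else 0) ∧
        Φ s' = Φ s := by
      intro c
      induction c with
      | zero =>
        obtain ⟨s', h1, h2⟩ := ih (p := fun i => p i - p N) s hs
          (fun i => by have := hp i; omega)
          (fun i hi => by
            rcases hi.lt_or_eq with h | rfl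
            · simp only [hN i h]
              omega
            · simp)
        exact ⟨s', by rw [h1]; simp, h2⟩
      | succ c ihc =>
        obtain ⟨s', h1, h2⟩ := ihc
        refine ⟨b N ::ₘ s', ?_, by rw [hΦ, h2]⟩
        rw [hb, h1]
        funext i
        simp only
        split_ifs <;> omega
    obtain ⟨s', h1, h2⟩ := key (p N)
    refine ⟨s', ?_, h2⟩
    rw [h1]
    funext i
    have hanti : Antitone p := antitone_nat_of_succ_le hp
    split_ifs with h
    · have := hanti (show i ≤ N by omega)
      omega
    · simp [hN i (by omega)]

/-- Any family of partitions is realised by a multiset of blocks. -/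
theorem exists_of_isPartitionFun {R L : ℕ → ℕ} {J : Option ℂ → ℕ → ℕ} (hR : IsPartitionFun R)
    (hL : IsPartitionFun L) (hJ : ∀ μ, IsPartitionFun (J μ)) (F : Finset (Option ℂ))
    (hF : ∀ μ ∉ F, J μ = 0) :
    ∃ s, rPart s = R ∧ lPart s = L ∧ ∀ μ, jPart s μ = J μ := by
  have h1 : ∃ s, rPart s = 0 ∧ lPart s = 0 ∧ ∀ μ, jPart s μ = J μ := by
    induction F using Finset.induction_on generalizing J with
    | empty => exact ⟨0, rfl, rfl, fun μ => (hF μ (by simp)).symm⟩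
    | insert μ F hμ ih =>
      obtain ⟨s, e1, e2, e3⟩ := ih (J := fun ν => if ν = μ then 0 else J ν)
        (fun ν => by
          by_cases h : ν = μ
          · simp only [h, if_true]
            exact ⟨fun _ => le_rfl, 0, fun _ _ => rfl⟩
          · simp only [h, if_false]
            exact hJ ν)
        (fun ν hν => by
          by_cases h : ν = μ
          · simp [h]
          · simp only [h, if_false]
            exact hF ν (by simp [h, hν]))
      obtain ⟨s', h, h'⟩ := exists_part_eq (fun s => jPart s μ)
        (fun s => (rPart s, lPart s, fun ν : {ν // ν ≠ μ} => jPart s ν))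
        (fun a => Eb μ (a + 1)) (fun a s => jPart_cons_Eb μ (a + 1) s)
        (fun a s => by
          simp only [Prod.mk.injEq]
          exact ⟨rPart_cons_of_ne (fun c => Eb_ne_L μ _ c) s,
            lPart_cons_of_ne (fun c => Eb_ne_LT μ _ c) s,
            funext fun ν => jPart_cons_of_ne (fun c hc => ν.2 (Eb_injective hc).1.symm) s⟩)
        (hJ μ) s (by simp only [e3, if_true])
      simp only [Prod.mk.injEq] at h'
      refine ⟨s', h'.1.trans e1, h'.2.1.trans e2, fun ν => ?_⟩
      by_cases hν : ν = μ
      · rw [hν, ← h]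
      · have := congrFun h'.2.2 ⟨ν, hν⟩
        simp only [e3, hν, if_false] at this
        exact this
  obtain ⟨s, e1, e2, e3⟩ := h1
  obtain ⟨s', f1, f2⟩ := exists_part_eq rPart (fun s => (lPart s, jPart s)) .L rPart_cons_L
    (fun a s => by
      simp only [Prod.mk.injEq]
      exact ⟨lPart_cons_of_ne (by simp) s,
        funext fun ν => jPart_cons_of_ne (fun c hc => Eb_ne_L ν c a hc.symm) s⟩) hR s e1
  simp only [Prod.mk.injEq] at f2
  obtain ⟨s'', g1, g2⟩ := exists_part_eq lPart (fun s => (rPart s, jPart s)) .LT lPart_cons_LT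
    (fun a s => by
      simp only [Prod.mk.injEq]
      exact ⟨rPart_cons_of_ne (by simp) s,
        funext fun ν => jPart_cons_of_ne (fun c hc => Eb_ne_LT ν c a hc.symm) s⟩) hL s'
    (f2.1.trans e2)
  simp only [Prod.mk.injEq] at g2
  exact ⟨s'', g2.1.trans f1, g1, fun μ => by rw [g2.2, f2.2, e3]⟩

/-! ### Recognising canonical blocks -/

theorem eq_indicator {p : ℕ → ℕ} (hp : ∀ i, p (i + 1) ≤ p i) (h0 : p 0 ≤ 1) {N : ℕ} (hN : p N = 0) :
    p = fun i => if i < psum p N then 1 else 0 := by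
  have hanti : Antitone p := antitone_nat_of_succ_le hp
  have hex : ∃ n, p n = 0 := ⟨N, hN⟩
  have key : p = fun i => if i < Nat.find hex then 1 else 0 := by
    funext i
    split_ifs with h
    · have h1 := Nat.find_min hex h
      have h2 := hanti (Nat.zero_le i)
      omega
    · have h1 := hanti (not_lt.1 h)
      rw [Nat.find_spec hex] at h1
      omega
  have : psum p N = Nat.find hex := by
    conv_lhs => rw [key]
    rw [psum_indicator]
    exact min_eq_right (Nat.find_min' hex hN)
  rw [this]
  exact key

namespace KMod

theorem finrank_sum_V (l : List KBlock) : Module.finrank ℂ (sum l).V = colsOf l := by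
  rw [(sum_iso_pencilOfList l).finrank_V, finrank_ofMat_V, Fintype.card_fin, colsSum_eq]

theorem finrank_sum_W (l : List KBlock) : Module.finrank ℂ (sum l).W = rowsOf l := by
  rw [(sum_iso_pencilOfList l).finrank_W, finrank_ofMat_W, Fintype.card_fin, rowsSum_eq]

theorem rowsOf_add_rPart (s : Multiset KBlock) :
    rowsOf s + rPart s 0 = colsOf s + lPart s 0 := by
  have h1 := rowsOf_add s (N := rowsOf s + colsOf s + 1) (by omega) (finite_evs s).toFinset
    (by simp [evs])
  have h2 := colsOf_add s (N := rowsOf s + colsOf s + 1) (by omega) (finite_evs s).toFinset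
    (by simp [evs])
  omega

theorem iso_blk_of_sameData {l : List KBlock} {b : KBlock} (h : SameData l (b ::ₘ 0)) :
    Iso (sum l) (blk b) :=
  (iso_of_sameData (l' := [b]) h).trans (sum_singleton_iso b)

theorem iso_LT_of_injective {M : KMod} {s : ℕ} (hV : Module.finrank ℂ M.V = s)
    (hW : Module.finrank ℂ M.W = s + 1) (h : ∀ μ, Function.Injective (M.localAt μ).a) :
    Iso M (blk (.LT s)) := by
  obtain ⟨l, hl⟩ := isSum M
  rw [← hl.finrank_V, finrank_sum_V] at hV
  rw [← hl.finrank_W, finrank_sum_W] at hW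
  have hJ : ∀ μ, rPart l 0 + jPart l μ 0 = 0 := fun μ => by
    have h1 := dimJ_sum l μ 1
    have h2 := hl.dimJ_eq μ 1
    rw [dimJ, dimJ, chainDim_eq_zero_of_injective_a (M.localAt μ) le_rfl (h μ)] at h2
    rw [dimJ, h2, psum_succ, psum_zero] at h1
    omega
  have hJ0 : ∀ μ, jPart l μ 0 = 0 := fun μ => by have := hJ μ; omega
  have hR0 : rPart l 0 = 0 := by have := hJ none; omega
  have hR : rPart (l : Multiset KBlock) = 0 := by
    funext i
    exact Nat.le_zero.1
      ((antitone_nat_of_succ_le (rPart_antitone_succ l) (Nat.zero_le i)).trans hR0.le)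
  have hrc := rowsOf_add_rPart l
  have h1 := rowsOf_add l (N := s + 2) (by omega) ∅ fun μ _ => hJ0 μ
  rw [hR, psum_fun_zero] at h1
  refine (hl.symm.trans (iso_blk_of_sameData ⟨?_, ?_, fun μ => ?_⟩))
  · rw [hR, rPart_cons_of_ne (by simp)]
    rfl
  · rw [eq_indicator (lPart_antitone_succ l) (N := s + 2) (by omega)
      (rPart_isPartitionFun_aux l (by omega)).2.1, lPart_cons_LT, lPart_zero]
    funext i
    simp only [Finset.sum_empty, Pi.zero_apply] at h1 ⊢
    rw [show psum (lPart l) (s + 2) = s + 1 by omega, add_zero]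
  · rw [jPart_cons_of_ne fun c => (Eb_ne_LT μ c s).symm]
    exact funext fun i => jPart_eq_zero_of_zero (hJ0 μ) i

theorem iso_L_of_surjective {M : KMod} {t : ℕ} (hV : Module.finrank ℂ M.V = t + 1)
    (hW : Module.finrank ℂ M.W = t) (h : ∀ μ, Function.Surjective (M.localAt μ).a) :
    Iso M (blk (.L t)) := by
  obtain ⟨l, hl⟩ := isSum M
  have hJ : ∀ μ, rPart l 0 + jPart l μ 0 = 1 := fun μ => by
    have h1 := dimJ_sum l μ 1
    have h2 := hl.dimJ_eq μ 1
    have h3 := chainDim_of_surjective_a (M.localAt μ) 1 (h μ)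
    have hV' : Module.finrank ℂ (M.localAt μ).V = t + 1 := hV
    have hW' : Module.finrank ℂ (M.localAt μ).W = t := hW
    rw [dimJ, dimJ] at h2
    rw [dimJ, h2, psum_succ, psum_zero] at h1
    omega
  rw [← hl.finrank_V, finrank_sum_V] at hV
  rw [← hl.finrank_W, finrank_sum_W] at hW
  have hrc := rowsOf_add_rPart l
  have hJ0 : ∀ μ, jPart l μ 0 = 0 := fun μ => by have := hJ μ; omega
  have hR0 : rPart l 0 = 1 := by have := hJ none; omega
  have hL0 : lPart l 0 = 0 := by omega
  have hL : lPart (l : Multiset KBlock) = 0 := by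
    funext i
    exact Nat.le_zero.1
      ((antitone_nat_of_succ_le (lPart_antitone_succ l) (Nat.zero_le i)).trans hL0.le)
  have h1 := rowsOf_add l (N := t + 1) (by omega) ∅ fun μ _ => hJ0 μ
  rw [hL, psum_fun_zero] at h1
  refine (hl.symm.trans (iso_blk_of_sameData ⟨?_, ?_, fun μ => ?_⟩))
  · rw [eq_indicator (rPart_antitone_succ l) (N := t + 1) (by omega)
      (rPart_isPartitionFun_aux l (by omega)).1, rPart_cons_L, rPart_zero]
    funext i
    simp only [Finset.sum_empty, Pi.zero_apply] at h1 ⊢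
    rw [show psum (rPart l) (t + 1) = t + 1 by omega, add_zero]
  · rw [hL, lPart_cons_of_ne (by simp)]
    rfl
  · rw [jPart_cons_of_ne fun c => (Eb_ne_L μ c t).symm]
    exact funext fun i => jPart_eq_zero_of_zero (hJ0 μ) i

/-- The eigenvalue part of the sum of Jordan blocks with distinct eigenvalues. -/
theorem jPart_map_Eb {ek : List (Option ℂ × ℕ)} (hnd : (ek.map Prod.fst).Nodup) :
    (∀ x ∈ ek, jPart ((ek.map fun x => Eb x.1 x.2 : List KBlock) : Multiset KBlock) x.1 =
      fun i => if i < x.2 then 1 else 0) ∧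
    (∀ ν ∉ ek.map Prod.fst, jPart ((ek.map fun x => Eb x.1 x.2 : List KBlock) : Multiset KBlock) ν =
      0) := by
  induction ek with
  | nil => exact ⟨by simp, fun _ _ => rfl⟩
  | cons y ek ih =>
    rw [List.map_cons, List.nodup_cons] at hnd
    obtain ⟨ih1, ih2⟩ := ih hnd.2
    rw [List.map_cons, ← Multiset.cons_coe]
    refine ⟨fun x hx => ?_, fun ν hν => ?_⟩
    · rcases List.mem_cons.1 hx with rfl | hx
      · rw [jPart_cons_Eb, ih2 _ hnd.1]
        rfl
      · rw [jPart_cons_of_ne, ih1 x hx]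
        intro c hc
        exact hnd.1 ((Eb_injective hc).1 ▸ List.mem_map_of_mem hx)
    · rw [List.map_cons, List.mem_cons, not_or] at hν
      rw [jPart_cons_of_ne fun c hc => hν.1 (Eb_injective hc).1.symm, ih2 ν hν.2]

theorem parts_map_Eb (ek : List (Option ℂ × ℕ)) :
    rPart ((ek.map fun x => Eb x.1 x.2 : List KBlock) : Multiset KBlock) = 0 ∧
    lPart ((ek.map fun x => Eb x.1 x.2 : List KBlock) : Multiset KBlock) = 0 := by
  induction ek with
  | nil => exact ⟨rfl, rfl⟩
  | cons y ek ih =>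
    rw [List.map_cons, ← Multiset.cons_coe, rPart_cons_of_ne fun c => Eb_ne_L _ _ c,
      lPart_cons_of_ne fun c => Eb_ne_LT _ _ c]
    exact ih

theorem rowsOf_map_Eb (ek : List (Option ℂ × ℕ)) :
    rowsOf ((ek.map fun x => Eb x.1 x.2 : List KBlock) : Multiset KBlock) =
      (ek.map Prod.snd).sum := by
  induction ek with
  | nil => rfl
  | cons y ek ih =>
    have : ∀ μ a, (Eb μ a).rows = a := by rintro (_ | μ) a <;> rfl
    rw [List.map_cons, ← Multiset.cons_coe, rowsOf_cons, ih, this, List.map_cons, List.sum_cons]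

/-- A regular module with one long chain and a one-dimensional kernel at each prescribed
eigenvalue is a sum of Jordan blocks. -/
theorem iso_sum_Eb {M : KMod} {ek : List (Option ℂ × ℕ)} (hnd : (ek.map Prod.fst).Nodup)
    (hV : Module.finrank ℂ M.V = (ek.map Prod.snd).sum)
    (hW : Module.finrank ℂ M.W = (ek.map Prod.snd).sum)
    {c : Option ℂ} (hc : Function.Injective (M.localAt c).a)
    (h1 : ∀ x ∈ ek, M.dimJ x.1 1 ≤ 1) (hd : ∀ x ∈ ek, x.2 ≤ M.dimJ x.1 x.2) :
    Iso M (sum (ek.map fun x => Eb x.1 x.2)) := by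
  obtain ⟨l, hl⟩ := isSum M
  rw [← hl.finrank_V, finrank_sum_V] at hV
  rw [← hl.finrank_W, finrank_sum_W] at hW
  have hJ : ∀ μ k, M.dimJ μ k = k * rPart l 0 + psum (jPart l μ) k := fun μ k =>
    (hl.dimJ_eq μ k).symm.trans (dimJ_sum l μ k)
  have hR0 : rPart l 0 = 0 := by
    have h2 := hJ c 1
    rw [dimJ, chainDim_eq_zero_of_injective_a (M.localAt c) le_rfl hc] at h2
    omega
  have hrc := rowsOf_add_rPart l
  have hL0 : lPart l 0 = 0 := by omega
  have hR : rPart (l : Multiset KBlock) = 0 := by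
    funext i
    exact Nat.le_zero.1
      ((antitone_nat_of_succ_le (rPart_antitone_succ l) (Nat.zero_le i)).trans hR0.le)
  have hL : lPart (l : Multiset KBlock) = 0 := by
    funext i
    exact Nat.le_zero.1
      ((antitone_nat_of_succ_le (lPart_antitone_succ l) (Nat.zero_le i)).trans hL0.le)
  simp only [hR0, mul_zero, zero_add] at hJ
  obtain ⟨N, hN⟩ : ∃ N, N = rowsOf l + 1 := ⟨_, rfl⟩
  have hmono : ∀ μ, Monotone (psum (jPart (l : Multiset KBlock) μ)) := fun μ =>
    monotone_nat_of_le_succ fun k => by rw [psum_succ]; omega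
  have hmem : ∀ x ∈ ek, x.2 ≤ psum (jPart l x.1) N := fun x hx => by
    have h2 := hd x hx
    rw [hJ] at h2
    refine h2.trans (hmono _ ?_)
    have := List.single_le_sum (l := ek.map Prod.snd) (by simp) x.2 (List.mem_map_of_mem hx)
    omega
  set F := (ek.map Prod.fst).toFinset ∪ (finite_evs l).toFinset with hF
  have hsum := rowsOf_add l (N := N) (by omega) F fun μ hμ => by
    by_contra h
    exact hμ (Finset.mem_union_right _ ((finite_evs l).mem_toFinset.2 h))
  rw [hR, hL, psum_fun_zero, hW, zero_add, zero_add, Pi.zero_apply, add_zero] at hsum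
  have hsum' := rowsOf_add ((ek.map fun x => Eb x.1 x.2 : List KBlock) : Multiset KBlock) (N := N)
    (by rw [rowsOf_map_Eb]; omega) F fun μ hμ => by
      rw [(jPart_map_Eb hnd).2 μ fun h => hμ (Finset.mem_union_left _ (List.mem_toFinset.2 h))]
      rfl
  rw [rowsOf_map_Eb, (parts_map_Eb ek).1, (parts_map_Eb ek).2, psum_fun_zero, zero_add, zero_add,
    Pi.zero_apply, add_zero] at hsum'
  have hle : ∀ μ ∈ F,
      psum (jPart ((ek.map fun x => Eb x.1 x.2 : List KBlock) : Multiset KBlock) μ) N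
      ≤ psum (jPart l μ) N := by
    intro μ _
    by_cases h : μ ∈ ek.map Prod.fst
    · obtain ⟨x, hx, rfl⟩ := List.mem_map.1 h
      rw [(jPart_map_Eb hnd).1 x hx, psum_indicator]
      exact (min_le_right _ _).trans (hmem x hx)
    · rw [(jPart_map_Eb hnd).2 μ h, psum_fun_zero]
      exact Nat.zero_le _
  have heq := (Finset.sum_eq_sum_iff_of_le hle).1 (hsum'.symm.trans hsum)
  refine hl.symm.trans (iso_of_sameData ⟨?_, ?_, fun μ => ?_⟩)
  · rw [hR, (parts_map_Eb ek).1]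
  · rw [hL, (parts_map_Eb ek).2]
  · have hj : psum (jPart l μ) N =
        psum (jPart ((ek.map fun x => Eb x.1 x.2 : List KBlock) : Multiset KBlock) μ) N := by
      by_cases h : μ ∈ F
      · exact (heq μ h).symm
      · rw [hF, Finset.mem_union, not_or, List.mem_toFinset] at h
        rw [(jPart_map_Eb hnd).2 μ h.1]
        congr 1
        funext i
        refine jPart_eq_zero_of_zero ?_ i
        by_contra hi
        exact h.2 ((finite_evs l).mem_toFinset.2 hi)
    by_cases h : μ ∈ ek.map Prod.fst
    · obtain ⟨x, hx, rfl⟩ := List.mem_map.1 h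
      have h2 := h1 x hx
      rw [hJ] at h2
      have h3 : x.2 ≤ N := by
        have := List.single_le_sum (l := ek.map Prod.snd) (by simp) x.2 (List.mem_map_of_mem hx)
        omega
      rw [(jPart_map_Eb hnd).1 x hx, psum_indicator, min_eq_right h3] at hj
      rw [(jPart_map_Eb hnd).1 x hx, eq_indicator (jPart_antitone_succ l x.1) (N := N)
        (by rwa [psum_succ, psum_zero, zero_add] at h2)
        ((rPart_isPartitionFun_aux l (by omega)).2.2 x.1), hj]
    · rw [(jPart_map_Eb hnd).2 μ h] at hj ⊢
      funext i
      refine jPart_eq_zero_of_zero ?_ i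
      have h2 := hmono μ (show 1 ≤ N by omega)
      rw [hj, psum_fun_zero, psum_succ, psum_zero] at h2
      omega

end KMod

/-! ### Degeneration of a regular module to a singular one -/

namespace KMod

/-- The restriction of a module to a pair of subspaces. -/
def subMod (M : KMod) (V' : Submodule ℂ M.V) (W' : Submodule ℂ M.W)
    (ha : V' ≤ W'.comap M.a) (hb : V' ≤ W'.comap M.b) : KMod :=
  ⟨V', W', M.a.restrict ha, M.b.restrict hb⟩

/-- The quotient of a module by a pair of subspaces. -/
def quotMod (M : KMod) (V' : Submodule ℂ M.V) (W' : Submodule ℂ M.W)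
    (ha : V' ≤ W'.comap M.a) (hb : V' ≤ W'.comap M.b) : KMod :=
  ⟨M.V ⧸ V', M.W ⧸ W', V'.mapQ W' M.a ha, V'.mapQ W' M.b hb⟩

theorem deg_sub_quot (M : KMod) (V' : Submodule ℂ M.V) (W' : Submodule ℂ M.W)
    (ha : V' ≤ W'.comap M.a) (hb : V' ≤ W'.comap M.b) :
    Deg M ((M.subMod V' W' ha hb).prod (M.quotMod V' W' ha hb)) := by
  obtain ⟨σ, hσ⟩ := V'.mkQ.exists_rightInverse_of_surjective V'.range_mkQ
  obtain ⟨τ, hτ⟩ := W'.mkQ.exists_rightInverse_of_surjective W'.range_mkQ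
  have hσ' : ∀ y, V'.mkQ (σ y) = y := fun y => LinearMap.congr_fun hσ y
  have hτ' : ∀ y, W'.mkQ (τ y) = y := fun y => LinearMap.congr_fun hτ y
  have key : ∀ (c : M.V →ₗ[ℂ] M.W) (hc : V' ≤ W'.comap c),
      ∀ y, (c ∘ₗ σ - τ ∘ₗ V'.mapQ W' c hc) y ∈ W' := by
    intro c hc y
    refine (Submodule.Quotient.mk_eq_zero W').1 ?_
    change W'.mkQ ((c ∘ₗ σ - τ ∘ₗ V'.mapQ W' c hc) y) = 0
    rw [LinearMap.sub_apply, map_sub,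
      LinearMap.comp_apply, LinearMap.comp_apply, hτ', sub_eq_zero]
    conv_rhs => rw [← hσ' y]
    rfl
  let x : ∀ (c : M.V →ₗ[ℂ] M.W) (hc : V' ≤ W'.comap c), (M.V ⧸ V') →ₗ[ℂ] W' := fun c hc =>
    (c ∘ₗ σ - τ ∘ₗ V'.mapQ W' c hc).codRestrict W' (key c hc)
  refine (deg_glue (M.subMod V' W' ha hb) (M.quotMod V' W' ha hb) (x M.a ha) (x M.b hb)).of_iso
    ?_ (Iso.refl _)
  have hinj : ∀ {U : Type} [AddCommGroup U] [Module ℂ U] (U' : Submodule ℂ U)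
      (ρ : (U ⧸ U') →ₗ[ℂ] U), (∀ y, U'.mkQ (ρ y) = y) →
      Function.Injective (U'.subtype.coprod ρ) := by
    intro U _ _ U' ρ hρ
    refine injective_of_zero _ fun z hz => ?_
    have h1 : (z.1 : U) + ρ z.2 = 0 := hz
    have h2 : z.2 = 0 := by
      have := congrArg U'.mkQ h1
      rwa [map_add, hρ, map_zero, show U'.mkQ z.1 = 0 from
        (Submodule.Quotient.mk_eq_zero U').2 z.1.2,
        zero_add] at this
    rw [h2, map_zero, add_zero] at h1
    exact Prod.ext (Subtype.ext h1) h2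
  have hfr : ∀ {U : Type} [AddCommGroup U] [Module ℂ U] [FiniteDimensional ℂ U]
      (U' : Submodule ℂ U), Module.finrank ℂ (U' × (U ⧸ U')) = Module.finrank ℂ U := by
    intro U _ _ _ U'
    rw [Module.finrank_prod, add_comm, Submodule.finrank_quotient_add_finrank]
  have hcomm : ∀ (c : M.V →ₗ[ℂ] M.W) (hc : V' ≤ W'.comap c) (z : V' × (M.V ⧸ V')),
      ((c.restrict hc z.1 + x c hc z.2 : W') : M.W) + τ (V'.mapQ W' c hc z.2) =
        c (z.1 + σ z.2) := by
    intro c hc z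
    have h1 : ((x c hc z.2 : W') : M.W) = c (σ z.2) - τ (V'.mapQ W' c hc z.2) := rfl
    rw [Submodule.coe_add, h1, LinearMap.coe_restrict_apply, map_add]
    abel
  exact Iso.of_injective (V'.subtype.coprod σ) (W'.subtype.coprod τ) (hinj V' σ hσ')
    (hinj W' τ hτ') (hfr V') (hfr W') (hcomm M.a ha) (hcomm M.b hb)

open Polynomial in
/-- The linear form vanishing at an eigenvalue, in a coordinate in which `c` is at infinity. -/
def evPoly (c : ℂ) : Option ℂ → ℂ[X]
  | none => X
  | some μ => 1 - C (μ - c) * X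

open Polynomial in
/-- Multiplication by two linear forms on the quotient of the polynomial ring by `p`. -/
def polyMod (c : ℂ) {p : ℂ[X]} (hp : p ≠ 0) : KMod :=
  haveI : FiniteDimensional ℂ (AdjoinRoot p) := (AdjoinRoot.powerBasis hp).finite
  ⟨AdjoinRoot p, AdjoinRoot p, LinearMap.mulLeft ℂ (AdjoinRoot.mk p (1 + C c * X)),
    LinearMap.mulLeft ℂ (AdjoinRoot.mk p X)⟩

open Polynomial in
theorem polyMod_localAt_a (c : ℂ) {p : ℂ[X]} (hp : p ≠ 0) (μ : Option ℂ) (y : AdjoinRoot p) :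
    ((polyMod c hp).localAt μ).a y = AdjoinRoot.mk p (evPoly c μ) * y := by
  rcases μ with _ | μ
  · rfl
  · have : ∀ y : AdjoinRoot p, AdjoinRoot.mk p (1 + C c * X) * y - μ • (AdjoinRoot.mk p X * y) =
        AdjoinRoot.mk p (1 - C (μ - c) * X) * y := by
      intro y
      have h : (1 - C (μ - c) * X : ℂ[X]) = 1 + C c * X - μ • X := by
        rw [smul_eq_C_mul, C_sub]
        ring
      rw [h, ← smul_mul_assoc, ← sub_mul, map_sub, ← AdjoinRoot.smul_mk]
    exact this y

open Polynomial in
theorem evPoly_ne_zero (c : ℂ) (μ : Option ℂ) : evPoly c μ ≠ 0 := by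
  rcases μ with _ | μ
  · exact X_ne_zero
  · intro h
    have := congrArg (eval 0) h
    simp [evPoly] at this

open Polynomial in
theorem natDegree_evPoly_le (c : ℂ) (μ : Option ℂ) : (evPoly c μ).natDegree ≤ 1 := by
  rcases μ with _ | μ
  · exact natDegree_X_le
  · refine (natDegree_sub_le _ _).trans (max_le (by simp)
      ((natDegree_C_mul_le _ _).trans natDegree_X_le))

open Polynomial in
theorem natDegree_evPoly {c : ℂ} {μ : Option ℂ} (h : μ ≠ some c) : (evPoly c μ).natDegree = 1 := by
  rcases μ with _ | μ
  · exact natDegree_X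
  · have hμ : μ - c ≠ 0 := fun h' => h (by rw [sub_eq_zero.1 h'])
    have h1 := natDegree_C_mul_X _ hμ
    rw [evPoly, natDegree_sub_eq_right_of_natDegree_lt, h1]
    rw [h1, natDegree_one]
    exact Nat.one_pos

open Polynomial in
theorem natDegree_one_add_le (c : ℂ) : (1 + C c * X : ℂ[X]).natDegree ≤ 1 :=
  (natDegree_add_le _ _).trans (max_le (by simp)
      ((natDegree_C_mul_le _ _).trans natDegree_X_le))

open Polynomial in
/-- The classes of the polynomials of degree less than `n`. -/
def lowDeg (p : ℂ[X]) (n : ℕ) : Submodule ℂ (AdjoinRoot p) :=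
  (degreeLT ℂ n).map (AdjoinRoot.mkₐ p).toLinearMap

open Polynomial in
theorem mem_lowDeg {p : ℂ[X]} {n : ℕ} {y : AdjoinRoot p} :
    y ∈ lowDeg p n ↔ ∃ g : ℂ[X], g.degree < n ∧ AdjoinRoot.mk p g = y := by
  rw [lowDeg, Submodule.mem_map]
  simp only [mem_degreeLT]
  rfl

open Polynomial in
theorem eq_zero_of_mk_eq_zero {p g : ℂ[X]} (hg : g.degree < p.natDegree)
    (h : AdjoinRoot.mk p g = 0) : g = 0 := by
  rw [AdjoinRoot.mk_eq_zero] at h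
  rcases eq_or_ne p 0 with rfl | hp
  · exact zero_dvd_iff.1 h
  · exact eq_zero_of_dvd_of_degree_lt h (hg.trans_le (degree_eq_natDegree hp).ge)

open Polynomial in
theorem finrank_lowDeg {p : ℂ[X]} {n : ℕ} (hn : n ≤ p.natDegree) :
    Module.finrank ℂ (lowDeg p n) = n := by
  have hinj : Function.Injective ((AdjoinRoot.mkₐ p).toLinearMap.domRestrict (degreeLT ℂ n)) := by
    rw [injective_iff_map_eq_zero]
    exact fun g hg => Subtype.ext (eq_zero_of_mk_eq_zero
      ((mem_degreeLT.1 g.2).trans_le (by exact_mod_cast hn)) hg)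
  rw [lowDeg, ← LinearMap.range_domRestrict, LinearMap.finrank_range_of_inj hinj,
    (degreeLTEquiv ℂ n).finrank_eq, Module.finrank_fin_fun]

open Polynomial in
theorem mul_mem_lowDeg {p f : ℂ[X]} (hf : f.natDegree ≤ 1) {n : ℕ} {y : AdjoinRoot p}
    (hy : y ∈ lowDeg p n) : AdjoinRoot.mk p f * y ∈ lowDeg p (n + 1) := by
  obtain ⟨g, hg, rfl⟩ := mem_lowDeg.1 hy
  refine mem_lowDeg.2 ⟨f * g, ?_, map_mul _ _ _⟩
  rcases eq_or_ne g 0 with rfl | h0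
  · rw [mul_zero, degree_zero]
    exact WithBot.bot_lt_coe _
  · rw [degree_eq_natDegree h0, Nat.cast_lt] at hg
    refine degree_le_natDegree.trans_lt ?_
    rw [Nat.cast_lt]
    have := natDegree_mul_le (p := f) (q := g)
    omega

open Polynomial in
theorem finrank_adjoinRoot {p : ℂ[X]} (hp : p ≠ 0) :
    Module.finrank ℂ (AdjoinRoot p) = p.natDegree := by
  rw [(AdjoinRoot.powerBasis hp).finrank, AdjoinRoot.powerBasis_dim]

open Polynomial in
theorem deg_polyMod (c : ℂ) {p : ℂ[X]} (hp : p ≠ 0) {t s : ℕ} (hdeg : p.natDegree = t + s + 1) :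
    Deg (polyMod c hp) ((blk (.L t)).prod (blk (.LT s))) := by
  have ha : lowDeg p s ≤ (lowDeg p (s + 1)).comap (polyMod c hp).a := fun y hy =>
    mul_mem_lowDeg (natDegree_one_add_le c) hy
  have hb : lowDeg p s ≤ (lowDeg p (s + 1)).comap (polyMod c hp).b := fun y hy =>
    mul_mem_lowDeg natDegree_X_le hy
  have : FiniteDimensional ℂ (AdjoinRoot p) := (AdjoinRoot.powerBasis hp).finite
  have h1 : Iso ((polyMod c hp).subMod (lowDeg p s) (lowDeg p (s + 1)) ha hb) (blk (.LT s)) := by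
    refine iso_LT_of_injective (finrank_lowDeg (by omega)) (finrank_lowDeg (by omega)) fun μ => ?_
    have key : ∀ y : lowDeg p s, AdjoinRoot.mk p (evPoly c μ) * (y : AdjoinRoot p) = 0 → y = 0 := by
      intro y hy'
      obtain ⟨g, hg, hgy⟩ := mem_lowDeg.1 y.2
      rw [← hgy, ← map_mul] at hy'
      have h2 := eq_zero_of_mk_eq_zero (by
        rcases eq_or_ne g 0 with rfl | h0
        · rw [mul_zero, degree_zero]
          exact WithBot.bot_lt_coe _
        · rw [degree_eq_natDegree h0, Nat.cast_lt] at hg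
          refine degree_le_natDegree.trans_lt ?_
          rw [Nat.cast_lt]
          have := natDegree_mul_le (p := evPoly c μ) (q := g)
          have := natDegree_evPoly_le c μ
          omega) hy'
      have h3 := (mul_eq_zero.1 h2).resolve_left (evPoly_ne_zero c μ)
      rw [h3, map_zero] at hgy
      exact Subtype.ext hgy.symm
    refine injective_of_zero _ fun y hy => key y ((polyMod_localAt_a c hp μ _).symm.trans ?_)
    have := congrArg Subtype.val hy
    rcases μ with _ | μ <;> exact this
  have h2 : Iso ((polyMod c hp).quotMod (lowDeg p s) (lowDeg p (s + 1)) ha hb) (blk (.L t)) := by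
    have hq : ∀ n ≤ p.natDegree,
        Module.finrank ℂ (AdjoinRoot p ⧸ lowDeg p n) = p.natDegree - n := fun n hn => by
      have h3 := Submodule.finrank_quotient_add_finrank (lowDeg p n)
      rw [finrank_adjoinRoot hp, finrank_lowDeg hn] at h3
      omega
    refine iso_L_of_surjective ((hq s (by omega)).trans (by omega))
      ((hq (s + 1) (by omega)).trans (by omega)) fun μ => ?_
    have key : ∀ w : AdjoinRoot p ⧸ lowDeg p (s + 1), ∃ v : AdjoinRoot p,
        (Submodule.Quotient.mk (AdjoinRoot.mk p (evPoly c μ) * v) : AdjoinRoot p ⧸ _) = w := by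
      intro w
      obtain ⟨w, rfl⟩ := Submodule.Quotient.mk_surjective _ w
      obtain ⟨g, rfl⟩ := AdjoinRoot.mk_surjective w
      refine ⟨AdjoinRoot.mk p (g / evPoly c μ), (Submodule.Quotient.eq _).2 ?_⟩
      refine mem_lowDeg.2 ⟨-(g % evPoly c μ), ?_, ?_⟩
      · rw [degree_neg]
        refine (degree_mod_lt g (evPoly_ne_zero c μ)).trans_le (degree_le_natDegree.trans ?_)
        have := natDegree_evPoly_le c μ
        rw [Nat.cast_le]
        omega
      · rw [← map_mul, ← map_sub]
        congr 1
        have := EuclideanDomain.div_add_mod g (evPoly c μ)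
        linear_combination -this
    intro w
    obtain ⟨v, hv⟩ := key w
    refine ⟨Submodule.Quotient.mk v, Eq.trans ?_ hv⟩
    have h3 := polyMod_localAt_a c hp μ v
    rw [← h3]
    rcases μ with _ | μ <;> rfl
  exact ((polyMod c hp).deg_sub_quot _ _ ha hb).of_iso (Iso.refl _)
    ((h1.prod h2).trans (prod_comm_iso _ _))

theorem le_chainDim_of_chain {M : KMod} {d : ℕ} (τ : ℕ → M.V) (h0 : M.a (τ 0) = 0) (hτ : τ 0 ≠ 0)
    (h : ∀ i, i + 1 < d → M.a (τ (i + 1)) = M.b (τ i)) : d ≤ M.chainDim d d := by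
  let ψ : (Fin d → ℂ) →ₗ[ℂ] (Fin d → M.V) := LinearMap.pi fun i =>
    ∑ j : Fin d, if (j : ℕ) ≤ i then (LinearMap.proj j).smulRight (τ (i - j)) else 0
  have hψ : ∀ y i, ψ y i = ∑ j : Fin d, if (j : ℕ) ≤ i then y j • τ (i - j) else 0 := by
    intro y i
    simp only [ψ, LinearMap.pi_apply, LinearMap.sum_apply]
    refine Finset.sum_congr rfl fun j _ => ?_
    split_ifs <;> rfl
  refine le_chainDim_of_linearMap ψ (fun y hy => ?_) fun y => mem_ker_chainMap.2 ⟨fun hd => ?_,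
    fun i hi => ?_⟩
  · have key : ∀ n (hn : n < d), y ⟨n, hn⟩ = 0 := by
      intro n
      induction n using Nat.strong_induction_on with
      | _ n ih =>
        intro hn
        have h1 := hψ y ⟨n, hn⟩
        rw [hy, Pi.zero_apply, Finset.sum_eq_single ⟨n, hn⟩, if_pos le_rfl, Nat.sub_self] at h1
        · exact (smul_eq_zero.1 h1.symm).resolve_right hτ
        · intro j _ hj
          have hj' : (j : ℕ) ≠ n := fun h' => hj (Fin.ext h')
          split_ifs with hjn
          · rw [ih j (by simp only at hjn; omega) j.2, zero_smul]
          · rfl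
        · exact fun h' => absurd (Finset.mem_univ _) h'
    exact funext fun j => key j j.2
  · rw [extZ_of_lt _ hd, hψ, map_sum]
    refine Finset.sum_eq_zero fun j _ => ?_
    split_ifs with hj
    · rw [show (0 : ℕ) - (j : ℕ) = 0 by omega, map_smul, h0, smul_zero]
    · exact map_zero _
  · rw [extZ_of_lt _ hi, extZ_of_lt _ (show i < d by omega), hψ, hψ, map_sum, map_sum]
    refine Finset.sum_congr rfl fun j _ => ?_
    simp only
    split_ifs with h1 h2 h2
    · rw [map_smul, map_smul, show i + 1 - (j : ℕ) = i - j + 1 by omega, h _ (by omega)]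
    · rw [show i + 1 - (j : ℕ) = 0 by omega, map_smul, h0, smul_zero, map_zero]
    · omega
    · rw [map_zero, map_zero]

open Polynomial in
/-- The second linear form at an eigenvalue. -/
def evCopoly (c : ℂ) : Option ℂ → ℂ[X]
  | none => 1 + C c * X
  | some _ => X

open Polynomial in
theorem polyMod_localAt_b (c : ℂ) {p : ℂ[X]} (hp : p ≠ 0) (μ : Option ℂ) (y : AdjoinRoot p) :
    ((polyMod c hp).localAt μ).b y = AdjoinRoot.mk p (evCopoly c μ) * y := by
  rcases μ with _ | μ <;> rfl

open Polynomial in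
theorem dimJ_polyMod_one_le (c : ℂ) {p : ℂ[X]} (hp : p ≠ 0) {μ : Option ℂ} (hμ : μ ≠ some c)
    (h : evPoly c μ ∣ p) : (polyMod c hp).dimJ μ 1 ≤ 1 := by
  obtain ⟨q, rfl⟩ := h
  have hq : q ≠ 0 := right_ne_zero_of_mul hp
  have key : ∀ y : AdjoinRoot (evPoly c μ * q), AdjoinRoot.mk _ (evPoly c μ) * y = 0 →
      ∃ z : ℂ, z • AdjoinRoot.mk (evPoly c μ * q) q = y := by
    intro y hy
    obtain ⟨g, rfl⟩ := AdjoinRoot.mk_surjective y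
    rw [← map_mul, AdjoinRoot.mk_eq_zero] at hy
    obtain ⟨e, rfl⟩ := (mul_dvd_mul_iff_left (evPoly_ne_zero c μ)).1 hy
    have hdeg : (e % evPoly c μ).degree ≤ 0 := by
      have h1 := degree_mod_lt e (evPoly_ne_zero c μ)
      rw [degree_eq_natDegree (evPoly_ne_zero c μ), natDegree_evPoly hμ] at h1
      exact Nat.WithBot.lt_one_iff_le_zero.1 (by exact_mod_cast h1)
    rw [degree_le_zero_iff] at hdeg
    refine ⟨(e % evPoly c μ).coeff 0, ?_⟩
    rw [AdjoinRoot.smul_mk, ← sub_eq_zero, ← map_sub, AdjoinRoot.mk_eq_zero]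
    refine ⟨-(e / evPoly c μ), ?_⟩
    have h1 := EuclideanDomain.div_add_mod e (evPoly c μ)
    rw [smul_eq_C_mul, ← hdeg]
    linear_combination q * h1
  have hv := mem_ker_chainMap (M := (polyMod c hp).localAt μ) (k := 1) (K := 1)
    (x := fun _ => AdjoinRoot.mk (evPoly c μ * q) q)
  refine finrank_le_one ⟨fun _ => AdjoinRoot.mk (evPoly c μ * q) q, hv.2 ⟨fun _ => ?_, by omega⟩⟩
    fun w => ?_
  · refine (polyMod_localAt_a c hp μ _).trans ?_
    have h2 :
        AdjoinRoot.mk (evPoly c μ * q) (evPoly c μ) * AdjoinRoot.mk (evPoly c μ * q) q = 0 := by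
      rw [← map_mul, AdjoinRoot.mk_self]
    exact h2
  · have h1 := (mem_ker_chainMap.1 w.2).1 one_pos
    obtain ⟨z, hz⟩ := key (w.1 0) ((polyMod_localAt_a c hp μ _).symm.trans h1)
    refine ⟨z, Subtype.ext (funext fun i => ?_)⟩
    rw [Subsingleton.elim i 0]
    exact hz

open Polynomial in
theorem le_dimJ_polyMod (c : ℂ) {p : ℂ[X]} (hp : p ≠ 0) {μ : Option ℂ} (hμ : μ ≠ some c) {d : ℕ}
    (hd : 1 ≤ d) (h : evPoly c μ ^ d ∣ p) : d ≤ (polyMod c hp).dimJ μ d := by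
  obtain ⟨q, hq⟩ := h
  obtain ⟨d, rfl⟩ : ∃ e, d = e + 1 := ⟨d - 1, by omega⟩
  have hf := evPoly_ne_zero c μ
  have hq0 : q ≠ 0 := by
    rintro rfl
    exact hp (by rw [hq, mul_zero])
  have hne : AdjoinRoot.mk p (evPoly c μ ^ d * q) ≠ 0 := by
    intro h0
    have h1 := eq_zero_of_mk_eq_zero (by
      rw [degree_eq_natDegree (mul_ne_zero (pow_ne_zero _ hf) hq0), Nat.cast_lt, hq,
        natDegree_mul (pow_ne_zero _ hf) hq0, natDegree_mul (pow_ne_zero _ hf) hq0,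
        natDegree_pow, natDegree_pow, natDegree_evPoly hμ]
      omega) h0
    exact mul_ne_zero (pow_ne_zero _ hf) hq0 h1
  refine le_chainDim_of_chain (M := (polyMod c hp).localAt μ)
    (fun j => AdjoinRoot.mk p (evCopoly c μ ^ j * evPoly c μ ^ (d - j) * q)) ?_ ?_ fun i hi => ?_
  · have h1 : AdjoinRoot.mk p (evPoly c μ) *
        AdjoinRoot.mk p (evCopoly c μ ^ 0 * evPoly c μ ^ (d - 0) * q) = 0 := by
      rw [← map_mul, AdjoinRoot.mk_eq_zero]
      exact ⟨1, by rw [hq, Nat.sub_zero]; ring⟩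
    exact (polyMod_localAt_a c hp μ _).trans h1
  · intro h0
    refine hne (Eq.trans ?_ h0)
    simp
  · have h1 : AdjoinRoot.mk p (evPoly c μ) *
        AdjoinRoot.mk p (evCopoly c μ ^ (i + 1) * evPoly c μ ^ (d - (i + 1)) * q) =
        AdjoinRoot.mk p (evCopoly c μ) *
        AdjoinRoot.mk p (evCopoly c μ ^ i * evPoly c μ ^ (d - i) * q) := by
      rw [← map_mul, ← map_mul, show d - i = d - (i + 1) + 1 by omega]
      congr 1
      ring
    exact (polyMod_localAt_a c hp μ _).trans (h1.trans (polyMod_localAt_b c hp μ _).symm)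

open Polynomial in
theorem iso_polyMod (c : ℂ) {p : ℂ[X]} (hp : p ≠ 0) {ek : List (Option ℂ × ℕ)}
    (hnd : (ek.map Prod.fst).Nodup) (hpos : ∀ x ∈ ek, 1 ≤ x.2)
    (hdeg : p.natDegree = (ek.map Prod.snd).sum) (hc : some c ∉ ek.map Prod.fst)
    (hdvd : ∀ x ∈ ek, evPoly c x.1 ^ x.2 ∣ p) :
    Iso (polyMod c hp) (sum (ek.map fun x => Eb x.1 x.2)) := by
  have hne : ∀ x ∈ ek, x.1 ≠ some c := fun x hx h => hc (h ▸ List.mem_map_of_mem hx)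
  have hfr := (finrank_adjoinRoot hp).trans hdeg
  refine iso_sum_Eb hnd hfr hfr (c := some c) ?_ (fun x hx => ?_) fun x hx => ?_
  · have key : ∀ y : AdjoinRoot p, AdjoinRoot.mk p (evPoly c (some c)) * y = 0 → y = 0 := by
      intro y hy
      rwa [evPoly, sub_self, C_0, zero_mul, sub_zero, map_one, one_mul] at hy
    exact injective_of_zero _ fun y hy => key y ((polyMod_localAt_a _ _ _ _).symm.trans hy)
  · exact dimJ_polyMod_one_le c hp (hne x hx) ((dvd_pow_self _ (by have := hpos x hx; omega)).trans
      (hdvd x hx))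
  · exact le_dimJ_polyMod c hp (hne x hx) (hpos x hx) (hdvd x hx)

/-- A regular module all of whose eigenvalues have geometric multiplicity one degenerates to any
singular module with one block of each type. -/
theorem deg_Eb_L_LT {ek : List (Option ℂ × ℕ)} (hnd : (ek.map Prod.fst).Nodup)
    (hpos : ∀ x ∈ ek, 1 ≤ x.2) {t s : ℕ} (hk : (ek.map Prod.snd).sum = t + s + 1) :
    Deg (sum (ek.map fun x => Eb x.1 x.2)) ((blk (.L t)).prod (blk (.LT s))) := by
  obtain ⟨c, hc⟩ := Infinite.exists_notMem_finset
    ((ek.map Prod.fst).toFinset.preimage some (Option.some_injective _).injOn)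
  rw [Finset.mem_preimage, List.mem_toFinset] at hc
  have key : ∀ ek : List (Option ℂ × ℕ), some c ∉ ek.map Prod.fst →
      (ek.map fun x => evPoly c x.1 ^ x.2).prod ≠ 0 ∧
      (ek.map fun x => evPoly c x.1 ^ x.2).prod.natDegree = (ek.map Prod.snd).sum := by
    intro ek hc
    induction ek with
    | nil => simp
    | cons x ek ih =>
      rw [List.map_cons, List.mem_cons, not_or] at hc
      obtain ⟨ih1, ih2⟩ := ih hc.2
      have h0 := pow_ne_zero x.2 (evPoly_ne_zero c x.1)
      simp only [List.map_cons, List.prod_cons, List.sum_cons]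
      refine ⟨mul_ne_zero h0 ih1, ?_⟩
      rw [Polynomial.natDegree_mul h0 ih1, ih2, Polynomial.natDegree_pow,
        natDegree_evPoly (Ne.symm hc.1), mul_one]
  obtain ⟨h0, hdeg⟩ := key ek hc
  exact (deg_polyMod c h0 (hdeg.trans hk)).of_iso (iso_polyMod c h0 hnd hpos hdeg hc fun x hx =>
    List.dvd_prod (List.mem_map_of_mem hx)) (Iso.refl _)

end KMod

/-! ### Every coin move is a degeneration -/

/-- The direct sum of the blocks of one multiset degenerates to that of the other. -/
def DegS (s1 s2 : Multiset KBlock) : Prop :=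
  KMod.Deg (KMod.sum s1.toList) (KMod.sum s2.toList)

theorem SameData.symm {s s' : Multiset KBlock} (h : SameData s s') : SameData s' s :=
  ⟨h.1.symm, h.2.1.symm, fun μ => (h.2.2 μ).symm⟩

theorem KMod.iso_toList {l : List KBlock} {s : Multiset KBlock} (h : SameData s l) :
    KMod.Iso (KMod.sum s.toList) (KMod.sum l) :=
  KMod.iso_of_sameData (by rwa [Multiset.coe_toList])

theorem KMod.dual_toList_iso (s : Multiset KBlock) :
    KMod.Iso (KMod.sum (s.map dualBlock).toList) (KMod.sum s.toList).dual := by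
  refine (KMod.sum_perm_iso ?_).trans (KMod.dual_sum_iso _)
  rw [← Multiset.coe_eq_coe, Multiset.coe_toList, ← Multiset.map_coe, Multiset.coe_toList]

theorem DegS.of_dual {s1 s2 : Multiset KBlock} (h : DegS (s1.map dualBlock) (s2.map dualBlock)) :
    DegS s1 s2 := by
  have := (h.of_iso (KMod.dual_toList_iso s1) (KMod.dual_toList_iso s2)).dual
  exact this.of_iso (KMod.dual_dual_iso _).symm (KMod.dual_dual_iso _).symm

theorem DegS.trans {s1 s2 s3 : Multiset KBlock} (h : DegS s1 s2) (h' : DegS s2 s3) : DegS s1 s3 :=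
  KMod.Deg.trans h h'

theorem SameData.degS {s s' : Multiset KBlock} (h : SameData s s') : DegS s s' :=
  (KMod.Deg.refl _).of_iso (KMod.Iso.refl _) (KMod.iso_toList (by rwa [Multiset.coe_toList]))

theorem degS_of_step {s1 s2 t : Multiset KBlock} {l l' : List KBlock}
    (h : KMod.Deg (KMod.sum l) (KMod.sum l')) (h1 : SameData s1 (l + t))
    (h2 : SameData s2 (l' + t)) :
    DegS s1 s2 := by
  have key : ∀ {s : Multiset KBlock} {l : List KBlock}, SameData s (l + t) →
      KMod.Iso ((KMod.sum l).prod (KMod.sum t.toList)) (KMod.sum s.toList) := by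
    intro s l h
    refine ((KMod.iso_toList ?_).trans (KMod.sum_append_iso _ _)).symm
    rwa [← Multiset.coe_add, Multiset.coe_toList]
  exact (h.prod_right (KMod.sum t.toList)).of_iso (key h1) (key h2)

theorem KMod.sum_pair_iso (b b' : KBlock) :
    KMod.Iso ((KMod.blk b).prod (KMod.blk b')) (KMod.sum [b, b']) :=
  ((KMod.sum_singleton_iso b).symm.prod (KMod.sum_singleton_iso b').symm).trans
    (KMod.sum_append_iso [b] [b']).symm

theorem degS_of_pair {s1 s2 t : Multiset KBlock} {b b' e e' : KBlock}
    (h : KMod.Deg ((KMod.blk b).prod (KMod.blk b')) ((KMod.blk e).prod (KMod.blk e')))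
    (h1 : SameData s1 (b ::ₘ b' ::ₘ t)) (h2 : SameData s2 (e ::ₘ e' ::ₘ t)) : DegS s1 s2 := by
  refine degS_of_step (l := [b, b']) (l' := [e, e']) (t := t)
    (h.of_iso (KMod.sum_pair_iso _ _) (KMod.sum_pair_iso _ _)) ?_ ?_
  · simpa [← Multiset.cons_coe] using h1
  · simpa [← Multiset.cons_coe] using h2

theorem rPart_add (s t : Multiset KBlock) : rPart (s + t) = rPart s + rPart t := by
  funext i
  simp [rPart, rW, Multiset.filter_add]

theorem lPart_add (s t : Multiset KBlock) : lPart (s + t) = lPart s + lPart t := by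
  funext i
  simp [lPart, lW, Multiset.filter_add]

theorem jPart_add (s t : Multiset KBlock) (μ : Option ℂ) :
    jPart (s + t) μ = jPart s μ + jPart t μ := by
  funext i
  simp [jPart, jW, Multiset.filter_add]

theorem mem_of_rPart_lt {s : Multiset KBlock} {i : ℕ} (h : rPart s (i + 1) < rPart s i) :
    .L i ∈ s := by
  rw [rPart_eq_count s i] at h
  exact Multiset.count_pos.1 (by omega)

theorem mem_of_jPart_lt {s : Multiset KBlock} {μ : Option ℂ} {i : ℕ}
    (h : jPart s μ (i + 1) < jPart s μ i) : Eb μ (i + 1) ∈ s := by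
  rw [jPart_eq_count s μ i] at h
  exact Multiset.count_pos.1 (by omega)

theorem lPart_cons_L (a : ℕ) (s : Multiset KBlock) : lPart (.L a ::ₘ s) = lPart s :=
  lPart_cons_of_ne (fun _ h => by cases h) s

theorem rPart_cons_LT (a : ℕ) (s : Multiset KBlock) : rPart (.LT a ::ₘ s) = rPart s :=
  rPart_cons_of_ne (fun _ h => by cases h) s

theorem jPart_cons_L (a : ℕ) (s : Multiset KBlock) (μ : Option ℂ) :
    jPart (.L a ::ₘ s) μ = jPart s μ :=
  jPart_cons_of_ne (fun _ h => Eb_ne_L _ _ _ h.symm) s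

theorem jPart_cons_LT (a : ℕ) (s : Multiset KBlock) (μ : Option ℂ) :
    jPart (.LT a ::ₘ s) μ = jPart s μ :=
  jPart_cons_of_ne (fun _ h => Eb_ne_LT _ _ _ h.symm) s

theorem rPart_cons_Eb (ν : Option ℂ) (a : ℕ) (s : Multiset KBlock) :
    rPart (Eb ν a ::ₘ s) = rPart s :=
  rPart_cons_of_ne (fun _ => Eb_ne_L _ _ _) s

theorem lPart_cons_Eb (ν : Option ℂ) (a : ℕ) (s : Multiset KBlock) :
    lPart (Eb ν a ::ₘ s) = lPart s :=
  lPart_cons_of_ne (fun _ => Eb_ne_LT _ _ _) s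

theorem jPart_cons_Eb_of_ne {μ ν : Option ℂ} (h : μ ≠ ν) (a : ℕ) (s : Multiset KBlock) :
    jPart (Eb ν a ::ₘ s) μ = jPart s μ :=
  jPart_cons_of_ne (fun _ h' => h (Eb_injective h').1.symm) s

/-- A coin move to the right, away from the first column, of the partition `R`. -/
def StepR (s1 s2 : Multiset KBlock) : Prop :=
  ∃ j, 1 ≤ j ∧ MinRightCoinMove (rPart s1) (rPart s2) j ∧
    lPart s2 = lPart s1 ∧ ∀ μ, jPart s2 μ = jPart s1 μ

/-- The last coin of the partition `R` moves to the first row of some `J_μ`. -/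
def StepRJ (s1 s2 : Multiset KBlock) : Prop :=
  ∃ (c : ℕ) (μ : Option ℂ) (d : ℕ), 1 ≤ c ∧
    rPart s1 c = 1 ∧ (∀ i, c < i → rPart s1 i = 0) ∧
    rPart s2 = Function.update (rPart s1) c 0 ∧
    jPart s1 μ d = 0 ∧ (∀ i, i < d → 1 ≤ jPart s1 μ i) ∧
    jPart s2 μ = Function.update (jPart s1 μ) d 1 ∧
    (∀ ν, ν ≠ μ → jPart s2 ν = jPart s1 ν) ∧
    lPart s2 = lPart s1

theorem StepR.degS {s1 s2 : Multiset KBlock} (h : StepR s1 s2) : DegS s1 s2 := by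
  obtain ⟨j, hj, ⟨⟨k, hjk, h1, h2, h3⟩, ⟨hq, -⟩, -⟩, hl, hJ⟩ := h
  obtain ⟨j, rfl⟩ : ∃ i, j = i + 1 := ⟨j - 1, by omega⟩
  obtain ⟨k, rfl⟩ : ∃ i, k = i + 1 := ⟨k - 1, by omega⟩
  have hp : ∀ i, rPart s1 (i + 1) ≤ rPart s1 i := (isPartitionFun_rPart s1).1
  have ha : rPart s1 (j + 1 + 1) < rPart s1 (j + 1) := by
    have := hq (j + 1)
    rcases eq_or_ne (j + 1 + 1) (k + 1) with e | e
    · rw [e] at this ⊢; omega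
    · rw [h3 (j + 1 + 1) (by omega) e] at this; omega
  obtain ⟨t, rfl⟩ := Multiset.exists_cons_of_mem (mem_of_rPart_lt ha)
  have hb : rPart t (k + 1) < rPart t k := by
    have := hq k
    rw [rPart_cons_L] at h1 h2 h3
    rcases eq_or_ne (j + 1) k with rfl | e
    · simp only [ite_true, show ¬ j + 1 + 1 < j + 1 + 1 by omega, show j + 1 < j + 1 + 1 by omega,
        if_false] at h1 h2
      omega
    · rw [h3 k (Ne.symm e) (by omega)] at this
      simp only [show ¬ k + 1 < j + 1 + 1 by omega, if_false] at this h2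
      split_ifs at this <;> omega
  obtain ⟨t, rfl⟩ := Multiset.exists_cons_of_mem (mem_of_rPart_lt hb)
  refine degS_of_pair (t := t) (KMod.deg_L_L (show j ≤ k by omega)) ⟨rfl, rfl, fun _ => rfl⟩
    ⟨funext fun i => ?_, ?_, fun μ => ?_⟩
  · simp only [rPart_cons_L] at h1 h2 h3 ⊢
    rcases eq_or_ne i (j + 1) with rfl | e1
    · split_ifs at h1 ⊢ <;> omega
    rcases eq_or_ne i (k + 1) with rfl | e2
    · split_ifs at h2 ⊢ <;> omega
    rw [h3 i e1 e2]
    split_ifs <;> omega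
  · simp only [hl, lPart_cons_L]
  · simp only [hJ, jPart_cons_L]

theorem StepRJ.degS {s1 s2 : Multiset KBlock} (h : StepRJ s1 s2) : DegS s1 s2 := by
  obtain ⟨c, μ, d, hc, h1, h2, h3, h4, h5, h6, h7, h8⟩ := h
  obtain ⟨c, rfl⟩ : ∃ i, c = i + 1 := ⟨c - 1, by omega⟩
  obtain ⟨t, rfl⟩ := Multiset.exists_cons_of_mem (mem_of_rPart_lt (s := s1) (i := c + 1) (by
    rw [h1, h2 _ (by omega)]; exact one_pos))
  obtain ⟨t', ht'⟩ : ∃ t', SameData t (Eb μ d ::ₘ t') := by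
    rcases d with _ | d
    · refine ⟨t, (rPart_cons_Eb _ _ _).symm, (lPart_cons_Eb _ _ _).symm, fun ν => ?_⟩
      rcases eq_or_ne ν μ with rfl | e
      · rw [jPart_cons_Eb]; simp
      · rw [jPart_cons_Eb_of_ne e]
    · have h9 := h5 d (by omega)
      rw [jPart_cons_L] at h9 h4
      obtain ⟨t', rfl⟩ := Multiset.exists_cons_of_mem
        (mem_of_jPart_lt (s := t) (μ := μ) (i := d) (by omega))
      exact ⟨t', rfl, rfl, fun _ => rfl⟩
  have hR := ht'.1
  have hJ := ht'.2.2
  rw [rPart_cons_Eb] at hR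
  refine degS_of_pair (t := t') (KMod.deg_L_Eb c d μ) ⟨?_, ?_, fun ν => ?_⟩
    ⟨funext fun i => ?_, ?_, fun ν => ?_⟩
  · rw [rPart_cons_L, rPart_cons_L, ht'.1]
  · rw [lPart_cons_L, lPart_cons_L, ht'.2.1]
  · rw [jPart_cons_L, jPart_cons_L, hJ]
  · simp only [h3, rPart_cons_L, rPart_cons_Eb, hR] at h1 ⊢
    rcases eq_or_ne i (c + 1) with rfl | e
    · rw [Function.update_self]
      split_ifs at h1 ⊢ <;> omega
    · rw [Function.update_of_ne e]
      split_ifs <;> omega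
  · rw [h8, lPart_cons_L, lPart_cons_L, lPart_cons_Eb, ht'.2.1, lPart_cons_Eb]
  · rcases eq_or_ne ν μ with rfl | e
    · rw [jPart_cons_L, hJ, jPart_cons_Eb] at h6 h4
      rw [h6, jPart_cons_L, jPart_cons_Eb]
      funext i
      simp only at h4
      rcases eq_or_ne i d with rfl | e
      · rw [Function.update_self]
        split_ifs at h4 ⊢ <;> omega
      · rw [Function.update_of_ne e]
        split_ifs <;> omega
    · rw [h7 ν e, jPart_cons_L, jPart_cons_L, hJ, jPart_cons_Eb_of_ne e, jPart_cons_Eb_of_ne e]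

theorem RuleC3.degS {s1 s2 : Multiset KBlock} (h : RuleC3 s1 s2) : DegS s1 s2 := by
  obtain ⟨μ, ⟨j, ⟨k, hjk, h1, h2, h3⟩, -, -⟩, h4, h5, h6⟩ := h
  have hp : ∀ i, jPart s2 μ (i + 1) ≤ jPart s2 μ i := (isPartitionFun_jPart s2 μ).1
  have ha : jPart s1 μ (k + 1) < jPart s1 μ k := by
    have := hp k
    rw [h3 (k + 1) (by omega) (by omega)]
    omega
  obtain ⟨t, rfl⟩ := Multiset.exists_cons_of_mem (mem_of_jPart_lt ha)
  rw [jPart_cons_Eb] at h1 h2 h3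
  simp only at h1 h2 h3
  obtain ⟨t', ht'⟩ : ∃ t', SameData t (Eb μ j ::ₘ t') := by
    rcases j with _ | j
    · refine ⟨t, (rPart_cons_Eb _ _ _).symm, (lPart_cons_Eb _ _ _).symm, fun ν => ?_⟩
      rcases eq_or_ne ν μ with rfl | e
      · rw [jPart_cons_Eb]; simp
      · rw [jPart_cons_Eb_of_ne e]
    · have h7 := hp j
      have h8 := h3 j (by omega) (by omega)
      have hb : jPart t μ (j + 1) < jPart t μ j := by split_ifs at h1 h8 <;> omega
      obtain ⟨t', rfl⟩ := Multiset.exists_cons_of_mem (mem_of_jPart_lt hb)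
      exact ⟨t', rfl, rfl, fun _ => rfl⟩
  have hJ := ht'.2.2
  have hJμ := hJ μ
  rw [jPart_cons_Eb] at hJμ
  refine degS_of_pair (t := t') ((KMod.deg_Eb_Eb (show j ≤ k by omega) μ)) ⟨?_, ?_, fun ν => ?_⟩
    ⟨?_, ?_, fun ν => ?_⟩
  · simp only [rPart_cons_Eb, ht'.1]
  · simp only [lPart_cons_Eb, ht'.2.1]
  · rcases eq_or_ne ν μ with rfl | e
    · simp only [jPart_cons_Eb, hJμ]
      funext i
      omega
    · simp only [jPart_cons_Eb_of_ne e, hJ]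
  · simp only [h5, rPart_cons_Eb, ht'.1]
  · simp only [h6, lPart_cons_Eb, ht'.2.1]
  · rcases eq_or_ne ν μ with rfl | e
    · simp only [jPart_cons_Eb]
      rw [hJμ] at h1 h2 h3
      simp only at h1 h2 h3
      funext i
      rcases eq_or_ne i j with rfl | e1
      · split_ifs at h1 ⊢ <;> omega
      rcases eq_or_ne i k with rfl | e2
      · split_ifs at h2 ⊢ <;> omega
      have := h3 i e1 e2
      split_ifs at this ⊢ <;> omega
    · simp only [h4 ν e, jPart_cons_Eb_of_ne e, hJ]

theorem RuleC4.degS {s1 s2 : Multiset KBlock} (h : RuleC4 s1 s2) : DegS s1 s2 := by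
  obtain ⟨ek, t, hnd, hek, hall, h⟩ := h
  simp only at h
  obtain ⟨htk, hJ, hR, hL, -, -⟩ := h
  have hle : ((ek.map fun x => Eb x.1 x.2 : List KBlock) : Multiset KBlock) ≤ s1 := by
    rw [Multiset.le_iff_subset]
    · intro b hb
      rw [Multiset.mem_coe, List.mem_map] at hb
      obtain ⟨x, hx, rfl⟩ := hb
      obtain ⟨h1, h2, h3⟩ := hek x hx
      have := mem_of_jPart_lt (s := s1) (μ := x.1) (i := x.2 - 1) (by
        rw [h3 _ (by omega)]; omega)
      rwa [Nat.sub_add_cancel h1] at this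
    · rw [Multiset.coe_nodup]
      refine (List.nodup_map_iff_inj_on (List.Nodup.of_map _ hnd)).2 fun x hx y hy h => ?_
      exact Prod.ext (Eb_injective h).1 (Eb_injective h).2
  obtain ⟨u, rfl⟩ := Multiset.le_iff_exists_add.1 hle
  obtain ⟨hE1, hE2⟩ := KMod.jPart_map_Eb hnd
  obtain ⟨hER, hEL⟩ := KMod.parts_map_Eb ek
  simp only [rPart_add, lPart_add, hER, hEL, zero_add] at hR hL
  simp only [jPart_add] at hJ
  refine degS_of_step (l' := [.L t, .LT ((ek.map Prod.snd).sum - t - 1)]) (t := u)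
    ((KMod.deg_Eb_L_LT hnd (fun x hx => (hek x hx).1) (by omega)).of_iso (KMod.Iso.refl _)
      (KMod.sum_pair_iso _ _)) ⟨rfl, rfl, fun _ => rfl⟩ ?_
  have hcons : (([.L t, .LT ((ek.map Prod.snd).sum - t - 1)] : List KBlock) : Multiset KBlock) + u =
      .L t ::ₘ .LT ((ek.map Prod.snd).sum - t - 1) ::ₘ u := by
    simp [← Multiset.cons_coe]
  rw [hcons]
  refine ⟨funext fun i => ?_, funext fun i => ?_, fun ν => funext fun i => ?_⟩
  · rw [hR, rPart_cons_L, rPart_cons_LT]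
    simp only
    split_ifs <;> omega
  · rw [hL, lPart_cons_L, lPart_cons_LT]
    simp only
    split_ifs <;> omega
  · rw [hJ, jPart_cons_L, jPart_cons_LT]
    by_cases hν : ν ∈ ek.map Prod.fst
    · obtain ⟨x, hx, rfl⟩ := List.mem_map.1 hν
      have h1 := (hek x hx).2.2 i
      rw [jPart_add] at h1
      simp only [Pi.add_apply, hE1 x hx] at h1 ⊢
      split_ifs at h1 ⊢ <;> omega
    · have h1 := jPart_eq_zero_of_zero (not_imp_comm.1 (hall ν) hν)
      have h2 := h1 i
      rw [jPart_add] at h2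
      simp only [Pi.add_apply] at h2 ⊢
      omega

/-! ### Partitions and the dominance order -/

theorem psum_mono (p : ℕ → ℕ) : Monotone (psum p) :=
  monotone_nat_of_le_succ fun k => by rw [psum_succ]; omega

theorem psum_eq_of_le {p : ℕ → ℕ} {n : ℕ} (hp : ∀ i, n ≤ i → p i = 0) {k : ℕ} (hk : n ≤ k) :
    psum p k = psum p n := by
  induction k, hk using Nat.le_induction with
  | base => rfl
  | succ k hk ih => rw [psum_succ, hp k hk, ih, add_zero]

theorem psum_ext {p q : ℕ → ℕ} (h : ∀ k, psum p k = psum q k) : p = q := by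
  funext i
  have h1 := h (i + 1)
  rw [psum_succ, psum_succ, h i] at h1
  omega

theorem psum_le_of_tail {p : ℕ → ℕ} {n : ℕ} (hp : ∀ i, n ≤ i → p i = 0) (k : ℕ) :
    psum p k ≤ psum p n := by
  rcases le_total n k with h | h
  · exact (psum_eq_of_le hp h).le
  · exact psum_mono p h

theorem Dominates.trans {p q r : ℕ → ℕ} (h : Dominates p q) (h' : Dominates q r) :
    Dominates p r := by
  obtain ⟨h1, N, hN⟩ := h
  obtain ⟨h2, M, hM⟩ := h'
  exact ⟨fun m => (h2 m).trans (h1 m), max N M, fun m hm =>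
    (hN m ((le_max_left _ _).trans hm)).trans (hM m ((le_max_right _ _).trans hm))⟩

theorem CoinMoveRight.psum_eq {p q : ℕ → ℕ} {j k : ℕ} (hjk : j < k) (h1 : q j + 1 = p j)
    (h2 : q k = p k + 1) (h3 : ∀ i, i ≠ j → i ≠ k → q i = p i) (m : ℕ) :
    psum p m = psum q m + if j < m ∧ m ≤ k then 1 else 0 := by
  induction m with
  | zero => simp [psum_zero]
  | succ m ih =>
    rw [psum_succ, psum_succ, ih]
    rcases eq_or_ne m j with rfl | e1
    · split_ifs <;> omega
    rcases eq_or_ne m k with rfl | e2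
    · split_ifs <;> omega
    rw [h3 m e1 e2]
    split_ifs <;> omega

theorem CoinMoveRight.dominates {p q : ℕ → ℕ} {j : ℕ} (h : CoinMoveRight p q j) :
    Dominates p q := by
  obtain ⟨k, hjk, h1, h2, h3⟩ := h
  have key := CoinMoveRight.psum_eq hjk h1 h2 h3
  refine ⟨fun m => ?_, k + 1, fun m hm => ?_⟩
  · rw [key m]
    omega
  · rw [key m, if_neg (by omega), add_zero]

theorem CoinMoveRight.ne {p q : ℕ → ℕ} {j : ℕ} (h : CoinMoveRight p q j) : p ≠ q := by
  obtain ⟨k, hjk, h1, h2, h3⟩ := h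
  rintro rfl
  omega

theorem exists_leftMove {p q : ℕ → ℕ} (hp : IsPartitionFun p) (hq : IsPartitionFun q)
    (h : Dominates q p) (hne : q ≠ p) :
    ∃ r, IsPartitionFun r ∧ Dominates q r ∧ ∃ j, CoinMoveRight r p j := by
  have hex : ∃ i, q i ≠ p i := Function.ne_iff.1 hne
  obtain ⟨a, ha, hlt⟩ : ∃ a, q a ≠ p a ∧ ∀ i < a, q i = p i :=
    ⟨Nat.find hex, Nat.find_spec hex, fun i hi => not_not.1 (Nat.find_min hex hi)⟩
  have hpa : psum q a = psum p a :=
    Finset.sum_congr rfl fun i hi => hlt i (Finset.mem_range.1 hi)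
  have ha' : p a < q a := by
    have := h.1 (a + 1)
    rw [psum_succ, psum_succ, hpa] at this
    omega
  obtain ⟨N, hN⟩ := h.2
  have hex' : ∃ m, a < m ∧ psum q m = psum p m := ⟨a + 1 + N, by omega, hN _ (by omega)⟩
  obtain ⟨b, hab, hb, hbm⟩ : ∃ b, a < b ∧ psum q (b + 1) = psum p (b + 1) ∧
      ∀ m, a < m → m ≤ b → psum p m < psum q m := by
    obtain ⟨h1, h2⟩ := Nat.find_spec hex'
    have h4 : Nat.find hex' ≠ a + 1 := by
      intro h4
      rw [h4, psum_succ, psum_succ] at h2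
      omega
    obtain ⟨b, hb⟩ : ∃ b, Nat.find hex' = b + 1 := ⟨Nat.find hex' - 1, by omega⟩
    refine ⟨b, by omega, hb ▸ h2, fun m hm hmb => lt_of_le_of_ne (h.1 m) fun h5 => ?_⟩
    exact Nat.find_min hex' (m := m) (by omega) ⟨hm, h5.symm⟩
  have hqb : q b < p b := by
    have := hbm b hab le_rfl
    rw [psum_succ, psum_succ] at hb
    omega
  have hb1 : p (b + 1) < p b := by
    have h1 := hq.1 b
    have h2 := hp.1 b
    have h3 := h.1 (b + 1 + 1)
    rw [psum_succ _ (b + 1), psum_succ _ (b + 1), hb] at h3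
    omega
  let r : ℕ → ℕ := fun i => if i = a then p a + 1 else if i = b then p b - 1 else p i
  have hra : r a = p a + 1 := if_pos rfl
  have hrb : r b = p b - 1 := (if_neg hab.ne').trans (if_pos rfl)
  have hr : ∀ i, i ≠ a → i ≠ b → r i = p i := fun i h1 h2 => (if_neg h1).trans (if_neg h2)
  have hmove : CoinMoveRight r p a :=
    ⟨b, hab, hra.symm, by omega, fun i h1 h2 => (hr i h1 h2).symm⟩
  have hps := CoinMoveRight.psum_eq hab hra.symm (show p b = r b + 1 by omega)
    fun i h1 h2 => (hr i h1 h2).symm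
  refine ⟨r, ⟨fun i => ?_, ?_⟩, ⟨fun m => ?_, ?_⟩, a, hmove⟩
  · have h1 := hp.1 i
    rcases eq_or_ne i a with rfl | e1
    · rcases eq_or_ne (i + 1) b with rfl | e2
      · omega
      · rw [hr (i + 1) (by omega) e2]; omega
    rcases eq_or_ne i b with rfl | e2
    · rw [hr (i + 1) (by omega) (by omega)]; omega
    rw [hr i e1 e2]
    rcases eq_or_ne (i + 1) a with rfl | e3
    · have := hlt i (by omega)
      have := hq.1 i
      omega
    rcases eq_or_ne (i + 1) b with rfl | e4
    · omega
    rw [hr (i + 1) e3 e4]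
    exact h1
  · obtain ⟨M, hM⟩ := hp.2
    refine ⟨M + b + 1, fun i hi => ?_⟩
    rw [hr i (by omega) (by omega)]
    exact hM i (by omega)
  · have := h.1 m
    rw [hps]
    split_ifs with h1
    · exact hbm m h1.1 h1.2
    · exact this
  · refine ⟨N + b + 1, fun m hm => ?_⟩
    rw [hps, if_neg (by omega)]
    exact hN m (by omega)

theorem eq_of_sum_psum_le {p q r r' : ℕ → ℕ} {N : ℕ} (hN : ∀ m, N ≤ m → psum p m = psum q m)
    (h1 : Dominates p r') (h2 : Dominates r' r) (h3 : Dominates r q)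
    (h : ∑ m ∈ Finset.range N, psum r' m ≤ ∑ m ∈ Finset.range N, psum r m) : r' = r := by
  refine psum_ext fun m => ?_
  rcases lt_or_ge m N with hm | hm
  · have h4 : ∑ m ∈ Finset.range N, psum r m = ∑ m ∈ Finset.range N, psum r' m :=
      le_antisymm (Finset.sum_le_sum fun m _ => h2.1 m) h
    exact ((Finset.sum_eq_sum_iff_of_le fun m _ => h2.1 m).1 h4 m (Finset.mem_range.2 hm)).symm
  · have := hN m hm
    have := h1.1 m
    have := h2.1 m
    have := h3.1 m
    omega

theorem Dominates.refl (p : ℕ → ℕ) : Dominates p p := ⟨fun _ => le_rfl, 0, fun _ _ => rfl⟩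

theorem exists_min_of_nonempty {α : Type*} (f : α → ℕ) {S : Set α} (hS : S.Nonempty) :
    ∃ a ∈ S, ∀ b ∈ S, f a ≤ f b :=
  ⟨Function.argminOn f S hS, Function.argminOn_mem f S hS,
    fun _ hb => Function.argminOn_le f S hb⟩

theorem exists_minRightCoinMove {p q : ℕ → ℕ} (hp : IsPartitionFun p) (hq : IsPartitionFun q)
    (h : Dominates p q) (hne : p ≠ q) : ∃ r j, MinRightCoinMove p r j ∧ Dominates r q := by
  obtain ⟨N, hN⟩ := h.2
  let S : Set (ℕ → ℕ) := {r | IsPartitionFun r ∧ Dominates p r ∧ Dominates r q ∧ r ≠ p}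
  have hbdd : ∀ r ∈ S, ∑ m ∈ Finset.range N, psum r m ≤ ∑ m ∈ Finset.range N, psum p m :=
    fun r hr => Finset.sum_le_sum fun m _ => hr.2.1.1 m
  obtain ⟨r, ⟨hr1, hr2, hr3, hr4⟩, hmin⟩ := exists_min_of_nonempty (fun r =>
    ∑ m ∈ Finset.range N, psum p m - ∑ m ∈ Finset.range N, psum r m)
    (⟨q, hq, h, Dominates.refl q, hne.symm⟩ : S.Nonempty)
  have hcov : ∀ s, IsPartitionFun s → Dominates p s → Dominates s r → s = p ∨ s = r := by
    intro s hs h1 h2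
    by_contra! hs'
    have hsS : s ∈ S := ⟨hs, h1, h2.trans hr3, hs'.1⟩
    have h3 := hmin s hsS
    have h4 := hbdd s hsS
    have h5 := hbdd r ⟨hr1, hr2, hr3, hr4⟩
    exact hs'.2 (eq_of_sum_psum_le hN h1 h2 hr3 (by omega))
  obtain ⟨s, hs, hps, j, hj⟩ := exists_leftMove hr1 hp hr2 hr4.symm
  rcases hcov s hs hps hj.dominates with rfl | rfl
  · exact ⟨r, j, ⟨hj, hr1, hr2, hr4.symm, hcov⟩, hr3⟩
  · exact absurd rfl hj.ne

theorem exists_minLeftCoinMove {p q : ℕ → ℕ} (hp : IsPartitionFun p) (hq : IsPartitionFun q)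
    (h : Dominates p q) (hne : p ≠ q) :
    ∃ r, IsPartitionFun r ∧ MinLeftCoinMove q r ∧ Dominates p r := by
  obtain ⟨N, hN⟩ := h.2
  let S : Set (ℕ → ℕ) := {r | IsPartitionFun r ∧ Dominates p r ∧ Dominates r q ∧ r ≠ q}
  obtain ⟨r, ⟨hr1, hr2, hr3, hr4⟩, hmin⟩ := exists_min_of_nonempty
    (fun r => ∑ m ∈ Finset.range N, psum r m) (⟨p, hp, Dominates.refl p, h, hne⟩ : S.Nonempty)
  have hcov : ∀ s, IsPartitionFun s → Dominates r s → Dominates s q → s = r ∨ s = q := by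
    intro s hs h1 h2
    by_contra! hs'
    exact hs'.1 (eq_of_sum_psum_le hN hr2 h1 h2 (hmin s ⟨hs, hr2.trans h1, h2, hs'.2⟩)).symm
  obtain ⟨s, hs, hps, j, hj⟩ := exists_leftMove hq hr1 hr3 hr4
  rcases hcov s hs hps hj.dominates with rfl | rfl
  · exact ⟨s, hr1, ⟨j, hj, hq, hr3, hr4, hcov⟩, hr2⟩
  · exact absurd rfl hj.ne

theorem minRightCoinMove_last {p : ℕ → ℕ} (hp : IsPartitionFun p) {c : ℕ} (hc : 2 ≤ p c)
    (h0 : ∀ i, c < i → p i = 0) :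
    MinRightCoinMove p (Function.update (Function.update p c (p c - 1)) (c + 1) 1) c ∧
    ∀ m, psum p m =
      psum (Function.update (Function.update p c (p c - 1)) (c + 1) 1) m +
        if m = c + 1 then 1 else 0 := by
  set q := Function.update (Function.update p c (p c - 1)) (c + 1) 1 with hq
  have h1 : q c = p c - 1 := by
    rw [hq, Function.update_of_ne (by omega), Function.update_self]
  have h2 : q (c + 1) = 1 := Function.update_self _ _ _
  have h3 : ∀ i, i ≠ c → i ≠ c + 1 → q i = p i := fun i e1 e2 => by
    rw [hq, Function.update_of_ne e2, Function.update_of_ne e1]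
  have h4 := h0 (c + 1) (by omega)
  have hps : ∀ m, psum p m = psum q m + if m = c + 1 then 1 else 0 := by
    intro m
    rw [CoinMoveRight.psum_eq (Nat.lt_succ_self c) (show q c + 1 = p c by omega)
      (show q (c + 1) = p (c + 1) + 1 by omega) h3 m]
    congr 1
    exact if_congr (by omega) rfl rfl
  have hmove : CoinMoveRight p q c := ⟨c + 1, by omega, by omega, by omega, h3⟩
  refine ⟨⟨hmove, ⟨fun i => ?_, c + 2, fun i hi => ?_⟩, hmove.dominates, hmove.ne,
    fun r _ hr1 hr2 => ?_⟩, hps⟩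
  · have h5 := hp.1 i
    rcases eq_or_ne i c with rfl | e1
    · omega
    rcases eq_or_ne i (c + 1) with rfl | e2
    · rw [h3 (c + 1 + 1) (by omega) (by omega), h0 _ (by omega)]; omega
    rw [h3 i e1 e2]
    rcases eq_or_ne (i + 1) c with rfl | e3
    · omega
    rw [h3 (i + 1) e3 (by omega)]
    exact h5
  · rw [h3 i (by omega) (by omega), h0 _ (by omega)]
  · have key : ∀ m, m ≠ c + 1 → psum r m = psum p m ∧ psum r m = psum q m := by
      intro m hm
      have h5 := hps m
      rw [if_neg hm] at h5
      have := hr1.1 m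
      have := hr2.1 m
      omega
    have h5 := hps (c + 1)
    rw [if_pos rfl] at h5
    have h6 := hr1.1 (c + 1)
    have h7 := hr2.1 (c + 1)
    rcases eq_or_ne (psum r (c + 1)) (psum p (c + 1)) with e | e
    · left
      refine psum_ext fun m => ?_
      rcases eq_or_ne m (c + 1) with rfl | e'
      exacts [e, (key m e').1]
    · right
      refine psum_ext fun m => ?_
      rcases eq_or_ne m (c + 1) with rfl | e'
      exacts [by omega, (key m e').2]

theorem psum_update_of_zero {p : ℕ → ℕ} {d : ℕ} (h : p d = 0) (k : ℕ) :
    psum (Function.update p d 1) k = psum p k + if d < k then 1 else 0 := by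
  induction k with
  | zero => simp [psum_zero]
  | succ k ih =>
    rw [psum_succ, psum_succ, ih]
    rcases eq_or_ne k d with rfl | e
    · rw [Function.update_self]
      split_ifs <;> omega
    · rw [Function.update_of_ne e]
      split_ifs <;> omega

/-- Only two partitions lie between a partition and the same partition with one more column
consisting of a single coin. -/
theorem eq_or_eq_update {p r : ℕ → ℕ} {d : ℕ} (hr : IsPartitionFun r) (h0 : ∀ i, d ≤ i → p i = 0)
    (h1 : ∀ k, psum p k ≤ psum r k) (h2 : ∀ k, psum r k ≤ psum (Function.update p d 1) k) :
    r = p ∨ r = Function.update p d 1 := by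
  have h3 := psum_update_of_zero (h0 d le_rfl)
  simp only [h3] at h2
  have hd : psum r d = psum p d := by
    have h4 := h2 d
    have h5 := h1 d
    rw [if_neg (lt_irrefl d)] at h4
    omega
  have hlow : ∀ k, k ≤ d → psum r k = psum p k := by
    intro k hk
    have h4 := h2 k
    have h5 := h1 k
    rw [if_neg (by omega)] at h4
    omega
  have hanti : Antitone r := antitone_nat_of_succ_le hr.1
  rcases Nat.eq_zero_or_pos (r d) with e | e
  · left
    refine psum_ext fun k => ?_
    rcases le_total k d with hk | hk
    · exact hlow k hk
    · rw [psum_eq_of_le h0 hk, psum_eq_of_le (p := r) (n := d) (fun i hi => ?_) hk, hd]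
      have := hanti hi
      omega
  · right
    refine psum_ext fun k => ?_
    rw [h3]
    rcases le_or_gt k d with hk | hk
    · rw [if_neg (by omega), hlow k hk, add_zero]
    · have h4 := h2 k
      have h5 := psum_mono r (show d + 1 ≤ k from hk)
      rw [psum_succ] at h5
      have h6 := psum_eq_of_le h0 hk.le
      rw [if_pos hk] at h4 ⊢
      omega

theorem exists_length {p : ℕ → ℕ} (hp : IsPartitionFun p) :
    ∃ d, (∀ i, d ≤ i → p i = 0) ∧ ∀ i, i < d → 1 ≤ p i := by
  obtain ⟨N, hN⟩ := hp.2
  have hex : ∃ d, p d = 0 := ⟨N, hN N le_rfl⟩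
  refine ⟨Nat.find hex, fun i hi => ?_, fun i hi => ?_⟩
  · have := antitone_nat_of_succ_le hp.1 hi
    rw [Nat.find_spec hex] at this
    omega
  · exact Nat.one_le_iff_ne_zero.2 (Nat.find_min hex hi)

theorem exists_last_or_bound {p q : ℕ → ℕ} (hp : IsPartitionFun p) (hq : IsPartitionFun q) {e : ℕ}
    (h0 : q 0 = p 0 + (e + 1)) (h : ∀ k, psum q k ≤ psum p k + k * (e + 1)) :
    (∃ c, 1 ≤ c ∧ 1 ≤ p c ∧ (∀ i, c < i → p i = 0) ∧
      ∀ k, c < k → psum q k + 1 ≤ psum p k + k * (e + 1)) ∨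
    ∃ T x, T ≤ x ∧ (∀ i, p i ≠ 0 → i ≤ T) ∧
      (∀ T', T ≤ T' → ∀ k, psum q k ≤ psum p k + min k (T' + 1) + k * e) ∧
      ∃ M, ∀ N, M ≤ N → T + psum p N + (e + 1) + x * e ≤ psum q N := by
  obtain ⟨n, hn0, hn1⟩ := exists_length hp
  obtain ⟨n', hn'0, -⟩ := exists_length hq
  obtain ⟨x, hx⟩ : ∃ x : ℕ, ∀ y : ℕ,
      (psum q (y + 1) : ℤ) - y * e ≤ psum q (x + 1) - x * e := by
    obtain ⟨x, -, hx⟩ := Finset.exists_max_image (Finset.range (n' + 1))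
      (fun y : ℕ => (psum q (y + 1) : ℤ) - y * e) ⟨0, by simp⟩
    refine ⟨x, fun y => ?_⟩
    rcases lt_or_ge y (n' + 1) with hy | hy
    · exact hx y (Finset.mem_range.2 hy)
    · refine le_trans ?_ (hx n' (by simp))
      rw [psum_eq_of_le hn'0 (show n' ≤ y + 1 by omega),
        psum_eq_of_le hn'0 (show n' ≤ n' + 1 by omega)]
      have : (n' : ℤ) * e ≤ y * e :=
        mul_le_mul_of_nonneg_right (by exact_mod_cast (by omega : n' ≤ y)) (by positivity)
      linarith
  have htot : ∀ k, n ≤ k → psum p k = psum p n := fun k hk => psum_eq_of_le hn0 hk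
  by_cases hbig : (n : ℤ) ≤ psum q (x + 1) - x * e - psum p n - (e + 1) + 1 ∨ n ≤ 1
  · right
    have hT : (0 : ℤ) ≤ psum q (x + 1) - x * e - psum p n - (e + 1) := by
      rcases Nat.eq_zero_or_pos n with hn | hn
      · have h1 := hx 0
        have h2 : psum p n ≤ p 0 := by rw [hn, psum_zero]; omega
        rw [zero_add, psum_succ, psum_zero, h0] at h1
        push_cast at h1
        have : (psum p n : ℤ) ≤ p 0 := by exact_mod_cast h2
        linarith
      · rcases hbig with h1 | h1
        · have : (1 : ℤ) ≤ n := by exact_mod_cast hn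
          linarith
        · obtain rfl : n = 1 := by omega
          have h2 := hx 0
          rw [zero_add, psum_succ, psum_zero, h0] at h2
          have h3 : psum p 1 = p 0 := by rw [psum_succ, psum_zero, zero_add]
          rw [h3]
          push_cast at h2
          linarith
    obtain ⟨T, hT'⟩ := Int.eq_ofNat_of_zero_le hT
    have hTx : T ≤ x := by
      have h1 : (psum q (x + 1) : ℤ) ≤ psum p (x + 1) + (x + 1) * (e + 1) := by
        exact_mod_cast h (x + 1)
      have h2 : (psum p (x + 1) : ℤ) ≤ psum p n := by exact_mod_cast psum_le_of_tail hn0 _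
      have : (T : ℤ) ≤ x := by linarith
      exact_mod_cast this
    have hnT : n ≤ T + 1 := by
      rcases hbig with h1 | h1
      · have : (n : ℤ) ≤ T + 1 := by linarith
        exact_mod_cast this
      · omega
    refine ⟨T, x, hTx, fun i hi => ?_, fun T' hTT' k => ?_, n + n' + x + 1, fun N hN => ?_⟩
    · by_contra hi'
      exact hi (hn0 i (by omega))
    · rcases le_or_gt k (T' + 1) with hk | hk
      · rw [min_eq_left hk, add_assoc, show k + k * e = k * (e + 1) by ring]
        exact h k
      · obtain ⟨y, rfl⟩ : ∃ y, k = y + 1 := ⟨k - 1, by omega⟩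
        rw [min_eq_right hk.le, htot (y + 1) (by omega)]
        have h1 := hx y
        have h2 : (T : ℤ) ≤ T' := by exact_mod_cast hTT'
        have : (psum q (y + 1) : ℤ) ≤ psum p n + (T' + 1) + (y + 1) * e := by linarith
        exact_mod_cast this
    · have h1 : (psum q (x + 1) : ℤ) ≤ psum q N := by exact_mod_cast psum_mono q (by omega)
      rw [htot N (by omega)]
      have : (T : ℤ) + psum p n + (e + 1) + x * e ≤ psum q N := by linarith
      exact_mod_cast this
  · left
    rw [not_or, not_le, not_le] at hbig
    obtain ⟨hb, hn⟩ := hbig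
    refine ⟨n - 1, by omega, hn1 _ (by omega), fun i hi => hn0 i (by omega), fun k hk => ?_⟩
    obtain ⟨y, rfl⟩ : ∃ y, k = y + 1 := ⟨k - 1, by omega⟩
    rw [htot (y + 1) (by omega)]
    have h1 := hx y
    have h2 : (n : ℤ) ≤ y + 1 := by exact_mod_cast (by omega : n ≤ y + 1)
    have : (psum q (y + 1) : ℤ) + 1 ≤ psum p n + (y + 1) * (e + 1) := by
      have h3 : (psum q (y + 1) : ℤ) - y * e < n + psum p n + e := by linarith
      have h4 : (psum q (y + 1) : ℤ) - y * e + 1 ≤ n + psum p n + e := h3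
      linarith
    exact_mod_cast this

/-! ### The closure order on the partitions -/

/-- The necessary conditions for `s2` to be a degeneration of `s1` of the same size, where `s2` has
`δ` more `L`-blocks than `s1`. -/
structure Above (δ : ℕ) (s1 s2 : Multiset KBlock) : Prop where
  rows : rowsOf s2 = rowsOf s1
  r0 : rPart s2 0 = rPart s1 0 + δ
  l0 : lPart s2 0 = lPart s1 0 + δ
  R : ∀ k, psum (rPart s2) k ≤ psum (rPart s1) k + k * δ
  L : ∀ k, psum (lPart s2) k ≤ psum (lPart s1) k + k * δ
  J : ∀ μ k, psum (jPart s1 μ) k ≤ psum (jPart s2 μ) k + k * δ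

theorem WGe.above {s1 s2 : Multiset KBlock} (h : WGe s1 s2) (hr : rowsOf s2 = rowsOf s1)
    (hc : colsOf s2 = colsOf s1) : ∃ δ, Above δ s1 s2 := by
  obtain ⟨hR, hL, hJ⟩ := h
  have h0 : rPart s1 0 ≤ rPart s2 0 := by
    by_contra! h0
    obtain ⟨n, hn⟩ := (isPartitionFun_rPart s1).2
    have h1 := hR (psum (rPart s1) n + 1)
    have h2 := psum_le_of_tail hn (psum (rPart s1) n + 1)
    nlinarith
  obtain ⟨δ, hδ⟩ := Nat.exists_eq_add_of_le h0
  have h1 := KMod.rowsOf_add_rPart s1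
  have h2 := KMod.rowsOf_add_rPart s2
  have hl : lPart s2 0 = lPart s1 0 + δ := by omega
  refine ⟨δ, hr, hδ, hl, fun k => ?_, fun k => ?_, fun μ k => ?_⟩
  · have := hR k
    rw [hδ, mul_add] at this
    omega
  · have := hL k
    rw [hl, mul_add] at this
    omega
  · have := hJ μ k
    rw [hδ, mul_add] at this
    omega

theorem DegS.above {s1 s2 : Multiset KBlock} (h : DegS s1 s2) : ∃ δ, Above δ s1 s2 := by
  obtain ⟨m, n, Q, hQ⟩ : ∃ m n, ∃ Q : Pencil m n, KMod.Iso (KMod.sum s2.toList) (KMod.ofMat Q) := by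
    obtain ⟨Q, hQ⟩ := KMod.exists_ofMat_iso (KMod.sum s2.toList)
    exact ⟨_, _, Q, hQ.symm⟩
  have hcl := h m n Q hQ
  obtain ⟨X, hX⟩ := closure_nonempty_iff.1 ⟨Q, hcl⟩
  have hV := hX.finrank_V
  have hW := hX.finrank_W
  have hV' := hQ.finrank_V
  have hW' := hQ.finrank_W
  rw [KMod.finrank_sum_V, KMod.finrank_ofMat_V, Multiset.coe_toList] at hV hV'
  rw [KMod.finrank_sum_W, KMod.finrank_ofMat_W, Multiset.coe_toList] at hW hW'
  have := KMod.wGe_of_subset_closure hX hQ (closure_mono (fun Y hY => ?_) hcl)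
  · rw [Multiset.coe_toList, Multiset.coe_toList] at this
    exact this.above (hW'.trans hW.symm) (hV'.trans hV.symm)
  · exact (KMod.ofMat_iso_iff_strictEquiv X Y).1 (hX.symm.trans hY)

theorem Above.cols {δ : ℕ} {s1 s2 : Multiset KBlock} (h : Above δ s1 s2) :
    colsOf s2 = colsOf s1 := by
  have h1 := KMod.rowsOf_add_rPart s1
  have h2 := KMod.rowsOf_add_rPart s2
  have := h.rows
  have := h.r0
  have := h.l0
  omega

theorem Above.dual {δ : ℕ} {s1 s2 : Multiset KBlock} (h : Above δ s1 s2) :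
    Above δ (s1.map dualBlock) (s2.map dualBlock) := by
  refine ⟨?_, ?_, ?_, ?_, ?_, ?_⟩
  · rw [rowsOf_map_dualBlock, rowsOf_map_dualBlock, h.cols]
  · simpa only [rPart_map_dualBlock] using h.l0
  · simpa only [lPart_map_dualBlock] using h.r0
  · simpa only [rPart_map_dualBlock] using h.L
  · simpa only [lPart_map_dualBlock] using h.R
  · simpa only [jPart_map_dualBlock] using h.J

theorem Above.of_dual {δ : ℕ} {s1 s2 : Multiset KBlock}
    (h : Above δ (s1.map dualBlock) (s2.map dualBlock)) : Above δ s1 s2 := by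
  simpa only [map_dualBlock_dualBlock] using h.dual

theorem SameData.dual {s1 s2 : Multiset KBlock} (h : SameData s1 s2) :
    SameData (s1.map dualBlock) (s2.map dualBlock) := by
  refine ⟨?_, ?_, fun μ => ?_⟩
  · simpa only [rPart_map_dualBlock] using h.2.1
  · simpa only [lPart_map_dualBlock] using h.1
  · simpa only [jPart_map_dualBlock] using h.2.2 μ

theorem SameData.of_dual {s1 s2 : Multiset KBlock}
    (h : SameData (s1.map dualBlock) (s2.map dualBlock)) : SameData s1 s2 := by
  simpa only [map_dualBlock_dualBlock] using h.dual

theorem Above.total {δ : ℕ} {s1 s2 : Multiset KBlock} (h : Above δ s1 s2) {N : ℕ}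
    (hN : rowsOf s1 < N) (F : Finset (Option ℂ)) (h1 : ∀ μ ∉ F, jPart s1 μ 0 = 0)
    (h2 : ∀ μ ∉ F, jPart s2 μ 0 = 0) :
    psum (rPart s1) N + psum (lPart s1) N + ∑ μ ∈ F, psum (jPart s1 μ) N + δ =
      psum (rPart s2) N + psum (lPart s2) N + ∑ μ ∈ F, psum (jPart s2 μ) N := by
  have e1 := rowsOf_add s1 hN F h1
  have e2 := rowsOf_add s2 (N := N) (by rw [h.rows]; exact hN) F h2
  have := h.rows
  have := h.r0
  omega

theorem Above.sameData {δ ε : ℕ} {s1 s2 : Multiset KBlock} (h : Above δ s1 s2)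
    (h' : Above ε s2 s1) : SameData s1 s2 := by
  have e1 := h.r0
  have e2 := h'.r0
  obtain rfl : δ = 0 := by omega
  obtain rfl : ε = 0 := by omega
  exact ⟨psum_ext fun k => le_antisymm (h'.R k) (h.R k), psum_ext fun k =>
    le_antisymm (h'.L k) (h.L k), fun μ => psum_ext fun k => le_antisymm (h.J μ k) (h'.J μ k)⟩

/-- The rules C1 to C4, without moves from the first columns of `R` and `L`. -/
def StrictRule (s1 s2 : Multiset KBlock) : Prop :=
  StepR s1 s2 ∨ StepR (s1.map dualBlock) (s2.map dualBlock) ∨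
  StepRJ s1 s2 ∨ StepRJ (s1.map dualBlock) (s2.map dualBlock) ∨ RuleC3 s1 s2 ∨ RuleC4 s1 s2

theorem StrictRule.degS {s1 s2 : Multiset KBlock} (h : StrictRule s1 s2) : DegS s1 s2 := by
  rcases h with h | h | h | h | h | h
  exacts [h.degS, h.degS.of_dual, h.degS, h.degS.of_dual, h.degS, h.degS]

/-- The last coin of `R` can be moved when the inequalities for `R` beyond it, and for some `J_μ`
beyond its last column, are strict. -/
theorem Above.exists_last {δ : ℕ} {s1 s2 : Multiset KBlock} (h : Above δ s1 s2) {c : ℕ}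
    (hc : 1 ≤ c) (hc1 : 1 ≤ rPart s1 c) (hc0 : ∀ i, c < i → rPart s1 i = 0)
    (hR : ∀ k, c < k → psum (rPart s2) k + 1 ≤ psum (rPart s1) k + k * δ) {μ : Option ℂ} {d : ℕ}
    (hd0 : ∀ i, d ≤ i → jPart s1 μ i = 0) (hd1 : ∀ i, i < d → 1 ≤ jPart s1 μ i)
    (hJ : ∀ k, d < k → psum (jPart s1 μ) k + 1 ≤ psum (jPart s2 μ) k + k * δ) :
    ∃ s', (StepR s1 s' ∨ StepRJ s1 s') ∧ Above δ s' s2 ∧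
      ∀ ν, jPart s' ν 0 ≠ 0 → jPart s1 ν 0 ≠ 0 ∨ ν = μ := by
  rcases Nat.lt_or_ge 1 (rPart s1 c) with hc2 | hc2
  · obtain ⟨h1, h2⟩ := minRightCoinMove_last (isPartitionFun_rPart s1) hc2 hc0
    obtain ⟨s', hs1, hs2, hs3⟩ := exists_of_isPartitionFun h1.2.1 (isPartitionFun_lPart s1)
      (isPartitionFun_jPart s1) (finite_evs s1).toFinset fun ν hν => by
        funext i
        exact jPart_eq_zero_of_zero (by simpa [evs] using hν) i
    have hstep : StepR s1 s' := ⟨c, hc, by rwa [hs1], hs2, hs3⟩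
    obtain ⟨ε, hε⟩ := hstep.degS.above
    have hl := hε.l0
    rw [hs2] at hl
    obtain rfl : ε = 0 := by omega
    refine ⟨s', Or.inl hstep, ⟨h.rows.trans hε.rows.symm, ?_, ?_, fun k => ?_, ?_, ?_⟩,
      fun ν hν => Or.inl (by rwa [hs3] at hν)⟩
    · rw [hε.r0, add_zero, h.r0]
    · rw [hs2, h.l0]
    · have e1 := h2 k
      rw [← hs1] at e1
      have e2 := h.R k
      split_ifs at e1 with hk
      · have := hR k (by omega)
        omega
      · omega
    · rw [hs2]; exact h.L
    · intro ν; rw [hs3]; exact h.J ν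
  · have hR' : IsPartitionFun (Function.update (rPart s1) c 0) := by
      refine ⟨fun i => ?_, c, fun i hi => ?_⟩
      · rcases eq_or_ne (i + 1) c with rfl | e
        · rw [Function.update_self]; omega
        rw [Function.update_of_ne e]
        rcases eq_or_ne i c with rfl | e'
        · rw [Function.update_self, hc0 _ (by omega)]
        · rw [Function.update_of_ne e']
          exact (isPartitionFun_rPart s1).1 i
      · rcases eq_or_ne i c with rfl | e'
        · rw [Function.update_self]
        · rw [Function.update_of_ne e', hc0 _ (by omega)]
    have hJ' : ∀ ν, IsPartitionFun
        (if ν = μ then Function.update (jPart s1 μ) d 1 else jPart s1 ν) := by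
      intro ν
      split_ifs with e
      · refine ⟨fun i => ?_, d + 1, fun i hi => ?_⟩
        · rcases eq_or_ne (i + 1) d with rfl | e
          · rw [Function.update_self, Function.update_of_ne (by omega)]
            exact hd1 i (by omega)
          rw [Function.update_of_ne e]
          rcases eq_or_ne i d with rfl | e'
          · rw [Function.update_self, hd0 _ (by omega)]
            omega
          · rw [Function.update_of_ne e']
            exact (isPartitionFun_jPart s1 μ).1 i
        · rw [Function.update_of_ne (by omega), hd0 _ (by omega)]
      · exact isPartitionFun_jPart s1 ν
    obtain ⟨s', hs1, hs2, hs3⟩ := exists_of_isPartitionFun hR' (isPartitionFun_lPart s1) hJ'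
      (insert μ (finite_evs s1).toFinset) fun ν hν => by
        rw [Finset.mem_insert, not_or] at hν
        rw [if_neg hν.1]
        funext i
        exact jPart_eq_zero_of_zero (by simpa [evs] using hν.2) i
    have hs3' : ∀ ν, ν ≠ μ → jPart s' ν = jPart s1 ν := fun ν hν => by rw [hs3, if_neg hν]
    have hs3μ := hs3 μ
    rw [if_pos rfl] at hs3μ
    have hstep : StepRJ s1 s' := ⟨c, μ, d, hc, by omega, hc0, hs1, hd0 d le_rfl, hd1, hs3μ,
      hs3', hs2⟩
    obtain ⟨ε, hε⟩ := hstep.degS.above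
    have hl := hε.l0
    rw [hs2] at hl
    obtain rfl : ε = 0 := by omega
    refine ⟨s', Or.inr hstep, ⟨h.rows.trans hε.rows.symm, ?_, ?_, fun k => ?_, ?_, fun ν k => ?_⟩,
      fun ν hν => ?_⟩
    · rw [hε.r0, add_zero, h.r0]
    · rw [hs2, h.l0]
    · have e1 : Function.update (rPart s') c 1 = rPart s1 := by
        rw [hs1, Function.update_idem, Function.update_eq_self_iff]
        omega
      have e2 := psum_update_of_zero (p := rPart s') (d := c)
        (by rw [hs1, Function.update_self]) k
      rw [e1] at e2
      have e3 := h.R k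
      split_ifs at e2 with hk
      · have := hR k hk
        omega
      · omega
    · rw [hs2]; exact h.L
    · rcases eq_or_ne ν μ with rfl | e
      · rw [hs3μ, psum_update_of_zero (hd0 d le_rfl)]
        split_ifs with hk
        · exact hJ k hk
        · exact h.J ν k
      · rw [hs3' ν e]; exact h.J ν k
    · rcases eq_or_ne ν μ with rfl | e
      · exact Or.inr rfl
      · rw [hs3' ν e] at hν
        exact Or.inl hν

/-! ### Reaching a lower orbit by coin moves -/

theorem Above.exists_stepR {s1 s2 : Multiset KBlock} (h : Above 0 s1 s2)
    (hN : psum (rPart s1) (rowsOf s1 + 1) = psum (rPart s2) (rowsOf s1 + 1))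
    (hne : rPart s1 ≠ rPart s2) :
    ∃ s', StepR s1 s' ∧ Above 0 s' s2 ∧ ∀ ν, jPart s' ν = jPart s1 ν := by
  have hd : Dominates (rPart s1) (rPart s2) := by
    refine ⟨fun k => by simpa using h.R k, rowsOf s1 + 1, fun m hm => ?_⟩
    rw [psum_eq_of_le (fun i hi => (rPart_isPartitionFun_aux s1 hi).1) hm, hN,
      psum_eq_of_le (fun i hi => (rPart_isPartitionFun_aux s2 (by rw [h.rows]; exact hi)).1) hm]
  obtain ⟨r, j, hr, hrd⟩ := exists_minRightCoinMove (isPartitionFun_rPart s1)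
    (isPartitionFun_rPart s2) hd hne
  obtain ⟨s', hs1, hs2, hs3⟩ := exists_of_isPartitionFun hr.2.1 (isPartitionFun_lPart s1)
      (isPartitionFun_jPart s1) (finite_evs s1).toFinset fun ν hν => by
        funext i
        exact jPart_eq_zero_of_zero (by simpa [evs] using hν) i
  have hj : 1 ≤ j := by
    by_contra hj
    obtain rfl : j = 0 := by omega
    obtain ⟨⟨k, -, h1, -, -⟩, -⟩ := hr
    have h2 := hrd.1 1
    have h3 : ∀ p, psum p 1 = p 0 := fun p => by rw [psum_succ, psum_zero, zero_add]
    rw [h3, h3, h.r0] at h2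
    omega
  have hstep : StepR s1 s' := ⟨j, hj, by rwa [hs1], hs2, hs3⟩
  obtain ⟨ε, hε⟩ := hstep.degS.above
  have hl := hε.l0
  rw [hs2] at hl
  obtain rfl : ε = 0 := by omega
  refine ⟨s', hstep, ⟨h.rows.trans hε.rows.symm, ?_, ?_, fun k => ?_, ?_, ?_⟩, hs3⟩
  · rw [hε.r0, add_zero, h.r0]
  · rw [hs2, h.l0]
  · rw [hs1]
    simpa using hrd.1 k
  · rw [hs2]; exact h.L
  · intro ν; rw [hs3]; exact h.J ν

theorem Above.exists_stepJ {s1 s2 : Multiset KBlock} (h : Above 0 s1 s2) {μ : Option ℂ}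
    (hN : psum (jPart s1 μ) (rowsOf s1 + 1) = psum (jPart s2 μ) (rowsOf s1 + 1))
    (hne : jPart s1 μ ≠ jPart s2 μ) :
    ∃ s', RuleC3 s1 s' ∧ Above 0 s' s2 ∧
      ∀ ν, jPart s' ν 0 ≠ 0 → jPart s1 ν 0 ≠ 0 ∨ jPart s2 ν 0 ≠ 0 := by
  have hd : Dominates (jPart s2 μ) (jPart s1 μ) := by
    refine ⟨fun k => by simpa using h.J μ k, rowsOf s1 + 1, fun m hm => ?_⟩
    rw [psum_eq_of_le (fun i hi => (rPart_isPartitionFun_aux s1 hi).2.2 μ) hm, hN,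
      psum_eq_of_le (fun i hi =>
        (rPart_isPartitionFun_aux s2 (by rw [h.rows]; exact hi)).2.2 μ) hm]
  obtain ⟨r, hr0, hr, hrd⟩ := exists_minLeftCoinMove (isPartitionFun_jPart s2 μ)
    (isPartitionFun_jPart s1 μ) hd hne.symm
  obtain ⟨s', hs1, hs2, hs3⟩ := exists_of_isPartitionFun (isPartitionFun_rPart s1)
      (isPartitionFun_lPart s1) (J := Function.update (jPart s1) μ r) (fun ν => by
        rcases eq_or_ne ν μ with rfl | e
        · rwa [Function.update_self]
        · rw [Function.update_of_ne e]
          exact isPartitionFun_jPart s1 ν)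
      (insert μ (finite_evs s1).toFinset) fun ν hν => by
        rw [Finset.mem_insert, not_or] at hν
        rw [Function.update_of_ne hν.1]
        funext i
        exact jPart_eq_zero_of_zero (by simpa [evs] using hν.2) i
  have hs3μ : jPart s' μ = r := by rw [hs3, Function.update_self]
  have hs3' : ∀ ν, ν ≠ μ → jPart s' ν = jPart s1 ν := fun ν e => by
    rw [hs3, Function.update_of_ne e]
  have hstep : RuleC3 s1 s' := ⟨μ, by rwa [hs3μ], hs3', hs1, hs2⟩
  obtain ⟨ε, hε⟩ := hstep.degS.above
  refine ⟨s', hstep, ⟨h.rows.trans hε.rows.symm, ?_, ?_, ?_, ?_, fun ν k => ?_⟩, fun ν hν => ?_⟩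
  · rw [hs1, h.r0]
  · rw [hs2, h.l0]
  · rw [hs1]; exact h.R
  · rw [hs2]; exact h.L
  · rcases eq_or_ne ν μ with rfl | e
    · rw [hs3μ]
      simpa using hrd.1 k
    · rw [hs3' ν e]; exact h.J ν k
  · rcases eq_or_ne ν μ with rfl | e
    · right
      have h1 : psum r 1 ≤ psum (jPart s2 ν) 1 := hrd.1 1
      have h2 : ∀ p, psum p 1 = p 0 := fun p => by rw [psum_succ, psum_zero, zero_add]
      rw [h2, h2] at h1
      rw [hs3μ] at hν
      omega
    · rw [hs3' ν e] at hν
      exact Or.inl hν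

theorem Above.exists_stepR_or_stepRJ {s1 s2 : Multiset KBlock} (h : Above 0 s1 s2)
    (hN : psum (rPart s2) (rowsOf s1 + 1) < psum (rPart s1) (rowsOf s1 + 1)) :
    ∃ s', (StepR s1 s' ∨ StepRJ s1 s') ∧ Above 0 s' s2 ∧
      ∀ ν, jPart s' ν 0 ≠ 0 → jPart s1 ν 0 ≠ 0 ∨ jPart s2 ν 0 ≠ 0 := by
  set N := rowsOf s1 + 1 with hNdef
  have hz1 : ∀ i, N ≤ i → rPart s1 i = 0 ∧ lPart s1 i = 0 ∧ ∀ μ, jPart s1 μ i = 0 :=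
    fun i hi => rPart_isPartitionFun_aux s1 hi
  have hz2 : ∀ i, N ≤ i → rPart s2 i = 0 ∧ lPart s2 i = 0 ∧ ∀ μ, jPart s2 μ i = 0 :=
    fun i hi => rPart_isPartitionFun_aux s2 (by rw [h.rows]; exact hi)
  obtain ⟨n, hn0, hn1⟩ := exists_length (isPartitionFun_rPart s1)
  have h1 : ∀ p, psum p 1 = p 0 := fun p => by rw [psum_succ, psum_zero, zero_add]
  have hn : 2 ≤ n := by
    by_contra hn
    have h2 := psum_le_of_tail (n := 1) (fun i hi => hn0 i (by omega)) N
    have h3 := psum_mono (rPart s2) (show 1 ≤ N by omega)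
    rw [h1] at h2 h3
    have := h.r0
    omega
  set F := (finite_evs s1).toFinset ∪ (finite_evs s2).toFinset
  have hF1 : ∀ μ ∉ F, jPart s1 μ 0 = 0 := fun μ hμ => by
    by_contra h0
    exact hμ (Finset.mem_union_left _ ((Set.Finite.mem_toFinset _).2 h0))
  have hF2 : ∀ μ ∉ F, jPart s2 μ 0 = 0 := fun μ hμ => by
    by_contra h0
    exact hμ (Finset.mem_union_right _ ((Set.Finite.mem_toFinset _).2 h0))
  have htot := h.total (N := N) (by omega) F hF1 hF2
  have hL := h.L N
  obtain ⟨μ, -, hμ⟩ := Finset.exists_lt_of_sum_lt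
    (show ∑ μ ∈ F, psum (jPart s1 μ) N < ∑ μ ∈ F, psum (jPart s2 μ) N by omega)
  obtain ⟨d, hd0, hd1⟩ := exists_length (isPartitionFun_jPart s1 μ)
  have hRk : ∀ k, n - 1 < k → psum (rPart s2) k + 1 ≤ psum (rPart s1) k + k * 0 := by
    intro k hk
    have h2 := psum_le_of_tail (fun i hi => (hz2 i hi).1) k
    have h3 := psum_le_of_tail hn0 N
    have h4 := psum_mono (rPart s1) (show n ≤ k by omega)
    omega
  have hJk : ∀ k, d < k → psum (jPart s1 μ) k + 1 ≤ psum (jPart s2 μ) k + k * 0 := by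
    intro k hk
    by_contra hlt
    have h2 := psum_eq_of_le hd0 hk.le
    have h3 := h.J μ d
    have h4 := psum_mono (jPart s2 μ) (show d + 1 ≤ k from hk)
    rw [psum_succ] at h4
    have h5 : ∀ i, d ≤ i → jPart s2 μ i = 0 := fun i hi => by
      have := antitone_nat_of_succ_le (isPartitionFun_jPart s2 μ).1 hi
      omega
    have h6 := psum_le_of_tail h5 N
    have h7 := psum_le_of_tail (fun i hi => (hz1 i hi).2.2 μ) d
    omega
  obtain ⟨s', hs1, hs2, hs3⟩ := h.exists_last (c := n - 1) (by omega) (hn1 _ (by omega))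
    (fun i hi => hn0 i (by omega)) hRk hd0 hd1 hJk
  refine ⟨s', hs1, hs2, fun ν hν => ?_⟩
  rcases hs3 ν hν with h2 | rfl
  · exact Or.inl h2
  · refine Or.inr fun h0 => ?_
    have h2 := psum_le_of_tail (p := jPart s2 ν) (n := 0)
      (fun i _ => jPart_eq_zero_of_zero h0 i) N
    rw [psum_zero] at h2
    omega

theorem exists_strictRule_of_dual {s1 s2 : Multiset KBlock} {p : Option ℂ → Prop}
    (h : ∃ t, (StepR (s1.map dualBlock) t ∨ StepRJ (s1.map dualBlock) t) ∧
      (∃ ε, Above ε t (s2.map dualBlock)) ∧ ∀ ν, jPart t ν 0 ≠ 0 → p ν) :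
    ∃ s', StrictRule s1 s' ∧ (∃ ε, Above ε s' s2) ∧ ∀ ν, jPart s' ν 0 ≠ 0 → p ν := by
  obtain ⟨t, ht1, ⟨ε, ht2⟩, ht3⟩ := h
  obtain ⟨s', rfl⟩ : ∃ s' : Multiset KBlock, t = s'.map dualBlock :=
    ⟨t.map dualBlock, (map_dualBlock_dualBlock t).symm⟩
  refine ⟨s', ?_, ⟨ε, ht2.of_dual⟩, by simpa only [jPart_map_dualBlock] using ht3⟩
  rcases ht1 with h | h
  exacts [Or.inr (Or.inl h), Or.inr (Or.inr (Or.inr (Or.inl h)))]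

theorem exists_strictRule_of_stepR {s1 s2 : Multiset KBlock} {p : Option ℂ → Prop}
    (h : ∃ t, (StepR s1 t ∨ StepRJ s1 t) ∧
      (∃ ε, Above ε t s2) ∧ ∀ ν, jPart t ν 0 ≠ 0 → p ν) :
    ∃ s', StrictRule s1 s' ∧ (∃ ε, Above ε s' s2) ∧ ∀ ν, jPart s' ν 0 ≠ 0 → p ν := by
  obtain ⟨t, ht1, ht2, ht3⟩ := h
  refine ⟨t, ?_, ht2, ht3⟩
  rcases ht1 with h | h
  exacts [Or.inl h, Or.inr (Or.inr (Or.inl h))]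

theorem Above.psum_rowsOf {s1 s2 : Multiset KBlock} (h : Above 0 s1 s2)
    (hR : psum (rPart s1) (rowsOf s1 + 1) ≤ psum (rPart s2) (rowsOf s1 + 1))
    (hL : psum (lPart s1) (rowsOf s1 + 1) ≤ psum (lPart s2) (rowsOf s1 + 1)) (μ : Option ℂ) :
    psum (jPart s1 μ) (rowsOf s1 + 1) = psum (jPart s2 μ) (rowsOf s1 + 1) := by
  set F := insert μ ((finite_evs s1).toFinset ∪ (finite_evs s2).toFinset)
  have hF1 : ∀ μ ∉ F, jPart s1 μ 0 = 0 := fun μ hμ => by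
    by_contra h0
    exact hμ (Finset.mem_insert_of_mem
      (Finset.mem_union_left _ ((Set.Finite.mem_toFinset _).2 h0)))
  have hF2 : ∀ μ ∉ F, jPart s2 μ 0 = 0 := fun μ hμ => by
    by_contra h0
    exact hμ (Finset.mem_insert_of_mem
      (Finset.mem_union_right _ ((Set.Finite.mem_toFinset _).2 h0)))
  have htot := h.total (N := rowsOf s1 + 1) (by omega) F hF1 hF2
  have hle : ∀ ν ∈ F, psum (jPart s1 ν) (rowsOf s1 + 1) ≤ psum (jPart s2 ν) (rowsOf s1 + 1) :=
    fun ν _ => by simpa using h.J ν (rowsOf s1 + 1)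
  have := Finset.sum_le_sum hle
  have h1 := h.R (rowsOf s1 + 1)
  have h2 := h.L (rowsOf s1 + 1)
  exact (Finset.sum_eq_sum_iff_of_le hle).1 (by omega) μ (Finset.mem_insert_self _ _)

theorem Above.exists_strictRule_of_zero {s1 s2 : Multiset KBlock} (h : Above 0 s1 s2)
    (hne : ¬ SameData s1 s2) :
    ∃ s', StrictRule s1 s' ∧ (∃ ε, Above ε s' s2) ∧
      ∀ ν, jPart s' ν 0 ≠ 0 → jPart s1 ν 0 ≠ 0 ∨ jPart s2 ν 0 ≠ 0 := by
  by_cases hR : psum (rPart s2) (rowsOf s1 + 1) < psum (rPart s1) (rowsOf s1 + 1)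
  · obtain ⟨s', h1, h2, h3⟩ := h.exists_stepR_or_stepRJ hR
    exact exists_strictRule_of_stepR ⟨s', h1, ⟨0, h2⟩, h3⟩
  by_cases hL : psum (lPart s2) (colsOf s1 + 1) < psum (lPart s1) (colsOf s1 + 1)
  · obtain ⟨t, h1, h2, h3⟩ := h.dual.exists_stepR_or_stepRJ
      (by simpa only [rPart_map_dualBlock, rowsOf_map_dualBlock] using hL)
    exact exists_strictRule_of_dual
      ⟨t, h1, ⟨0, h2⟩, by simpa only [jPart_map_dualBlock] using h3⟩
  rw [not_lt] at hR hL
  have hL' : psum (lPart s1) (rowsOf s1 + 1) ≤ psum (lPart s2) (rowsOf s1 + 1) := by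
    have h1 : ∀ s : Multiset KBlock,
        psum (lPart s) (rowsOf s + 1) = psum (lPart s) (colsOf s + 1) := by
      intro s
      refine le_antisymm (psum_le_of_tail (fun i hi => ?_) _) (psum_le_of_tail (fun i hi => ?_) _)
      · have := (rPart_isPartitionFun_aux (s.map dualBlock) (i := i)
          (by rw [rowsOf_map_dualBlock]; exact hi)).1
        rwa [rPart_map_dualBlock] at this
      · exact (rPart_isPartitionFun_aux s hi).2.1
    have h2 := h1 s1
    have h3 := h1 s2
    rw [h.rows, h.cols] at h3
    omega
  by_cases hR' : rPart s1 = rPart s2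
  · by_cases hLe : lPart s1 = lPart s2
    · obtain ⟨μ, hμ⟩ : ∃ μ, jPart s1 μ ≠ jPart s2 μ := by
        by_contra! hJ
        exact hne ⟨hR', hLe, hJ⟩
      obtain ⟨s', h1, h2, h3⟩ := h.exists_stepJ (h.psum_rowsOf hR hL' μ) hμ
      exact ⟨s', Or.inr (Or.inr (Or.inr (Or.inr (Or.inl h1)))), ⟨0, h2⟩, h3⟩
    · obtain ⟨t, h1, h2, h3⟩ := h.dual.exists_stepR
        (by
          rw [rPart_map_dualBlock, rPart_map_dualBlock, rowsOf_map_dualBlock]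
          exact le_antisymm hL (by simpa using h.L (colsOf s1 + 1)))
        (by rwa [rPart_map_dualBlock, rPart_map_dualBlock])
      refine exists_strictRule_of_dual ⟨t, Or.inl h1, ⟨0, h2⟩, fun ν hν => Or.inl ?_⟩
      rwa [h3, jPart_map_dualBlock] at hν
  · obtain ⟨t, h1, h2, h3⟩ := h.exists_stepR (le_antisymm hR (by simpa using h.R _)) hR'
    exact exists_strictRule_of_stepR
      ⟨t, Or.inl h1, ⟨0, h2⟩, fun ν hν => Or.inl (by rwa [h3] at hν)⟩

theorem psum_sub_one {p : ℕ → ℕ} {d : ℕ} (h0 : ∀ i, d ≤ i → p i = 0) (h1 : ∀ i, i < d → 1 ≤ p i)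
    (k : ℕ) : psum (fun i => p i - 1) k + min k d = psum p k := by
  induction k with
  | zero => simp [psum_zero]
  | succ k ih =>
    rw [psum_succ, psum_succ, ← ih]
    rcases lt_or_ge k d with hk | hk
    · have := h1 k hk
      omega
    · have := h0 k hk
      omega

theorem isPartitionFun_add_indicator {p : ℕ → ℕ} (hp : IsPartitionFun p) (t : ℕ) :
    IsPartitionFun fun i => p i + if i ≤ t then 1 else 0 := by
  obtain ⟨N, hN⟩ := hp.2
  refine ⟨fun i => ?_, N + t + 1, fun i hi => ?_⟩
  · have := hp.1 i
    simp only
    split_ifs <;> omega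
  · simp only
    rw [hN i (by omega), if_neg (by omega)]

theorem psum_add_indicator (p : ℕ → ℕ) (t k : ℕ) :
    psum (fun i => p i + if i ≤ t then 1 else 0) k = psum p k + min k (t + 1) := by
  simp only [← Nat.lt_succ_iff]
  rw [psum_add, psum_indicator]

theorem Above.exists_step_none {e : ℕ} {s1 s2 : Multiset KBlock} (h : Above (e + 1) s1 s2)
    (hR : ∃ c, 1 ≤ c ∧ 1 ≤ rPart s1 c ∧ (∀ i, c < i → rPart s1 i = 0) ∧
      ∀ k, c < k → psum (rPart s2) k + 1 ≤ psum (rPart s1) k + k * (e + 1)) :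
    ∃ s', (StepR s1 s' ∨ StepRJ s1 s') ∧ (∃ ε, Above ε s' s2) ∧
      ∀ ν, jPart s' ν 0 ≠ 0 → jPart s1 ν 0 ≠ 0 ∨ ν = none := by
  obtain ⟨c, hc, hc1, hc0, hk⟩ := hR
  obtain ⟨d, hd0, hd1⟩ := exists_length (isPartitionFun_jPart s1 none)
  have hJ : ∀ k, d < k → psum (jPart s1 none) k + 1 ≤ psum (jPart s2 none) k + k * (e + 1) := by
    intro k hk
    have h1 := psum_eq_of_le hd0 hk.le
    have h2 := h.J none d
    have h3 := psum_mono (jPart s2 none) hk.le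
    have h4 : (d + 1) * (e + 1) ≤ k * (e + 1) := Nat.mul_le_mul_right _ hk
    rw [Nat.succ_mul] at h4
    omega
  obtain ⟨s', h1, h2, h3⟩ := h.exists_last hc hc1 hc0 hk hd0 hd1 hJ
  exact ⟨s', h1, ⟨_, h2⟩, h3⟩

theorem Above.exists_ruleC4 {e : ℕ} {s1 s2 : Multiset KBlock} (h : Above (e + 1) s1 s2)
    (hR : ∃ T x, T ≤ x ∧ (∀ i, rPart s1 i ≠ 0 → i ≤ T) ∧
      (∀ T', T ≤ T' → ∀ k, psum (rPart s2) k ≤ psum (rPart s1) k + min k (T' + 1) + k * e) ∧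
      ∃ M, ∀ N, M ≤ N → T + psum (rPart s1) N + (e + 1) + x * e ≤ psum (rPart s2) N)
    (hL : ∃ T x, T ≤ x ∧ (∀ i, lPart s1 i ≠ 0 → i ≤ T) ∧
      (∀ T', T ≤ T' → ∀ k, psum (lPart s2) k ≤ psum (lPart s1) k + min k (T' + 1) + k * e) ∧
      ∃ M, ∀ N, M ≤ N → T + psum (lPart s1) N + (e + 1) + x * e ≤ psum (lPart s2) N) :
    ∃ s', RuleC4 s1 s' ∧ Above e s' s2 ∧ ∀ ν, jPart s' ν 0 ≠ 0 → jPart s1 ν 0 ≠ 0 := by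
  obtain ⟨t, x, htx, ht, hRk, M, hM⟩ := hR
  obtain ⟨u, y, huy, hu, hLk, M', hM'⟩ := hL
  choose len hlen0 hlen1 using fun ν => exists_length (isPartitionFun_jPart s1 ν)
  set E := (finite_evs s1).toFinset
  have hE : ∀ ν, ν ∈ E ↔ jPart s1 ν 0 ≠ 0 := fun ν => Set.Finite.mem_toFinset _
  set F := E ∪ (finite_evs s2).toFinset
  have hF1 : ∀ μ ∉ F, jPart s1 μ 0 = 0 := fun μ hμ => by
    by_contra h0
    exact hμ (Finset.mem_union_left _ ((hE μ).2 h0))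
  have hF2 : ∀ μ ∉ F, jPart s2 μ 0 = 0 := fun μ hμ => by
    by_contra h0
    exact hμ (Finset.mem_union_right _ ((Set.Finite.mem_toFinset _).2 h0))
  have hbound : t + u + 1 ≤ ∑ ν ∈ E, len ν := by
    set N := rowsOf s1 + 1 + M + M'
    have htot := h.total (N := N) (by omega) F hF1 hF2
    have h1 := hM N (by omega)
    have h2 := hM' N (by omega)
    have h3 : ∑ ν ∈ F, psum (jPart s1 ν) N = ∑ ν ∈ E, psum (jPart s1 ν) N := by
      refine (Finset.sum_subset Finset.subset_union_left fun ν _ hν => ?_).symm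
      rw [hE, not_not] at hν
      have := psum_le_of_tail (n := 0) (fun i _ => jPart_eq_zero_of_zero hν i) N
      rw [psum_zero] at this
      omega
    have h4 : ∑ ν ∈ E, psum (jPart s1 ν) N ≤
        ∑ ν ∈ E, (psum (jPart s2 ν) N + len ν * (e + 1)) := by
      refine Finset.sum_le_sum fun ν _ => ?_
      have h5 := psum_le_of_tail (hlen0 ν) N
      have h6 := h.J ν (len ν)
      have h7 := psum_le_of_tail (n := N) (p := jPart s2 ν) (fun i hi =>
        (rPart_isPartitionFun_aux s2 (by rw [h.rows]; omega)).2.2 ν) (len ν)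
      omega
    have h5 : ∑ ν ∈ E, psum (jPart s2 ν) N ≤ ∑ ν ∈ F, psum (jPart s2 ν) N :=
      Finset.sum_le_sum_of_subset Finset.subset_union_left
    rw [Finset.sum_add_distrib, ← Finset.sum_mul] at h4
    have h6 : t * e ≤ x * e := Nat.mul_le_mul_right _ htx
    have h7 : u * e ≤ y * e := Nat.mul_le_mul_right _ huy
    have h8 : (t + u + 1) * (e + 1) ≤ (∑ ν ∈ E, len ν) * (e + 1) := by
      have : (t + u + 1) * (e + 1) = t + u + (e + 1) + t * e + u * e := by ring
      omega
    exact Nat.le_of_mul_le_mul_right h8 (Nat.succ_pos e)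
  set ek : List (Option ℂ × ℕ) := E.toList.map fun ν => (ν, len ν)
  have hfst : ek.map Prod.fst = E.toList := by
    simp only [ek, List.map_map]
    exact List.map_id _
  have hsnd : (ek.map Prod.snd).sum = ∑ ν ∈ E, len ν := by
    simp only [ek, List.map_map]
    exact Finset.sum_map_toList E len
  set k := ∑ ν ∈ E, len ν
  obtain ⟨s', hs1, hs2, hs3⟩ := exists_of_isPartitionFun
    (isPartitionFun_add_indicator (isPartitionFun_rPart s1) t)
    (isPartitionFun_add_indicator (isPartitionFun_lPart s1) (k - t - 1))
    (J := fun ν i => jPart s1 ν i - 1)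
    (fun ν => ⟨fun i => Nat.sub_le_sub_right ((isPartitionFun_jPart s1 ν).1 i) 1, len ν,
      fun i hi => by simp only [hlen0 ν i hi]⟩) E fun ν hν => by
        rw [hE, not_not] at hν
        funext i
        simp only [jPart_eq_zero_of_zero hν]
        rfl
  have hrule : RuleC4 s1 s' := by
    refine ⟨ek, t, ?_, ?_, ?_, ?_⟩
    · rw [hfst]; exact E.nodup_toList
    · intro z hz
      obtain ⟨ν, hν, rfl⟩ := List.mem_map.1 hz
      rw [Finset.mem_toList, hE] at hν
      have h1 : 1 ≤ len ν := by
        by_contra h1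
        exact hν (hlen0 ν 0 (by omega))
      have h2 := hlen1 ν (len ν - 1) (by omega)
      exact ⟨h1, by simp only; omega, hlen0 ν⟩
    · intro ν hν
      rw [hfst, Finset.mem_toList, hE]
      exact hν
    · simp only [hsnd]
      refine ⟨by omega, fun ν i => by rw [hs3], fun i => by rw [hs1], fun i => by rw [hs2], ht,
        fun i hi => ?_⟩
      have := hu i hi
      omega
  obtain ⟨ε, hε⟩ := hrule.degS.above
  have h0 : rPart s' 0 = rPart s1 0 + 1 := by rw [hs1]; simp
  have h0' : lPart s' 0 = lPart s1 0 + 1 := by rw [hs2]; simp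
  refine ⟨s', hrule, ⟨h.rows.trans hε.rows.symm, ?_, ?_, fun m => ?_, fun m => ?_, fun ν m => ?_⟩,
    fun ν hν => ?_⟩
  · rw [h.r0, h0]; omega
  · rw [h.l0, h0']; omega
  · rw [hs1, psum_add_indicator]
    exact hRk t le_rfl m
  · rw [hs2, psum_add_indicator]
    exact hLk _ (by omega) m
  · have h1 := psum_sub_one (hlen0 ν) (hlen1 ν) m
    rw [← hs3] at h1
    rcases le_total m (len ν) with hm | hm
    · have h2 := h.J ν m
      rw [min_eq_left hm] at h1
      rw [Nat.mul_succ] at h2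
      omega
    · rw [min_eq_right hm, psum_eq_of_le (hlen0 ν) hm] at h1
      have h2 := h.J ν (len ν)
      have h3 := psum_mono (jPart s2 ν) hm
      have h4 : len ν * e ≤ m * e := Nat.mul_le_mul_right _ hm
      rw [Nat.mul_succ] at h2
      omega
  · rw [hs3] at hν
    simp only at hν
    omega

theorem Above.exists_strictRule {δ : ℕ} {s1 s2 : Multiset KBlock} (h : Above δ s1 s2)
    (hne : ¬ SameData s1 s2) :
    ∃ s', StrictRule s1 s' ∧ (∃ ε, Above ε s' s2) ∧
      ∀ ν, jPart s' ν 0 ≠ 0 → jPart s1 ν 0 ≠ 0 ∨ jPart s2 ν 0 ≠ 0 ∨ ν = none := by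
  rcases δ with _ | e
  · obtain ⟨s', h1, h2, h3⟩ := h.exists_strictRule_of_zero hne
    exact ⟨s', h1, h2, fun ν hν => (h3 ν hν).imp_right Or.inl⟩
  have hnone : ∀ {s' : Multiset KBlock},
      (∀ ν, jPart s' ν 0 ≠ 0 → jPart s1 ν 0 ≠ 0 ∨ ν = none) →
      ∀ ν, jPart s' ν 0 ≠ 0 → jPart s1 ν 0 ≠ 0 ∨ jPart s2 ν 0 ≠ 0 ∨ ν = none :=
    fun h ν hν => (h ν hν).imp_right Or.inr
  rcases exists_last_or_bound (isPartitionFun_rPart s1) (isPartitionFun_rPart s2) h.r0 h.R with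
    hR | hR
  · obtain ⟨s', h1, h2, h3⟩ := h.exists_step_none hR
    exact exists_strictRule_of_stepR ⟨s', h1, h2, hnone h3⟩
  rcases exists_last_or_bound (isPartitionFun_lPart s1) (isPartitionFun_lPart s2) h.l0 h.L with
    hL | hL
  · obtain ⟨t, h1, h2, h3⟩ := h.dual.exists_step_none
      (by simpa only [rPart_map_dualBlock] using hL)
    refine exists_strictRule_of_dual ⟨t, h1, h2, hnone ?_⟩
    simpa only [jPart_map_dualBlock] using h3
  · obtain ⟨s', h1, h2, h3⟩ := h.exists_ruleC4 hR hL
    exact ⟨s', Or.inr (Or.inr (Or.inr (Or.inr (Or.inr h1)))), ⟨_, h2⟩,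
      fun ν hν => Or.inl (h3 ν hν)⟩

/-! ### Nothing lies strictly between the two sides of a coin move -/

theorem Above.trans {a b : ℕ} {s1 s s2 : Multiset KBlock} (h1 : Above a s1 s) (h2 : Above b s s2) :
    Above (a + b) s1 s2 := by
  refine ⟨h2.rows.trans h1.rows, ?_, ?_, fun k => ?_, fun k => ?_, fun μ k => ?_⟩
  · rw [h2.r0, h1.r0, add_assoc]
  · rw [h2.l0, h1.l0, add_assoc]
  · have := h1.R k
    have := h2.R k
    rw [mul_add]
    omega
  · have := h1.L k
    have := h2.L k
    rw [mul_add]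
    omega
  · have := h1.J μ k
    have := h2.J μ k
    rw [mul_add]
    omega

theorem Above.lPart_eq {s1 s s2 : Multiset KBlock} (h1 : Above 0 s1 s) (h2 : Above 0 s s2)
    (h : lPart s2 = lPart s1) : lPart s = lPart s1 := by
  refine psum_ext fun k => le_antisymm (h1.L k) ?_
  rw [← h]
  exact h2.L k

theorem Above.jPart_eq {s1 s s2 : Multiset KBlock} (h1 : Above 0 s1 s) (h2 : Above 0 s s2)
    {ν : Option ℂ} (h : jPart s2 ν = jPart s1 ν) : jPart s ν = jPart s1 ν := by
  refine psum_ext fun k => le_antisymm ?_ (h1.J ν k)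
  rw [← h]
  exact h2.J ν k

theorem Dominates.of_between {p q r : ℕ → ℕ} (h : Dominates p q) (h1 : ∀ k, psum r k ≤ psum p k)
    (h2 : ∀ k, psum q k ≤ psum r k) : Dominates p r ∧ Dominates r q := by
  obtain ⟨N, hN⟩ := h.2
  refine ⟨⟨h1, N, fun m hm => ?_⟩, h2, N, fun m hm => ?_⟩
  · have := hN m hm
    have := h1 m
    have := h2 m
    omega
  · have := hN m hm
    have := h1 m
    have := h2 m
    omega

theorem StepR.eq_or_eq {s1 s s2 : Multiset KBlock} (h : StepR s1 s2) (h1 : Above 0 s1 s)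
    (h2 : Above 0 s s2) : SameData s s1 ∨ SameData s s2 := by
  obtain ⟨j, -, hj, hl, hJ⟩ := h
  have hl' := h1.lPart_eq h2 hl
  have hJ' := fun ν => h1.jPart_eq h2 (hJ ν)
  obtain ⟨h3, h4⟩ := hj.2.2.1.of_between h1.R h2.R
  rcases hj.2.2.2.2 _ (isPartitionFun_rPart s) h3 h4 with e | e
  · exact Or.inl ⟨e, hl', hJ'⟩
  · exact Or.inr ⟨e, hl'.trans hl.symm, fun ν => (hJ' ν).trans (hJ ν).symm⟩

theorem RuleC3.eq_or_eq {s1 s s2 : Multiset KBlock} (h : RuleC3 s1 s2) (h1 : Above 0 s1 s)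
    (h2 : Above 0 s s2) : SameData s s1 ∨ SameData s s2 := by
  obtain ⟨μ, ⟨j, hj⟩, hJ, hr, hl⟩ := h
  have hl' := h1.lPart_eq h2 hl
  have hr' : rPart s = rPart s1 := by
    simpa only [lPart_map_dualBlock] using
      h1.dual.lPart_eq h2.dual (by rwa [lPart_map_dualBlock, lPart_map_dualBlock])
  have hJ' := fun ν e => h1.jPart_eq h2 (hJ ν e)
  obtain ⟨h3, h4⟩ := hj.2.2.1.of_between (h2.J μ) (h1.J μ)
  rcases hj.2.2.2.2 _ (isPartitionFun_jPart s μ) h3 h4 with e | e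
  · refine Or.inr ⟨hr'.trans hr.symm, hl'.trans hl.symm, fun ν => ?_⟩
    rcases eq_or_ne ν μ with rfl | e'
    exacts [e, (hJ' ν e').trans (hJ ν e').symm]
  · refine Or.inl ⟨hr', hl', fun ν => ?_⟩
    rcases eq_or_ne ν μ with rfl | e'
    exacts [e, hJ' ν e']

theorem StepRJ.eq_or_eq {s1 s s2 : Multiset KBlock} (h : StepRJ s1 s2) (h1 : Above 0 s1 s)
    (h2 : Above 0 s s2) : SameData s s1 ∨ SameData s s2 := by
  obtain ⟨c, μ, d, -, hc1, hc0, hr, hd0, -, hμ, hJ, hl⟩ := h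
  have hl' := h1.lPart_eq h2 hl
  have hJ' := fun ν e => h1.jPart_eq h2 (hJ ν e)
  have hr1 : rPart s1 = Function.update (rPart s2) c 1 := by
    rw [hr, Function.update_idem, eq_comm, Function.update_eq_self_iff, hc1]
  have hr20 : ∀ i, c ≤ i → rPart s2 i = 0 := by
    intro i hi
    rw [hr]
    rcases eq_or_ne i c with rfl | e
    · rw [Function.update_self]
    · rw [Function.update_of_ne e, hc0 i (by omega)]
  have hd : ∀ i, d ≤ i → jPart s1 μ i = 0 := fun i hi => by
    have := antitone_nat_of_succ_le (isPartitionFun_jPart s1 μ).1 hi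
    omega
  have hdN : d < rowsOf s1 + 1 := by
    by_contra hdN
    have := (rPart_isPartitionFun_aux s2 (i := d)
      (by have := h2.rows; have := h1.rows; omega)).2.2 μ
    rw [hμ, Function.update_self] at this
    omega
  have hps := psum_update_of_zero hd0 (rowsOf s1 + 1)
  rw [if_pos hdN, ← hμ] at hps
  rcases eq_or_eq_update (isPartitionFun_rPart s) hr20 h2.R (by rw [← hr1]; exact h1.R)
    with e1 | e1 <;>
  rcases eq_or_eq_update (isPartitionFun_jPart s μ) hd (h1.J μ) (by rw [← hμ]; exact h2.J μ)
    with e2 | e2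
  · have := h2.psum_rowsOf (by rw [e1]) (by rw [hl', hl]) μ
    rw [h1.rows, e2] at this
    omega
  · refine Or.inr ⟨e1, hl'.trans hl.symm, fun ν => ?_⟩
    rcases eq_or_ne ν μ with rfl | e'
    exacts [e2.trans hμ.symm, (hJ' ν e').trans (hJ ν e').symm]
  · refine Or.inl ⟨e1.trans hr1.symm, hl', fun ν => ?_⟩
    rcases eq_or_ne ν μ with rfl | e'
    exacts [e2, hJ' ν e']
  · have := h1.psum_rowsOf (by rw [e1, hr1]) (by rw [hl']) μ
    rw [e2, ← hμ] at this
    omega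

theorem Above.rPart_eq_of_zero_one {s1 s s2 : Multiset KBlock} (h1 : Above 0 s1 s)
    (h2 : Above 1 s s2) {t : ℕ} (hr : ∀ i, rPart s2 i = rPart s1 i + if i ≤ t then 1 else 0)
    (ht : ∀ i, rPart s1 i ≠ 0 → i ≤ t) : rPart s = rPart s1 := by
  have hps := psum_add_indicator (rPart s1) t
  rw [← funext hr] at hps
  have hlow : ∀ k, k ≤ t + 1 → psum (rPart s) k = psum (rPart s1) k := by
    intro k hk
    have e1 := h1.R k
    have e2 := h2.R k
    rw [hps] at e2
    omega
  have h0 : ∀ i, t + 1 ≤ i → rPart s1 i = 0 := fun i hi => by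
    by_contra h0
    have := ht i h0
    omega
  refine psum_ext fun k => ?_
  rcases le_total k (t + 1) with hk | hk
  · exact hlow k hk
  · have e1 := h1.R k
    have e2 := psum_mono (rPart s) hk
    rw [hlow _ le_rfl] at e2
    have e3 := psum_eq_of_le h0 hk
    omega

theorem Above.rPart_eq_of_one_zero {s1 s s2 : Multiset KBlock} (h1 : Above 1 s1 s)
    (h2 : Above 0 s s2) {t : ℕ} (hr : ∀ i, rPart s2 i = rPart s1 i + if i ≤ t then 1 else 0)
    (ht : ∀ i, rPart s1 i ≠ 0 → i ≤ t)
    (hN : ∃ N, (∀ i, N ≤ i → rPart s i = 0) ∧ psum (rPart s) N = psum (rPart s2) N) :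
    rPart s = rPart s2 := by
  obtain ⟨N, hN0, hN⟩ := hN
  have hps := psum_add_indicator (rPart s1) t
  rw [← funext hr] at hps
  have h0 : ∀ i, t + 1 ≤ i → rPart s2 i = 0 := fun i hi => by
    rw [hr, if_neg (by omega), add_zero]
    by_contra h0
    have := ht i h0
    omega
  refine psum_ext fun k => ?_
  have e2 := h2.R k
  rcases le_total k (t + 1) with hk | hk
  · have e1 := h1.R k
    rw [hps] at e2 ⊢
    omega
  · have e3 := psum_eq_of_le h0 hk
    have e4 := psum_le_of_tail hN0 k
    have e5 := psum_le_of_tail h0 N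
    omega

theorem RuleC4.eq_or_eq {a b : ℕ} {s1 s s2 : Multiset KBlock} (h : RuleC4 s1 s2)
    (h1 : Above a s1 s) (h2 : Above b s s2) : SameData s s1 ∨ SameData s s2 := by
  obtain ⟨ek, t, -, -, -, h⟩ := h
  simp only at h
  obtain ⟨-, hJ, hr, hl, ht, hu⟩ := h
  generalize (ek.map Prod.snd).sum - t - 1 = u at hl hu
  have hab : a + b = 1 := by
    have e1 := h1.r0
    have e2 := h2.r0
    rw [hr, if_pos (Nat.zero_le t)] at e2
    omega
  choose len hlen0 hlen1 using fun ν => exists_length (isPartitionFun_jPart s1 ν)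
  have hJps : ∀ ν k, psum (jPart s2 ν) k + min k (len ν) = psum (jPart s1 ν) k := by
    intro ν k
    rw [funext (hJ ν)]
    exact psum_sub_one (hlen0 ν) (hlen1 ν) k
  have hl' : ∀ i, rPart (s2.map dualBlock) i =
      rPart (s1.map dualBlock) i + if i ≤ u then 1 else 0 := by
    simpa only [rPart_map_dualBlock] using hl
  have hu' : ∀ i, rPart (s1.map dualBlock) i ≠ 0 → i ≤ u := by
    simpa only [rPart_map_dualBlock] using hu
  rcases Nat.eq_zero_or_pos a with rfl | ha
  · obtain rfl : b = 1 := by omega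
    left
    have hR := h1.rPart_eq_of_zero_one h2 hr ht
    have hL := h1.dual.rPart_eq_of_zero_one h2.dual hl' hu'
    rw [rPart_map_dualBlock, rPart_map_dualBlock] at hL
    refine ⟨hR, hL, fun ν => psum_ext fun k => ?_⟩
    have e1 := h1.J ν k
    have e2 := h2.J ν k
    have e3 := hJps ν k
    rcases le_total k (len ν) with hk | hk
    · omega
    · have e4 := h1.psum_rowsOf (by rw [hR]) (by rw [hL]) ν
      have e5 := psum_le_of_tail (n := rowsOf s1 + 1) (p := jPart s ν)
        (fun i hi => (rPart_isPartitionFun_aux s (i := i) (by rw [h1.rows]; omega)).2.2 ν) k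
      have e6 := psum_le_of_tail (hlen0 ν) (rowsOf s1 + 1)
      have e7 := psum_mono (jPart s1 ν) hk
      omega
  · obtain rfl : a = 1 := by omega
    obtain rfl : b = 0 := by omega
    right
    have hJs : ∀ ν, jPart s ν = jPart s2 ν := by
      intro ν
      have hlow : ∀ k, k ≤ len ν → psum (jPart s ν) k = psum (jPart s2 ν) k := by
        intro k hk
        have e1 := h1.J ν k
        have e2 := h2.J ν k
        have e3 := hJps ν k
        omega
      refine psum_ext fun k => ?_
      rcases le_total k (len ν) with hk | hk
      · exact hlow k hk
      · have e1 := h2.J ν k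
        have e2 := psum_mono (jPart s ν) hk
        rw [hlow _ le_rfl] at e2
        have e3 := psum_eq_of_le (p := jPart s2 ν) (n := len ν)
          (fun i hi => by rw [hJ, hlen0 ν i hi]) hk
        omega
    set N := rowsOf s + colsOf s + 1
    have hsum : psum (rPart s) N = psum (rPart s2) N ∧ psum (lPart s) N = psum (lPart s2) N := by
      have htot := h2.total (N := N) (by omega) (finite_evs s).toFinset (by simp [evs])
        (fun μ hμ => by rw [← hJs]; revert hμ; simp [evs])
      simp only [hJs] at htot
      have e1 := h2.R N
      have e2 := h2.L N
      omega
    refine ⟨h1.rPart_eq_of_one_zero h2 hr ht ⟨N, fun i hi =>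
      (rPart_isPartitionFun_aux s (by omega)).1, hsum.1⟩, ?_, hJs⟩
    have hL := h1.dual.rPart_eq_of_one_zero h2.dual hl' hu' ⟨N, fun i hi => ?_, ?_⟩
    · rwa [rPart_map_dualBlock, rPart_map_dualBlock] at hL
    · exact (rPart_isPartitionFun_aux _ (by rw [rowsOf_map_dualBlock]; omega)).1
    · rw [rPart_map_dualBlock, rPart_map_dualBlock]
      exact hsum.2

theorem StrictRule.eq_or_eq {a b : ℕ} {s1 s s2 : Multiset KBlock} (h : StrictRule s1 s2)
    (h1 : Above a s1 s) (h2 : Above b s s2) : SameData s s1 ∨ SameData s s2 := by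
  have hab : rPart s2 0 = rPart s1 0 ∨ lPart s2 0 = lPart s1 0 → a = 0 ∧ b = 0 := by
    have e1 := h1.r0
    have e2 := h2.r0
    have e3 := h1.l0
    have e4 := h2.l0
    omega
  have hdual : SameData (s.map dualBlock) (s1.map dualBlock) ∨
      SameData (s.map dualBlock) (s2.map dualBlock) → SameData s s1 ∨ SameData s s2 :=
    Or.imp SameData.of_dual SameData.of_dual
  rcases h with h | h | h | h | h | h
  · obtain ⟨rfl, rfl⟩ := hab (Or.inr (by obtain ⟨j, -, -, hl, -⟩ := h; rw [hl]))
    exact h.eq_or_eq h1 h2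
  · obtain ⟨rfl, rfl⟩ := hab (Or.inl (by
      obtain ⟨j, -, -, hl, -⟩ := h
      rw [lPart_map_dualBlock, lPart_map_dualBlock] at hl
      rw [hl]))
    exact hdual (h.eq_or_eq h1.dual h2.dual)
  · obtain ⟨rfl, rfl⟩ := hab (Or.inr (by
      obtain ⟨c, μ, d, -, -, -, -, -, -, -, -, hl⟩ := h; rw [hl]))
    exact h.eq_or_eq h1 h2
  · obtain ⟨rfl, rfl⟩ := hab (Or.inl (by
      obtain ⟨c, μ, d, -, -, -, -, -, -, -, -, hl⟩ := h
      rw [lPart_map_dualBlock, lPart_map_dualBlock] at hl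
      rw [hl]))
    exact hdual (h.eq_or_eq h1.dual h2.dual)
  · obtain ⟨rfl, rfl⟩ := hab (Or.inr (by obtain ⟨μ, -, -, -, hl⟩ := h; rw [hl]))
    exact h.eq_or_eq h1 h2
  · exact h.eq_or_eq h1 h2

theorem StepR.not_sameData {s1 s2 : Multiset KBlock} (h : StepR s1 s2) : ¬ SameData s1 s2 := by
  obtain ⟨j, -, hj, -⟩ := h
  exact fun h => hj.2.2.2.1 h.1

theorem StepRJ.not_sameData {s1 s2 : Multiset KBlock} (h : StepRJ s1 s2) : ¬ SameData s1 s2 := by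
  obtain ⟨c, μ, d, -, hc1, -, hr, -⟩ := h
  intro h
  rw [h.1, hr, Function.update_self] at hc1
  omega

theorem StrictRule.not_sameData {s1 s2 : Multiset KBlock} (h : StrictRule s1 s2) :
    ¬ SameData s1 s2 := by
  rcases h with h | h | h | h | h | h
  · exact h.not_sameData
  · exact fun e => h.not_sameData e.dual
  · exact h.not_sameData
  · exact fun e => h.not_sameData e.dual
  · obtain ⟨μ, ⟨j, hj⟩, -⟩ := h
    exact fun h => hj.2.2.2.1 (h.2.2 μ).symm
  · obtain ⟨ek, t, -, -, -, -, -, hr, -⟩ := h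
    intro h
    have := hr 0
    rw [h.1, if_pos (Nat.zero_le t)] at this
    omega

/-! ### The inequalities between the partitions characterize degeneration -/

/-- The total defect at `k` in the inequalities between the partitions of `s` and `s2`. -/
def defect (s2 : Multiset KBlock) (F : Finset (Option ℂ)) (s : Multiset KBlock) (k : ℕ) : ℕ :=
  psum (rPart s) k + k * (rPart s2 0 - rPart s 0) +
    (psum (lPart s) k + k * (rPart s2 0 - rPart s 0)) +
    ∑ μ ∈ F, (psum (jPart s2 μ) k + k * (rPart s2 0 - rPart s 0) - psum (jPart s μ) k)

theorem Above.defect_eq {a : ℕ} {s s2 : Multiset KBlock} (h : Above a s s2)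
    (F : Finset (Option ℂ)) (k : ℕ) :
    defect s2 F s k = psum (rPart s) k + k * a + (psum (lPart s) k + k * a) +
      ∑ μ ∈ F, (psum (jPart s2 μ) k + k * a - psum (jPart s μ) k) := by
  have : rPart s2 0 - rPart s 0 = a := by rw [h.r0]; omega
  rw [defect, this]

theorem Above.defect_le {a b : ℕ} {s s' s2 : Multiset KBlock} (h1 : Above a s s')
    (h2 : Above b s' s2) (F : Finset (Option ℂ)) (k : ℕ) : defect s2 F s' k ≤ defect s2 F s k := by
  rw [(h1.trans h2).defect_eq, h2.defect_eq, mul_add]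
  refine add_le_add (add_le_add ?_ ?_) (Finset.sum_le_sum fun μ _ => ?_)
  · have := h1.R k
    omega
  · have := h1.L k
    omega
  · have := h1.J μ k
    have := h2.J μ k
    omega

theorem Above.eq_of_defect_le {a b : ℕ} {s s' s2 : Multiset KBlock} (h1 : Above a s s')
    (h2 : Above b s' s2) (F : Finset (Option ℂ)) {k : ℕ} (h : defect s2 F s k ≤ defect s2 F s' k) :
    psum (rPart s') k = psum (rPart s) k + k * a ∧ psum (lPart s') k = psum (lPart s) k + k * a ∧
      ∀ μ ∈ F, psum (jPart s μ) k = psum (jPart s' μ) k + k * a := by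
  rw [(h1.trans h2).defect_eq, h2.defect_eq, mul_add] at h
  have e1 := h1.R k
  have e2 := h1.L k
  have e3 : ∀ μ ∈ F, psum (jPart s2 μ) k + k * b - psum (jPart s' μ) k ≤
      psum (jPart s2 μ) k + (k * a + k * b) - psum (jPart s μ) k := by
    intro μ _
    have := h1.J μ k
    have := h2.J μ k
    omega
  have e4 := Finset.sum_le_sum e3
  refine ⟨by omega, by omega, fun μ hμ => ?_⟩
  have e5 := (Finset.sum_eq_sum_iff_of_le e3).1 (by omega) μ hμ
  have := h1.J μ k
  have := h2.J μ k
  omega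

theorem Above.sum_defect_lt {a b : ℕ} {s s' s2 : Multiset KBlock} (h1 : Above a s s')
    (h2 : Above b s' s2) (hne : ¬ SameData s s') {F : Finset (Option ℂ)}
    (hF : ∀ μ ∉ F, jPart s μ 0 = 0) (hF' : ∀ μ ∉ F, jPart s' μ 0 = 0) :
    ∑ k ∈ Finset.range (rowsOf s2 + 3), defect s2 F s' k <
      ∑ k ∈ Finset.range (rowsOf s2 + 3), defect s2 F s k := by
  refine lt_of_le_of_ne (Finset.sum_le_sum fun k _ => h1.defect_le h2 F k) fun heq => hne ?_
  have key := fun k hk => h1.eq_of_defect_le h2 F (k := k)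
    ((Finset.sum_eq_sum_iff_of_le fun k _ => h1.defect_le h2 F k).1 heq k hk).ge
  have hN := h2.rows
  have hN' := h1.rows
  obtain ⟨N, hNN⟩ : ∃ N, N = rowsOf s2 + 1 := ⟨_, rfl⟩
  have z : ∀ i, N ≤ i → rPart s i = 0 ∧ lPart s i = 0 ∧ ∀ μ, jPart s μ i = 0 := fun i hi =>
    rPart_isPartitionFun_aux s (by omega)
  have z' : ∀ i, N ≤ i → rPart s' i = 0 ∧ lPart s' i = 0 ∧ ∀ μ, jPart s' μ i = 0 := fun i hi =>
    rPart_isPartitionFun_aux s' (by omega)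
  obtain rfl : a = 0 := by
    have e1 := (key N (by rw [Finset.mem_range]; omega)).1
    have e2 := (key (N + 1) (by rw [Finset.mem_range]; omega)).1
    rw [psum_succ, psum_succ, (z N le_rfl).1, (z' N le_rfl).1, add_mul] at e2
    omega
  have ext : ∀ {p q : ℕ → ℕ}, (∀ i, N ≤ i → p i = 0) → (∀ i, N ≤ i → q i = 0) →
      (∀ k, k ≤ N → psum p k = psum q k) → p = q := by
    intro p q hp hq h
    refine psum_ext fun k => ?_
    rcases le_total k N with hk | hk
    · exact h k hk
    · rw [psum_eq_of_le hp hk, psum_eq_of_le hq hk, h N le_rfl]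
  have key' := fun k (hk : k ≤ N) => key k (by rw [Finset.mem_range]; omega)
  refine ⟨ext (fun i hi => (z i hi).1) (fun i hi => (z' i hi).1) fun k hk => (key' k hk).1.symm,
    ext (fun i hi => (z i hi).2.1) (fun i hi => (z' i hi).2.1) fun k hk => (key' k hk).2.1.symm,
    fun μ => ?_⟩
  by_cases hμ : μ ∈ F
  · exact ext (fun i hi => (z i hi).2.2 μ) (fun i hi => (z' i hi).2.2 μ)
      fun k hk => (key' k hk).2.2 μ hμ
  · funext i
    rw [jPart_eq_zero_of_zero (hF μ hμ), jPart_eq_zero_of_zero (hF' μ hμ)]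

theorem Above.degS {δ : ℕ} {s1 s2 : Multiset KBlock} (h : Above δ s1 s2) : DegS s1 s2 := by
  obtain ⟨F, hF1, hF2, hF0⟩ : ∃ F : Finset (Option ℂ), (∀ μ ∉ F, jPart s1 μ 0 = 0) ∧
      (∀ μ ∉ F, jPart s2 μ 0 = 0) ∧ none ∈ F := by
    refine ⟨(finite_evs s1).toFinset ∪ (finite_evs s2).toFinset ∪ {none}, fun μ hμ => ?_,
      fun μ hμ => ?_, by simp⟩
    · by_contra h
      exact hμ (by simp [evs, h])
    · by_contra h
      exact hμ (by simp [evs, h])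
  obtain ⟨n, hn⟩ : ∃ n, n = ∑ k ∈ Finset.range (rowsOf s2 + 3), defect s2 F s1 k := ⟨_, rfl⟩
  induction n using Nat.strong_induction_on generalizing δ s1 with
  | _ n ih =>
    by_cases hne : SameData s1 s2
    · exact hne.degS
    · obtain ⟨s', hs, ⟨ε, hε⟩, hsup⟩ := h.exists_strictRule hne
      obtain ⟨a, ha⟩ := hs.degS.above
      have hF' : ∀ μ ∉ F, jPart s' μ 0 = 0 := by
        intro μ hμ
        by_contra hc
        rcases hsup μ hc with h | h | rfl
        exacts [h (hF1 μ hμ), h (hF2 μ hμ), hμ hF0]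
      refine hs.degS.trans (ih _ ?_ hε hF' rfl)
      rw [hn]
      exact ha.sum_defect_lt hε hs.not_sameData hF1 hF'

/-! ### Coverings of orbits -/

theorem weakRepresentsE_iff_iso {m n : ℕ} {P : Pencil m n} {s : Multiset KBlock} :
    WeakRepresentsE P s ↔ KMod.Iso (KMod.sum s.toList) (KMod.ofMat P) := by
  rw [KMod.weakRepresentsE_iff]
  refine ⟨fun ⟨l, hl, h⟩ => (KMod.iso_toList ?_).trans h, fun h => ⟨_, s.coe_toList, h⟩⟩
  rw [hl]
  exact ⟨rfl, rfl, fun _ => rfl⟩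

theorem exists_weakRepresentsE {m n : ℕ} (P : Pencil m n) : ∃ s, WeakRepresentsE P s := by
  obtain ⟨l, hl⟩ := KMod.isSum (KMod.ofMat P)
  exact ⟨l, (KMod.weakRepresentsE_iff P l).2 ⟨l, rfl, hl⟩⟩

theorem WeakRepresentsE.rowsOf_eq {m n : ℕ} {P : Pencil m n} {s : Multiset KBlock}
    (h : WeakRepresentsE P s) : rowsOf s = m := by
  obtain ⟨l, hm, -, rfl, -⟩ := h
  rw [← rowsSum_eq, hm]

theorem WeakRepresentsE.colsOf_eq {m n : ℕ} {P : Pencil m n} {s : Multiset KBlock}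
    (h : WeakRepresentsE P s) : colsOf s = n := by
  obtain ⟨l, -, hn, rfl, -⟩ := h
  rw [← colsSum_eq, hn]

theorem exists_pencil {m n : ℕ} {s : Multiset KBlock} (hm : rowsOf s = m) (hn : colsOf s = n) :
    ∃ P : Pencil m n, WeakRepresentsE P s := by
  have hm' : rowsSum s.toList = m := by rw [rowsSum_eq, Multiset.coe_toList, hm]
  have hn' : colsSum s.toList = n := by rw [colsSum_eq, Multiset.coe_toList, hn]
  exact ⟨Pencil.cast hm' hn' (pencilOfList s.toList), s.toList, hm', hn', s.coe_toList,
    (KMod.ofMat_iso_iff_strictEquiv _ _).1 (KMod.Iso.refl _)⟩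

theorem WeakRepresentsE.strictEquiv_iff {m n : ℕ} {P Q : Pencil m n} {s t : Multiset KBlock}
    (hs : WeakRepresentsE P s) (ht : WeakRepresentsE Q t) :
    Pencil.StrictEquiv P Q ↔ SameData s t := by
  rw [weakRepresentsE_iff_iso] at hs ht
  rw [← KMod.ofMat_iso_iff_strictEquiv]
  refine ⟨fun h => ?_, fun h => hs.symm.trans ((KMod.iso_toList ?_).trans ht)⟩
  · have h' := (hs.trans h).trans ht.symm
    have h1 : DegS s t := (KMod.Deg.refl _).of_iso (KMod.Iso.refl _) h'
    have h2 : DegS t s := (KMod.Deg.refl _).of_iso h' (KMod.Iso.refl _)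
    obtain ⟨δ, hδ⟩ := h1.above
    obtain ⟨ε, hε⟩ := h2.above
    exact hδ.sameData hε
  · rwa [Multiset.coe_toList]

theorem WeakRepresentsE.of_sameData {m n : ℕ} {P : Pencil m n} {s t : Multiset KBlock}
    (hs : WeakRepresentsE P s) (h : SameData t s) : WeakRepresentsE P t := by
  rw [weakRepresentsE_iff_iso] at hs ⊢
  exact (KMod.iso_toList (by rwa [Multiset.coe_toList])).trans hs

theorem WeakRepresentsE.orbE_subset_iff {m n : ℕ} {P Q : Pencil m n} {s t : Multiset KBlock}
    (hs : WeakRepresentsE P s) (ht : WeakRepresentsE Q t) :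
    Pencil.orbE Q ⊆ closure (Pencil.orbE P) ↔ ∃ δ, Above δ s t := by
  have hs' := weakRepresentsE_iff_iso.1 hs
  have ht' := weakRepresentsE_iff_iso.1 ht
  constructor
  · intro h
    have hQ : Q ∈ Pencil.orbE Q := (KMod.ofMat_iso_iff_strictEquiv _ _).1 (KMod.Iso.refl _)
    have := KMod.wGe_of_subset_closure hs' ht' (h hQ)
    rw [Multiset.coe_toList, Multiset.coe_toList] at this
    exact this.above (ht.rowsOf_eq.trans hs.rowsOf_eq.symm) (ht.colsOf_eq.trans hs.colsOf_eq.symm)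
  · rintro ⟨δ, hδ⟩ X hX
    refine closure_mono (fun Y hY => ?_)
      (hδ.degS m n X (ht'.trans ((KMod.ofMat_iso_iff_strictEquiv _ _).2 hX)))
    exact (KMod.ofMat_iso_iff_strictEquiv _ _).1 (hs'.symm.trans hY)

theorem StrictRule.rules {s1 s2 : Multiset KBlock} (h : StrictRule s1 s2) :
    RuleC1 s1 s2 ∨ RuleC2 s1 s2 ∨ RuleC3 s1 s2 ∨ RuleC4 s1 s2 := by
  rcases h with h | h | h | h | h | h
  · exact Or.inl (Or.inl h)
  · refine Or.inl (Or.inr ?_)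
    simpa only [StepR, rPart_map_dualBlock, lPart_map_dualBlock, jPart_map_dualBlock] using h
  · obtain ⟨c, μ, d, -, h⟩ := h
    exact Or.inr (Or.inl (Or.inl ⟨c, μ, d, h⟩))
  · obtain ⟨c, μ, d, -, h⟩ := h
    refine Or.inr (Or.inl (Or.inr ⟨c, μ, d, ?_⟩))
    simpa only [rPart_map_dualBlock, lPart_map_dualBlock, jPart_map_dualBlock] using h
  · exact Or.inr (Or.inr (Or.inl h))
  · exact Or.inr (Or.inr (Or.inr h))

theorem strictRule_of_rules {s1 s2 : Multiset KBlock} (hr : rowsOf s2 = rowsOf s1)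
    (hc : colsOf s2 = colsOf s1)
    (h : RuleC1 s1 s2 ∨ RuleC2 s1 s2 ∨ RuleC3 s1 s2 ∨ RuleC4 s1 s2) : StrictRule s1 s2 := by
  have e1 := KMod.rowsOf_add_rPart s1
  have e2 := KMod.rowsOf_add_rPart s2
  rcases h with (h | h) | (⟨c, μ, d, h⟩ | ⟨c, μ, d, h⟩) | h | h
  · exact Or.inl h
  · refine Or.inr (Or.inl ?_)
    simpa only [StepR, rPart_map_dualBlock, lPart_map_dualBlock, jPart_map_dualBlock] using h
  · refine Or.inr (Or.inr (Or.inl ⟨c, μ, d, Nat.one_le_iff_ne_zero.2 ?_, h⟩))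
    rintro rfl
    obtain ⟨h1, -, h2, -, -, -, -, h3⟩ := h
    rw [h2, h3, Function.update_self] at e2
    omega
  · refine Or.inr (Or.inr (Or.inr (Or.inl ⟨c, μ, d, Nat.one_le_iff_ne_zero.2 ?_, ?_⟩)))
    · rintro rfl
      obtain ⟨h1, -, h2, -, -, -, -, h3⟩ := h
      rw [h2, h3, Function.update_self] at e2
      omega
    · simpa only [rPart_map_dualBlock, lPart_map_dualBlock, jPart_map_dualBlock] using h
  · exact Or.inr (Or.inr (Or.inr (Or.inr (Or.inl h))))
  · exact Or.inr (Or.inr (Or.inr (Or.inr (Or.inr h))))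

/-- **Theorem 2.3**: `orbᵉ P1` covers `orbᵉ P2` if and only if the partitions
`R`, `L`, `J_μ` of `P2` are obtained from those of `P1` by applying exactly one
of the coin-move rules C1–C4. -/
theorem coversE_iff_coinRules {m n : ℕ} (P1 P2 : Pencil m n) :
    Pencil.CoversE P1 P2 ↔
      ∃ s1 s2 : Multiset KBlock, WeakRepresentsE P1 s1 ∧ WeakRepresentsE P2 s2 ∧
        (RuleC1 s1 s2 ∨ RuleC2 s1 s2 ∨ RuleC3 s1 s2 ∨ RuleC4 s1 s2) := by
  constructor
  · rintro ⟨hne, hle, hmin⟩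
    obtain ⟨s1, h1⟩ := exists_weakRepresentsE P1
    obtain ⟨s2, h2⟩ := exists_weakRepresentsE P2
    obtain ⟨δ, hδ⟩ := (h1.orbE_subset_iff h2).1 hle
    obtain ⟨s, hs, ⟨ε, hε⟩, -⟩ := hδ.exists_strictRule (mt (h1.strictEquiv_iff h2).2 hne)
    obtain ⟨a, ha⟩ := hs.degS.above
    obtain ⟨P, hP⟩ := exists_pencil (ha.rows.trans h1.rowsOf_eq) (ha.cols.trans h1.colsOf_eq)
    have hP2 : Pencil.StrictEquiv P P2 := by
      by_contra hP2
      refine hmin ⟨P, fun h => ?_, hP2, (h1.orbE_subset_iff hP).2 ⟨a, ha⟩,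
        (hP.orbE_subset_iff h2).2 ⟨ε, hε⟩⟩
      exact hs.not_sameData ((hP.strictEquiv_iff h1).1 h).symm
    exact ⟨s1, s, h1, h2.of_sameData ((hP.strictEquiv_iff h2).1 hP2), hs.rules⟩
  · rintro ⟨s1, s2, h1, h2, h⟩
    have hs := strictRule_of_rules (h2.rowsOf_eq.trans h1.rowsOf_eq.symm)
      (h2.colsOf_eq.trans h1.colsOf_eq.symm) h
    refine ⟨mt (h1.strictEquiv_iff h2).1 hs.not_sameData,
      (h1.orbE_subset_iff h2).2 hs.degS.above, ?_⟩
    rintro ⟨P, hP1, hP2, hle1, hle2⟩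
    obtain ⟨s, hP⟩ := exists_weakRepresentsE P
    obtain ⟨a, ha⟩ := (h1.orbE_subset_iff hP).1 hle1
    obtain ⟨b, hb⟩ := (hP.orbE_subset_iff h2).1 hle2
    rcases hs.eq_or_eq ha hb with e | e
    · exact hP1 ((hP.strictEquiv_iff h1).2 e)
    · exact hP2 ((hP.strictEquiv_iff h2).2 e)
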